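/- Let γ be a relatively extremal knot in ℝⁿ (n ≥ 2) with image K whose generalized curvature κγ is not identically equal to R_O(K)^{-1}. Then i(K,ℝⁿ) = MDC(K)/2. Equivalently: if a relatively extremal knot γ satisfies MDC(K)/2 > R_O(K) = F_k(γ), then κγ(s) = F_k(γ)^{-1} for every s. -/

import Mathlib

open Set Filter MeasureTheory
open scoped RealInnerProductSpace Topology ENNReal

noncomputable section

/-- Euclidean space `ℝⁿ`. -/
abbrev Euc (n : ℕ) := EuclideanSpace ℝ (Fin n)

/-- Generalized curvature `κγ(s)` of a curve with derivative `γd` and parameter domain `D`: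
the limsup, as `x, y → s` with `x ≠ y`, of `∠(γd x, γd y) / |x - y|`, expressed as the
infimum of all eventual bounds. -/
def curvAt {n : ℕ} (γd : ℝ → Euc n) (D : Set ℝ) (s : ℝ) : ℝ :=
  sInf {Λ : ℝ | 0 ≤ Λ ∧ ∃ δ > 0, ∀ x ∈ D, ∀ y ∈ D, x ≠ y →
    |x - s| < δ → |y - s| < δ →
    InnerProductGeometry.angle (γd x) (γd y) ≤ Λ * |x - y|}

/-- `κγ(s) < Λ`: there are `δ > 0` and `Λ' < Λ` bounding the angle dilation near `s`. -/
def CurvLt {n : ℕ} (γd : ℝ → Euc n) (D : Set ℝ) (s Λ : ℝ) : Prop :=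
  ∃ δ > 0, ∃ Λ' < Λ, ∀ x ∈ D, ∀ y ∈ D, x ≠ y → |x - s| < δ → |y - s| < δ →
    InnerProductGeometry.angle (γd x) (γd y) ≤ Λ' * |x - y|

/-- `f` restricted to `[a, c]` is a planar circular arc of radius `1/Λ`
of length in `[0, 2π/Λ)`. -/
def IsArc {n : ℕ} (Λ : ℝ) (f : ℝ → Euc n) (a c : ℝ) : Prop :=
  c - a < 2 * Real.pi / Λ ∧
  ∃ (o u e : Euc n) (s₁ : ℝ), ‖u‖ = 1 ∧ ‖e‖ = 1 ∧ ⟪u, e⟫ = 0 ∧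
    ∀ s ∈ Icc a c,
      f s = o + (Λ⁻¹ * Real.cos (Λ * (s - s₁))) • u + (Λ⁻¹ * Real.sin (Λ * (s - s₁))) • e

/-- `f` restricted to `[a, c]` is a planar circular arc of radius `r`. -/
def IsArcR {n : ℕ} (r : ℝ) (f : ℝ → Euc n) (a c : ℝ) : Prop :=
  ∃ (o u e : Euc n) (s₁ : ℝ), ‖u‖ = 1 ∧ ‖e‖ = 1 ∧ ⟪u, e⟫ = 0 ∧
    ∀ s ∈ Icc a c,
      f s = o + (r * Real.cos ((s - s₁) / r)) • u + (r * Real.sin ((s - s₁) / r)) • e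

/-- `O_p(v, r)`: the union of the open balls of radius `r` tangent to `v^⊥` at `p`. -/
def Odisk {n : ℕ} (p v : Euc n) (r : ℝ) : Set (Euc n) :=
  {x | ∃ w : Euc n, ‖w‖ = 1 ∧ ⟪w, v⟫ = 0 ∧ ‖x - p - r • w‖ < r}

/-- Ball radius `R_O` of the curve `f` (with derivative/tangent field `γd`) on domain `D`. -/
def RO {n : ℕ} (f γd : ℝ → Euc n) (D : Set ℝ) : ℝ :=
  sInf {r : ℝ | 0 < r ∧ ∃ s ∈ D, ∃ t ∈ D, ∃ w : Euc n,
    ‖w‖ = 1 ∧ ⟪w, γd s⟫ = 0 ∧ ‖f t - f s - r • w‖ < r}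

/-- Minimal double critical distance of the curve `f` with tangent field `γd`. -/
def MDC {n : ℕ} (f γd : ℝ → Euc n) : ℝ :=
  sInf {d : ℝ | ∃ x y : ℝ, f x ≠ f y ∧ ⟪f x - f y, γd x⟫ = 0 ∧
    ⟪f x - f y, γd y⟫ = 0 ∧ d = ‖f x - f y‖}

/-- Normal injectivity radius `i(K, ℝⁿ)` of the curve `f` with tangent field `γd`. -/
def injRad {n : ℕ} (f γd : ℝ → Euc n) : ℝ :=
  sSup ({0} ∪ {r : ℝ | 0 < r ∧ ∀ s t : ℝ, ∀ u w : Euc n,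
    ⟪u, γd s⟫ = 0 → ⟪w, γd t⟫ = 0 → ‖u‖ < r → ‖w‖ < r →
    f s + u = f t + w → f s = f t ∧ u = w})

/-- A knot: a simple closed unit-speed `C^{1,1}` curve, as an `L`-periodic map `ℝ → ℝⁿ`,
injective on `[0, L)`, with `‖γ'‖ ≡ 1` and `γ'` Lipschitz. -/
structure Knot (n : ℕ) where
  L : ℝ
  Lpos : 0 < L
  f : ℝ → Euc n
  fd : ℝ → Euc n
  per : ∀ s, f (s + L) = f s
  perd : ∀ s, fd (s + L) = fd s
  deriv : ∀ s, HasDerivAt f (fd s) s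
  unit : ∀ s, ‖fd s‖ = 1
  lipd : ∃ C : NNReal, LipschitzWith C fd
  inj : InjOn f (Ico 0 L)

/-- Ropelength `ℓ_e(γ) = L / R_O(K)`. -/
def Knot.ropelength {n : ℕ} (k : Knot n) : ℝ := k.L / RO k.f k.fd univ

/-- The set `I_c` of parameters realizing the minimal double critical distance. -/
def Knot.Ic {n : ℕ} (k : Knot n) : Set ℝ :=
  {x | ∃ y : ℝ, k.f x ≠ k.f y ∧ ⟪k.f x - k.f y, k.fd x⟫ = 0 ∧
    ⟪k.f x - k.f y, k.fd y⟫ = 0 ∧ ‖k.f x - k.f y‖ = MDC k.f k.fd}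

/-- `sup_s κγ(s)` for a knot. -/
def Knot.supCurv {n : ℕ} (k : Knot n) : ℝ := ⨆ s : ℝ, curvAt k.fd univ s

/-- Analytic focal distance `F_k(γ) = (sup_s κγ(s))⁻¹`. -/
def Knot.Fk {n : ℕ} (k : Knot n) : ℝ := (k.supCurv)⁻¹

/-- Two knots are in the same knot class: after rescaling their domains to `ℝ/ℤ`
(realized by `1`-periodic maps `ℝ → ℝⁿ`), they are joined by a continuous homotopy
through injective loops. -/
def SameKnotClass {n : ℕ} (k₁ k₂ : Knot n) : Prop :=
  ∃ H : ℝ → ℝ → Euc n,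
    ContinuousOn (fun z : ℝ × ℝ => H z.1 z.2) (Icc 0 1 ×ˢ univ) ∧
    (∀ t s, H t (s + 1) = H t s) ∧
    (∀ s, H 0 s = k₁.f (k₁.L * s)) ∧
    (∀ s, H 1 s = k₂.f (k₂.L * s)) ∧
    ∀ t ∈ Icc (0 : ℝ) 1, InjOn (H t) (Ico 0 1)

/-- A knot is relatively extremal: a relative minimum of ropelength within its knot class
with respect to the `C¹` topology (on rescaled parametrizations). -/
def RelativelyExtremal {n : ℕ} (k : Knot n) : Prop :=
  ∃ ε > 0, ∀ η : Knot n, SameKnotClass k η →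
    (∀ s : ℝ, ‖η.f (η.L * s) - k.f (k.L * s)‖ +
      ‖η.L • η.fd (η.L * s) - k.L • k.fd (k.L * s)‖ < ε) →
    k.ropelength ≤ η.ropelength

/-- The class `C(p, q; v, w; Λ)`: unit-speed `C^{1,1}` curves `γ : [0, L] → ℝⁿ`
(`L` not fixed) from `p` to `q` with initial/terminal directions `v, w`
and `Λ`-Lipschitz derivative (curvature at most `Λ`). -/
structure CurveCC (n : ℕ) (p q v w : Euc n) (Λ : ℝ) where
  L : ℝ
  Lnn : 0 ≤ L
  f : ℝ → Euc n
  fd : ℝ → Euc n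
  deriv : ∀ s ∈ Icc (0 : ℝ) L, HasDerivWithinAt f (fd s) (Icc 0 L) s
  unit : ∀ s ∈ Icc (0 : ℝ) L, ‖fd s‖ = 1
  lip : LipschitzOnWith Λ.toNNReal fd (Icc 0 L)
  i0 : f 0 = p
  id0 : fd 0 = v
  iL : f L = q
  idL : fd L = w

/-- A `C¹` closed curve of period `L` with nowhere-vanishing derivative. -/
structure ClosedC1 (n : ℕ) (L : ℝ) where
  f : ℝ → Euc n
  fd : ℝ → Euc n
  per : ∀ s, f (s + L) = f s
  perd : ∀ s, fd (s + L) = fd s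
  deriv : ∀ s, HasDerivAt f (fd s) s
  nz : ∀ s, fd s ≠ 0

/-- A simple closed `C^{1,1}` curve of period `L` with nowhere-vanishing derivative. -/
structure ClosedC11 (n : ℕ) (L : ℝ) extends ClosedC1 n L where
  lipd : ∃ C : NNReal, LipschitzWith C fd
  inj : InjOn f (Ico 0 L)

/-- The unit tangent field of `c` is `C`-Lipschitz with respect to the arclength of `c`. -/
def TangentLip {n : ℕ} {L : ℝ} (c : ClosedC1 n L) (C : ℝ) : Prop :=
  ∀ x y : ℝ, x ≤ y →
    ‖‖c.fd y‖⁻¹ • c.fd y - ‖c.fd x‖⁻¹ • c.fd x‖ ≤ C * ∫ t in x..y, ‖c.fd t‖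

/-- Pointwise geometric focal distance `F_g(γ(s))` of the curve `f` with domain `D`. -/
def FgPt {n : ℕ} (f fd : ℝ → Euc n) (D : Set ℝ) (s : ℝ) : ℝ :=
  sInf {r : ℝ | 0 < r ∧ f s ∈ closure (Odisk (f s) (fd s) r ∩ (f '' D))}

end

lemma continuous_of_norm_sub_le {E : Type*} [NormedAddCommGroup E] {T : ℝ → E} {Λ : ℝ}
    (hT : ∀ x y, ‖T x - T y‖ ≤ Λ * |x - y|) : Continuous T := by
  refine (LipschitzWith.of_dist_le_mul (K := Λ.toNNReal) fun x y => ?_).continuous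
  rw [dist_eq_norm, Real.dist_eq]
  exact (hT x y).trans (by gcongr; exact Real.le_coe_toNNReal Λ)

lemma norm_sub_reverse_le {E : Type*} [NormedAddCommGroup E] {T : ℝ → E} {Λ : ℝ}
    (hT : ∀ x y, ‖T x - T y‖ ≤ Λ * |x - y|) (x y : ℝ) :
    ‖-T (-x) - -T (-y)‖ ≤ Λ * |x - y| := by
  have := hT (-y) (-x)
  rwa [show -T (-x) - -T (-y) = T (-y) - T (-x) by abel,
    show |x - y| = |-y - -x| by congr 1; ring]

section UnitFields

variable {E : Type*} [NormedAddCommGroup E] [InnerProductSpace ℝ E]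

lemma norm_sub_eq_two_mul_sin_half_angle {u v : E} (hu : ‖u‖ = 1) (hv : ‖v‖ = 1) :
    ‖u - v‖ = 2 * Real.sin (InnerProductGeometry.angle u v / 2) := by
  set θ := InnerProductGeometry.angle u v with hθ
  have h0 : 0 ≤ θ := InnerProductGeometry.angle_nonneg u v
  have h1 : θ ≤ Real.pi := InnerProductGeometry.angle_le_pi u v
  have hs : 0 ≤ Real.sin (θ / 2) :=
    Real.sin_nonneg_of_nonneg_of_le_pi (by linarith) (by linarith)
  have hc : ⟪u, v⟫ = Real.cos θ := by
    rw [hθ, InnerProductGeometry.cos_angle, hu, hv]; simp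
  have hcos : Real.cos θ = 1 - 2 * Real.sin (θ / 2) ^ 2 := by
    have := Real.cos_sq_add_sin_sq (θ / 2)
    have h2 := Real.cos_two_mul (θ / 2)
    rw [show 2 * (θ / 2) = θ by ring] at h2
    linarith
  have hsq : ‖u - v‖ ^ 2 = (2 * Real.sin (θ / 2)) ^ 2 := by
    rw [norm_sub_sq_real, hu, hv, hc, hcos]; ring
  exact (pow_left_inj₀ (norm_nonneg _) (by positivity) two_ne_zero).1 hsq

lemma norm_sub_le_angle {u v : E} (hu : ‖u‖ = 1) (hv : ‖v‖ = 1) :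
    ‖u - v‖ ≤ InnerProductGeometry.angle u v := by
  rw [norm_sub_eq_two_mul_sin_half_angle hu hv]
  have := Real.sin_le (x := InnerProductGeometry.angle u v / 2)
    (by linarith [InnerProductGeometry.angle_nonneg u v])
  linarith

/-- For nearby unit vectors, the angle is asymptotically bounded by the chord. -/
lemma exists_angle_le_mul_norm_sub {k : ℝ} (hk : 1 < k) :
    ∃ ρ > 0, ∀ u v : E, ‖u‖ = 1 → ‖v‖ = 1 → ‖u - v‖ ≤ ρ →
      InnerProductGeometry.angle u v ≤ k * ‖u - v‖ := by
  have hk0 : 0 < 1 - 1 / k := by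
    rw [sub_pos, div_lt_one (by linarith)]; exact hk
  refine ⟨min 1 (1 - 1 / k), by positivity, fun u v hu hv h => ?_⟩
  set θ := InnerProductGeometry.angle u v with hθ
  have h0 : 0 ≤ θ := InnerProductGeometry.angle_nonneg u v
  have h1 : θ ≤ Real.pi := InnerProductGeometry.angle_le_pi u v
  have hn := norm_sub_eq_two_mul_sin_half_angle hu hv
  rw [← hθ] at hn
  rw [hn] at h ⊢
  rcases h0.eq_or_lt with h0 | h0
  · simp [← h0]
  have hm := Real.mul_le_sin (x := θ / 2) (by linarith) (by linarith)
  have hp4 := Real.pi_lt_four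
  have hp := Real.pi_pos
  have hθs : θ ≤ Real.pi / 2 * (2 * Real.sin (θ / 2)) := by
    have : 2 / Real.pi * (θ / 2) = θ / Real.pi := by field_simp
    rw [this, div_le_iff₀ hp] at hm
    linarith
  have hmin1 := min_le_left (1 : ℝ) (1 - 1 / k)
  have hmin2 := min_le_right (1 : ℝ) (1 - 1 / k)
  have hθ2 : θ ≤ 2 * (2 * Real.sin (θ / 2)) := by nlinarith
  have ha1 : θ / 2 ≤ 1 := by linarith
  have ha2 : θ / 2 ≤ 1 - 1 / k := by linarith
  have hc := Real.sin_gt_sub_cube (x := θ / 2) (by linarith)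
  have hkk : (1 / k) * k = 1 := by field_simp
  have h5 : (θ / 2) * (1 / k) ≤ Real.sin (θ / 2) := by
    nlinarith [mul_nonneg h0.le (sub_nonneg.2 ha2), mul_nonneg h0.le (sub_nonneg.2 ha1),
      mul_nonneg (mul_nonneg h0.le h0.le) (sub_nonneg.2 ha1)]
  have h6 : (θ / 2) * (1 / k) * k ≤ Real.sin (θ / 2) * k := by gcongr
  rw [mul_assoc, hkk] at h6
  linarith

/-- A local angle dilation bound along a continuous unit field is global. -/
lemma angle_le_of_local {T : ℝ → E} (hc : Continuous T) (hu : ∀ x, ‖T x‖ = 1) {Λ : ℝ}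
    (h : ∀ s, ∃ δ > 0, ∀ x y, x ≠ y → |x - s| < δ → |y - s| < δ →
      InnerProductGeometry.angle (T x) (T y) ≤ Λ * |x - y|) (x y : ℝ) :
    InnerProductGeometry.angle (T x) (T y) ≤ Λ * |x - y| := by
  have hne : ∀ x, T x ≠ 0 := fun x h0 => by simpa [h0] using hu x
  wlog hxy : x ≤ y generalizing x y
  · rw [InnerProductGeometry.angle_comm, abs_sub_comm]
    exact this y x (le_of_not_ge hxy)
  have hcl : IsClosed ({z | InnerProductGeometry.angle (T x) (T z) ≤ Λ * (z - x)} ∩ Icc x y) := by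
    refine IsClosed.inter (isClosed_le ?_ (by fun_prop)) isClosed_Icc
    unfold InnerProductGeometry.angle
    refine Real.continuous_arccos.comp ?_
    simp only [hu]
    fun_prop
  have key : Icc x y ⊆ {z | InnerProductGeometry.angle (T x) (T z) ≤ Λ * (z - x)} := by
    refine IsClosed.Icc_subset_of_forall_exists_gt hcl ?_ ?_
    · simp [InnerProductGeometry.angle_self (hne x)]
    · rintro z ⟨hz, -⟩ w hw
      obtain ⟨δ, hδ, hloc⟩ := h z
      have hw' : z < w := hw
      refine ⟨min w (z + δ / 2), ?_, lt_min hw' (by linarith), min_le_left _ _⟩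
      have h1 : z < min w (z + δ / 2) := lt_min hw' (by linarith)
      have h2 : min w (z + δ / 2) ≤ z + δ / 2 := min_le_right _ _
      have := hloc z (min w (z + δ / 2)) h1.ne (by simpa using hδ)
        (by rw [abs_of_pos (by linarith)]; linarith)
      have htri := InnerProductGeometry.angle_le_angle_add_angle (T x) (T z)
        (T (min w (z + δ / 2)))
      rw [abs_sub_comm, abs_of_pos (by linarith)] at this
      simp only [mem_ofPred_eq] at hz ⊢
      linarith
  have := key (right_mem_Icc.2 hxy)
  rw [abs_sub_comm, abs_of_nonneg (by linarith)]
  exact this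

lemma angle_le_of_norm_sub_le {T : ℝ → E} (hu : ∀ x, ‖T x‖ = 1) {Λ : ℝ} (hΛ : 0 < Λ)
    (hT : ∀ x y, ‖T x - T y‖ ≤ Λ * |x - y|) (x y : ℝ) :
    InnerProductGeometry.angle (T x) (T y) ≤ Λ * |x - y| := by
  have hc := continuous_of_norm_sub_le hT
  have key : ∀ k > (1 : ℝ), InnerProductGeometry.angle (T x) (T y) ≤ k * (Λ * |x - y|) := by
    intro k hk
    obtain ⟨ρ, hρ, h⟩ := exists_angle_le_mul_norm_sub (E := E) hk
    rw [← mul_assoc]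
    refine angle_le_of_local hc hu (fun s => ⟨ρ / (2 * Λ), by positivity, fun x y _ hx hy => ?_⟩) x y
    have hd : |x - y| ≤ ρ / Λ := by
      have := abs_sub_le x s y
      rw [abs_sub_comm s y] at this
      have h2 : ρ / (2 * Λ) + ρ / (2 * Λ) = ρ / Λ := by field_simp; ring
      linarith
    have h1 : ‖T x - T y‖ ≤ ρ := by
      refine (hT x y).trans ?_
      rw [le_div_iff₀ hΛ] at hd
      linarith
    refine (h _ _ (hu x) (hu y) h1).trans ?_
    rw [mul_assoc]
    gcongr
    exact hT x y
  have h2 : Tendsto (fun k : ℝ => k * (Λ * |x - y|)) (𝓝[>] 1) (𝓝 (1 * (Λ * |x - y|))) :=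
    ((continuous_id.mul continuous_const).tendsto 1).mono_left nhdsWithin_le_nhds
  rw [one_mul] at h2
  exact ge_of_tendsto h2 (eventually_nhdsWithin_of_forall key)

lemma cos_le_inner_of_norm_sub_le {T : ℝ → E} (hu : ∀ x, ‖T x‖ = 1) {Λ : ℝ} (hΛ : 0 < Λ)
    (hT : ∀ x y, ‖T x - T y‖ ≤ Λ * |x - y|) {x y : ℝ} (hxy : Λ * |x - y| ≤ Real.pi) :
    Real.cos (Λ * |x - y|) ≤ ⟪T x, T y⟫ := by
  have h1 : ⟪T x, T y⟫ = Real.cos (InnerProductGeometry.angle (T x) (T y)) := by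
    rw [InnerProductGeometry.cos_angle, hu, hu]; simp
  rw [h1]
  exact Real.cos_le_cos_of_nonneg_of_le_pi (InnerProductGeometry.angle_nonneg _ _) hxy
    (angle_le_of_norm_sub_le hu hΛ hT x y)

end UnitFields

section BoundedCurvature

variable {E : Type*} [NormedAddCommGroup E] [InnerProductSpace ℝ E]
  {f T : ℝ → E} {Λ : ℝ}

lemma sin_div_le_inner_sub_left (hf : ∀ s, HasDerivAt f (T s) s) (hu : ∀ x, ‖T x‖ = 1)
    (hΛ : 0 < Λ) (hT : ∀ x y, ‖T x - T y‖ ≤ Λ * |x - y|) (x : ℝ) {h : ℝ} (h0 : 0 ≤ h)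
    (h1 : Λ * h ≤ Real.pi) :
    Real.sin (Λ * h) / Λ ≤ ⟪f (x + h) - f x, T x⟫ := by
  have hd : ∀ t, HasDerivAt (fun t => ⟪f (x + t) - f x, T x⟫ - Real.sin (Λ * t) / Λ)
      (⟪T (x + t), T x⟫ - Real.cos (Λ * t)) t := by
    intro t
    have hft : HasDerivAt (fun t => f (x + t) - f x) (T (x + t)) t :=
      ((hf (x + t)).comp_const_add x t).sub_const _
    have h2 : HasDerivAt (fun t => Real.sin (Λ * t) / Λ) (Real.cos (Λ * t)) t := by
      have := (((hasDerivAt_id t).const_mul Λ).sin).div_const Λ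
      refine this.congr_deriv ?_
      simp only [id]
      field_simp
    have h3 := hft.inner ℝ (hasDerivAt_const t (T x))
    exact (h3.sub h2).congr_deriv (by simp)
  have hmono : MonotoneOn (fun t => ⟪f (x + t) - f x, T x⟫ - Real.sin (Λ * t) / Λ)
      (Icc 0 h) := by
    refine monotoneOn_of_deriv_nonneg (convex_Icc 0 h)
      (fun t _ => (hd t).continuousAt.continuousWithinAt)
      (fun t _ => (hd t).differentiableAt.differentiableWithinAt) ?_
    intro t ht
    rw [interior_Icc] at ht
    rw [(hd t).deriv]
    have hab : |x + t - x| = t := by rw [add_sub_cancel_left, abs_of_pos ht.1]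
    have := cos_le_inner_of_norm_sub_le hu hΛ hT (x := x + t) (y := x)
      (by rw [hab]; nlinarith [ht.2])
    rw [hab] at this
    linarith
  have := hmono (left_mem_Icc.2 h0) (right_mem_Icc.2 h0) h0
  simp only [add_zero, sub_self, inner_zero_left, mul_zero, Real.sin_zero, zero_div] at this
  linarith

lemma hasDerivAt_reverse (hf : ∀ s, HasDerivAt f (T s) s) (s : ℝ) :
    HasDerivAt (fun s => f (-s)) (-T (-s)) s := by
  have := (hf (-s)).scomp s (hasDerivAt_neg s)
  exact this.congr_deriv (by simp)

lemma sin_div_le_inner_sub_right (hf : ∀ s, HasDerivAt f (T s) s) (hu : ∀ x, ‖T x‖ = 1)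
    (hΛ : 0 < Λ) (hT : ∀ x y, ‖T x - T y‖ ≤ Λ * |x - y|) (x : ℝ) {h : ℝ} (h0 : 0 ≤ h)
    (h1 : Λ * h ≤ Real.pi) :
    Real.sin (Λ * h) / Λ ≤ ⟪f (x + h) - f x, T (x + h)⟫ := by
  have := sin_div_le_inner_sub_left (hasDerivAt_reverse hf) (fun x => by rw [norm_neg, hu]) hΛ
    (norm_sub_reverse_le hT) (-(x + h)) h0 h1
  simp only [neg_add_rev, neg_neg, inner_neg_right] at this
  rw [← inner_neg_left] at this
  convert this using 2
  rw [show -h + (x + h) = x by ring]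
  abel

/-- Schur's comparison of chords, for chords spanning at most a full turn. -/
lemma two_mul_sin_div_le_norm_sub (hf : ∀ s, HasDerivAt f (T s) s) (hu : ∀ x, ‖T x‖ = 1)
    (hΛ : 0 < Λ) (hT : ∀ x y, ‖T x - T y‖ ≤ Λ * |x - y|) (x : ℝ) {h : ℝ} (h0 : 0 ≤ h)
    (h1 : Λ * h ≤ Real.pi) :
    2 * Real.sin (Λ * h / 2) / Λ ≤ ‖f (x + h) - f x‖ := by
  have ha := sin_div_le_inner_sub_left hf hu hΛ hT (x + h / 2) (h := h / 2) (by linarith)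
    (by linarith [mul_nonneg hΛ.le h0])
  have hb := sin_div_le_inner_sub_right hf hu hΛ hT x (h := h / 2) (by linarith)
    (by linarith [mul_nonneg hΛ.le h0])
  have hs : ⟪f (x + h) - f x, T (x + h / 2)⟫ =
      ⟪f (x + h / 2 + h / 2) - f (x + h / 2), T (x + h / 2)⟫ +
      ⟪f (x + h / 2) - f x, T (x + h / 2)⟫ := by
    rw [← inner_add_left, show x + h / 2 + h / 2 = x + h by ring]
    congr 1; abel
  have hle : ⟪f (x + h) - f x, T (x + h / 2)⟫ ≤ ‖f (x + h) - f x‖ := by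
    simpa [hu] using real_inner_le_norm (f (x + h) - f x) (T (x + h / 2))
  rw [show Λ * (h / 2) = Λ * h / 2 by ring] at ha hb
  have : 2 * Real.sin (Λ * h / 2) / Λ = Real.sin (Λ * h / 2) / Λ + Real.sin (Λ * h / 2) / Λ := by
    ring
  linarith

lemma inner_sq_add_inner_sq_le {z u w : E} (hu : ‖u‖ = 1) (hw : ‖w‖ = 1) (huw : ⟪w, u⟫ = 0) :
    ⟪z, u⟫ ^ 2 + ⟪z, w⟫ ^ 2 ≤ ‖z‖ ^ 2 := by
  have h := sq_nonneg ‖z - ⟪z, u⟫ • u - ⟪z, w⟫ • w‖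
  rw [norm_sub_sq_real, norm_sub_sq_real, inner_sub_left, norm_smul, norm_smul, hu, hw,
    inner_smul_right, inner_smul_right, inner_smul_right, real_inner_smul_left,
    real_inner_comm w u, huw] at h
  simp only [Real.norm_eq_abs, mul_one, sq_abs] at h
  nlinarith

/-- Up to a half turn, a curve with curvature at most `Λ` stays outside the open balls of
radius `1 / Λ` tangent to it. -/
lemma two_div_mul_inner_le_norm_sub_sq (hf : ∀ s, HasDerivAt f (T s) s) (hu : ∀ x, ‖T x‖ = 1)
    (hΛ : 0 < Λ) (hT : ∀ x y, ‖T x - T y‖ ≤ Λ * |x - y|) (x : ℝ) {h : ℝ} (h0 : 0 ≤ h)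
    (h1 : Λ * h ≤ Real.pi) {w : E} (hw : ‖w‖ = 1) (hwT : ⟪w, T x⟫ = 0) :
    2 / Λ * ⟪f (x + h) - f x, w⟫ ≤ ‖f (x + h) - f x‖ ^ 2 := by
  rcases le_total (Λ * h) (Real.pi / 2) with h2 | h2
  · have hd : ∀ t, HasDerivAt (fun t => ‖f (x + t) - f x‖ ^ 2 - 2 / Λ * ⟪f (x + t) - f x, w⟫)
        (2 * ⟪f (x + t) - f x, T (x + t)⟫ - 2 / Λ * ⟪T (x + t), w⟫) t := by
      intro t
      have hft : HasDerivAt (fun t => f (x + t) - f x) (T (x + t)) t :=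
        ((hf (x + t)).comp_const_add x t).sub_const _
      have h3 := hft.inner ℝ (hasDerivAt_const t w)
      exact (hft.norm_sq.sub (h3.const_mul (2 / Λ))).congr_deriv (by simp)
    have hmono : MonotoneOn
        (fun t => ‖f (x + t) - f x‖ ^ 2 - 2 / Λ * ⟪f (x + t) - f x, w⟫) (Icc 0 h) := by
      refine monotoneOn_of_deriv_nonneg (convex_Icc 0 h)
        (fun t _ => (hd t).continuousAt.continuousWithinAt)
        (fun t _ => (hd t).differentiableAt.differentiableWithinAt) ?_
      intro t ht
      rw [interior_Icc] at ht
      rw [(hd t).deriv]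
      have hth : Λ * t ≤ Real.pi / 2 := by nlinarith [ht.2]
      have ht0 : 0 ≤ Λ * t := mul_nonneg hΛ.le ht.1.le
      have hab : |x + t - x| = t := by rw [add_sub_cancel_left, abs_of_pos ht.1]
      have hcos := cos_le_inner_of_norm_sub_le hu hΛ hT (x := x + t) (y := x)
        (by rw [hab]; linarith [Real.pi_pos])
      rw [hab] at hcos
      have hsin := sin_div_le_inner_sub_right hf hu hΛ hT x ht.1.le (by linarith [Real.pi_pos])
      have hc0 : 0 ≤ Real.cos (Λ * t) := Real.cos_nonneg_of_mem_Icc ⟨by linarith, hth⟩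
      have hs0 : 0 ≤ Real.sin (Λ * t) :=
        Real.sin_nonneg_of_nonneg_of_le_pi ht0 (by linarith [Real.pi_pos])
      have hsq := inner_sq_add_inner_sq_le (z := T (x + t)) (hu x) hw hwT
      rw [hu] at hsq
      have hws : ⟪T (x + t), w⟫ ≤ Real.sin (Λ * t) := by
        refine le_of_sq_le_sq ?_ hs0
        nlinarith [Real.sin_sq_add_cos_sq (Λ * t)]
      have h5 : ⟪T (x + t), w⟫ / Λ ≤ Real.sin (Λ * t) / Λ := by gcongr
      have h6 : 2 / Λ * ⟪T (x + t), w⟫ = 2 * (⟪T (x + t), w⟫ / Λ) := by ring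
      linarith
    have := hmono (left_mem_Icc.2 h0) (right_mem_Icc.2 h0) h0
    simp only [add_zero, sub_self, inner_zero_left, mul_zero, norm_zero] at this
    linarith
  · set z := f (x + h) - f x with hz
    have hchord := two_mul_sin_div_le_norm_sub hf hu hΛ hT x h0 h1
    have hax := sin_div_le_inner_sub_left hf hu hΛ hT x h0 h1
    rw [← hz] at hchord hax
    have hsq := inner_sq_add_inner_sq_le (z := z) (hu x) hw hwT
    have hs0 : 0 ≤ Real.sin (Λ * h) :=
      Real.sin_nonneg_of_nonneg_of_le_pi (by positivity) h1
    have hs1 : 0 ≤ Real.sin (Λ * h / 2) :=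
      Real.sin_nonneg_of_nonneg_of_le_pi (by positivity) (by linarith [Real.pi_pos])
    have hcneg : Real.cos (Λ * h) ≤ 0 :=
      Real.cos_nonpos_of_pi_div_two_le_of_le h2 (by linarith [Real.pi_pos])
    have hhalf : Real.cos (Λ * h) = 1 - 2 * Real.sin (Λ * h / 2) ^ 2 := by
      have := Real.cos_sq_add_sin_sq (Λ * h / 2)
      have h2 := Real.cos_two_mul (Λ * h / 2)
      rw [show 2 * (Λ * h / 2) = Λ * h by ring] at h2
      linarith
    rw [div_le_iff₀ hΛ] at hchord hax
    set A := ‖z‖ * Λ with hA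
    set B := ⟪z, T x⟫ * Λ with hB
    set W := ⟪z, w⟫ * Λ with hW
    have hsqΛ : B ^ 2 + W ^ 2 ≤ A ^ 2 := by
      have := mul_le_mul_of_nonneg_right hsq (sq_nonneg Λ)
      rw [hA, hB, hW]; nlinarith
    have hA2 : 4 * Real.sin (Λ * h / 2) ^ 2 ≤ A ^ 2 := by
      have := pow_le_pow_left₀ (by positivity) hchord 2
      nlinarith
    have hB2 : Real.sin (Λ * h) ^ 2 ≤ B ^ 2 := pow_le_pow_left₀ hs0 hax 2
    have hcs := Real.sin_sq_add_cos_sq (Λ * h)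
    have hgoal : 2 * W ≤ A ^ 2 := by
      refine le_of_sq_le_sq ?_ (sq_nonneg A)
      have h7 : -Real.cos (Λ * h) ≤ A ^ 2 / 2 - 1 := by linarith
      have h8 : (-Real.cos (Λ * h)) ^ 2 ≤ (A ^ 2 / 2 - 1) ^ 2 :=
        pow_le_pow_left₀ (by linarith) h7 2
      nlinarith
    have h9 : 2 / Λ * ⟪z, w⟫ = 2 * W / Λ ^ 2 := by rw [hW]; field_simp
    have h10 : ‖z‖ ^ 2 = A ^ 2 / Λ ^ 2 := by rw [hA]; field_simp
    rw [h9, h10]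
    gcongr

end BoundedCurvature

namespace Knot

variable {n : ℕ} (k : Knot n)

lemma continuous_f : Continuous k.f :=
  continuous_iff_continuousAt.2 fun s => (k.deriv s).continuousAt

lemma continuous_fd : Continuous k.fd := by
  obtain ⟨C, hC⟩ := k.lipd
  exact hC.continuous

lemma exists_mem_Ico_eq (s t : ℝ) :
    ∃ h ∈ Ico 0 k.L, k.f t = k.f (s + h) ∧ k.fd t = k.fd (s + h) := by
  obtain ⟨m, hm, -⟩ := existsUnique_add_zsmul_mem_Ico k.Lpos (t - s) 0
  refine ⟨t - s + m • k.L, by simpa using hm, ?_, ?_⟩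
  · have h : Function.Periodic k.f k.L := k.per
    rw [show s + (t - s + m • k.L) = t + m • k.L by ring, h.zsmul m t]
  · have h : Function.Periodic k.fd k.L := k.perd
    rw [show s + (t - s + m • k.L) = t + m • k.L by ring, h.zsmul m t]

lemma f_ne_f_add (x : ℝ) {h : ℝ} (hh : h ∈ Ioo 0 k.L) : k.f x ≠ k.f (x + h) := by
  intro heq
  have hper : Function.Periodic k.f k.L := k.per
  obtain ⟨a, ha, hfa, -⟩ := k.exists_mem_Ico_eq 0 x
  rw [zero_add] at hfa
  obtain ⟨m, hm⟩ : ∃ m : ℤ, a = x + m • k.L := by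
    obtain ⟨m, hm, -⟩ := existsUnique_add_zsmul_mem_Ico k.Lpos x 0
    have : k.f (x + m • k.L) = k.f a := by rw [hper.zsmul m x, hfa]
    exact ⟨m, (k.inj (by simpa using hm) ha this).symm⟩
  have h1 : k.f (a + h) = k.f a := by
    rw [hm, show x + m • k.L + h = x + h + m • k.L by ring, hper.zsmul m, hper.zsmul m, heq]
  rcases lt_or_ge (a + h) k.L with h2 | h2
  · have := k.inj ⟨by linarith [ha.1, hh.1], h2⟩ ha h1
    linarith [hh.1]
  · have h3 : k.f (a + h - k.L) = k.f a := by rw [hper.sub_eq, h1]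
    have := k.inj ⟨by linarith, by linarith [ha.2, hh.2]⟩ ha h3
    linarith [hh.2]

/-- A diameter of a knot is a double critical pair. -/
lemma exists_double_critical : ∃ x y : ℝ, k.f x ≠ k.f y ∧ ⟪k.f x - k.f y, k.fd x⟫ = 0 ∧
    ⟪k.f x - k.f y, k.fd y⟫ = 0 := by
  have hc := k.continuous_f
  obtain ⟨⟨x, y⟩, -, hmax⟩ := (isCompact_Icc (a := (0 : ℝ)) (b := k.L)).prod
    (isCompact_Icc (a := (0 : ℝ)) (b := k.L)) |>.exists_isMaxOn
    ⟨(0, 0), ⟨left_mem_Icc.2 k.Lpos.le, left_mem_Icc.2 k.Lpos.le⟩⟩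
    (f := fun z : ℝ × ℝ => ‖k.f z.1 - k.f z.2‖ ^ 2) (by fun_prop)
  have hall : ∀ x' y', ‖k.f x' - k.f y'‖ ^ 2 ≤ ‖k.f x - k.f y‖ ^ 2 := by
    intro x' y'
    obtain ⟨a, ha, hfa, -⟩ := k.exists_mem_Ico_eq 0 x'
    obtain ⟨b, hb, hfb, -⟩ := k.exists_mem_Ico_eq 0 y'
    rw [zero_add] at hfa hfb
    rw [hfa, hfb]
    have := hmax (mk_mem_prod (Ico_subset_Icc_self ha) (Ico_subset_Icc_self hb))
    simpa only [mem_ofPred_eq] using this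
  refine ⟨x, y, ?_, ?_, ?_⟩
  · intro h
    have h1 := hall 0 (0 + k.L / 2)
    rw [h, sub_self, norm_zero] at h1
    have h2 : k.f 0 - k.f (0 + k.L / 2) ≠ 0 := sub_ne_zero.2
      (k.f_ne_f_add 0 ⟨by linarith [k.Lpos], by linarith [k.Lpos]⟩)
    have := norm_pos_iff.2 h2
    nlinarith
  · have h1 := ((k.deriv x).sub_const (k.f y)).norm_sq
    have h2 : IsLocalMax (fun x => ‖k.f x - k.f y‖ ^ 2) x := Eventually.of_forall fun x' => hall x' y
    have := h2.hasDerivAt_eq_zero h1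
    linarith
  · have h1 := ((k.deriv y).const_sub (k.f x)).norm_sq
    have h2 : IsLocalMax (fun y => ‖k.f x - k.f y‖ ^ 2) y := Eventually.of_forall fun y' => hall x y'
    have := h2.hasDerivAt_eq_zero h1
    rw [inner_neg_right] at this
    linarith

lemma norm_sub_smul_lt_iff {z w : Euc n} (hw : ‖w‖ = 1) {r : ℝ} (hr : 0 < r) :
    ‖z - r • w‖ < r ↔ ‖z‖ ^ 2 < 2 * r * ⟪z, w⟫ := by
  have h : ‖z - r • w‖ ^ 2 = ‖z‖ ^ 2 - 2 * r * ⟪z, w⟫ + r ^ 2 := by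
    rw [norm_sub_sq_real, inner_smul_right, norm_smul, hw, Real.norm_eq_abs, abs_of_pos hr]
    ring
  rw [← sq_lt_sq₀ (norm_nonneg _) hr.le, h]
  constructor <;> intro <;> linarith

lemma ballRadius_set_nonempty : {r : ℝ | 0 < r ∧ ∃ s ∈ univ, ∃ t ∈ univ, ∃ w : Euc n,
    ‖w‖ = 1 ∧ ⟪w, k.fd s⟫ = 0 ∧ ‖k.f t - k.f s - r • w‖ < r}.Nonempty := by
  obtain ⟨x, y, hne, -, h2⟩ := k.exists_double_critical
  have hz : k.f x - k.f y ≠ 0 := sub_ne_zero.2 hne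
  have hpos : 0 < ‖k.f x - k.f y‖ := norm_pos_iff.2 hz
  refine ⟨‖k.f x - k.f y‖, hpos, y, mem_univ _, x, mem_univ _,
    ‖k.f x - k.f y‖⁻¹ • (k.f x - k.f y), norm_smul_inv_norm hz, ?_, ?_⟩
  · rw [real_inner_smul_left, h2, mul_zero]
  · rw [smul_smul, mul_inv_cancel₀ hpos.ne', one_smul, sub_self, norm_zero]
    exact hpos

lemma RO_nonneg : 0 ≤ RO k.f k.fd univ := Real.sInf_nonneg fun _ hr => hr.1.le

/-- Below the ball radius, tangent balls miss the knot. -/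
lemma two_mul_RO_mul_inner_le {s t : ℝ} {w : Euc n} (hw : ‖w‖ = 1) (hws : ⟪w, k.fd s⟫ = 0) :
    2 * RO k.f k.fd univ * ⟪k.f t - k.f s, w⟫ ≤ ‖k.f t - k.f s‖ ^ 2 := by
  by_contra! h
  have hR := k.RO_nonneg
  set R := RO k.f k.fd univ with hRdef
  have hz : 0 < ⟪k.f t - k.f s, w⟫ := by
    by_contra! h0
    nlinarith [sq_nonneg ‖k.f t - k.f s‖]
  have hRpos : 0 < R := by
    rcases hR.eq_or_lt with h0 | h0
    · rw [← h0] at h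
      nlinarith [sq_nonneg ‖k.f t - k.f s‖]
    · exact h0
  obtain ⟨r, hr1, hr2⟩ : ∃ r, max 0 (‖k.f t - k.f s‖ ^ 2 / (2 * ⟪k.f t - k.f s, w⟫)) < r ∧ r < R := by
    refine exists_between (max_lt hRpos ?_)
    rw [div_lt_iff₀ (by positivity)]
    linarith
  have hr0 : 0 < r := (le_max_left _ _).trans_lt hr1
  have hr3 := (le_max_right _ _).trans_lt hr1
  rw [div_lt_iff₀ (by positivity)] at hr3
  have : R ≤ r := csInf_le ⟨0, fun _ h => h.1.le⟩
    ⟨hr0, s, mem_univ _, t, mem_univ _, w, hw, hws,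
      (norm_sub_smul_lt_iff hw hr0).2 (by linarith)⟩
  linarith

/-- If every sufficiently distant double critical pair is at distance at least `2 / Λ`, then
chords over at least half a turn have length at least `2 / Λ`. -/
lemma two_div_le_norm_sub {Λ : ℝ} (hΛ : 0 < Λ)
    (hT : ∀ x y, ‖k.fd x - k.fd y‖ ≤ Λ * |x - y|)
    (hdc : ∀ x, ∀ h ∈ Ioo (Real.pi / Λ) (k.L - Real.pi / Λ),
      ⟪k.f x - k.f (x + h), k.fd x⟫ = 0 → ⟪k.f x - k.f (x + h), k.fd (x + h)⟫ = 0 →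
      2 / Λ ≤ ‖k.f x - k.f (x + h)‖)
    (x : ℝ) {h : ℝ} (hh : h ∈ Icc (Real.pi / Λ) (k.L - Real.pi / Λ)) :
    2 / Λ ≤ ‖k.f x - k.f (x + h)‖ := by
  have hc := k.continuous_f
  have hper : Function.Periodic k.f k.L := k.per
  obtain ⟨⟨x₀, h₀⟩, ⟨-, hh₀⟩, hmin⟩ := (isCompact_Icc (a := (0 : ℝ)) (b := k.L)).prod
    (isCompact_Icc (a := Real.pi / Λ) (b := k.L - Real.pi / Λ)) |>.exists_isMinOn
    ⟨(0, h), ⟨left_mem_Icc.2 k.Lpos.le, hh⟩⟩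
    (f := fun z : ℝ × ℝ => ‖k.f z.1 - k.f (z.1 + z.2)‖ ^ 2) (by fun_prop)
  change h₀ ∈ _ at hh₀
  have hall : ∀ x', ∀ h' ∈ Icc (Real.pi / Λ) (k.L - Real.pi / Λ),
      ‖k.f x₀ - k.f (x₀ + h₀)‖ ^ 2 ≤ ‖k.f x' - k.f (x' + h')‖ ^ 2 := by
    intro x' h' hh'
    obtain ⟨m, hm, -⟩ := existsUnique_add_zsmul_mem_Ico k.Lpos x' 0
    rw [zero_add] at hm
    have := hmin (mk_mem_prod (Ico_subset_Icc_self hm) hh')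
    simp only [mem_ofPred_eq] at this
    rwa [show x' + m • k.L + h' = x' + h' + m • k.L by ring, hper.zsmul m, hper.zsmul m] at this
  have hschur : ∀ y, 2 / Λ ≤ ‖k.f (y + Real.pi / Λ) - k.f y‖ := by
    intro y
    have := two_mul_sin_div_le_norm_sub k.deriv k.unit hΛ hT y (h := Real.pi / Λ)
      (by positivity) (by field_simp; rfl)
    rwa [show Λ * (Real.pi / Λ) / 2 = Real.pi / 2 by field_simp, Real.sin_pi_div_two,
      mul_one] at this
  have hmin2 : 2 / Λ ≤ ‖k.f x₀ - k.f (x₀ + h₀)‖ := by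
    rcases hh₀.1.eq_or_lt with h1 | h1
    · rw [← h1, norm_sub_rev]
      exact hschur x₀
    rcases hh₀.2.eq_or_lt with h2 | h2
    · have := hschur (x₀ + h₀)
      rwa [show x₀ + h₀ + Real.pi / Λ = x₀ + k.L by linarith, hper] at this
    refine hdc x₀ h₀ ⟨h1, h2⟩ ?_ ?_
    all_goals
      have hd2 : HasDerivAt (fun t => ‖k.f x₀ - k.f (x₀ + t)‖ ^ 2)
          (2 * ⟪k.f x₀ - k.f (x₀ + h₀), -k.fd (x₀ + h₀)⟫) h₀ :=
        (((k.deriv (x₀ + h₀)).comp_const_add x₀ h₀).const_sub (k.f x₀)).norm_sq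
      have hl2 : IsLocalMin (fun t => ‖k.f x₀ - k.f (x₀ + t)‖ ^ 2) h₀ := by
        filter_upwards [Icc_mem_nhds h1 h2] with t ht using hall x₀ t ht
      have e2 := hl2.hasDerivAt_eq_zero hd2
      rw [inner_neg_right] at e2
    · have hd1 : HasDerivAt (fun t => ‖k.f t - k.f (t + h₀)‖ ^ 2)
          (2 * ⟪k.f x₀ - k.f (x₀ + h₀), k.fd x₀ - k.fd (x₀ + h₀)⟫) x₀ :=
        ((k.deriv x₀).sub ((k.deriv (x₀ + h₀)).comp_add_const x₀ h₀)).norm_sq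
      have hl1 : IsLocalMin (fun t => ‖k.f t - k.f (t + h₀)‖ ^ 2) x₀ :=
        Eventually.of_forall fun t => hall t h₀ hh₀
      have e1 := hl1.hasDerivAt_eq_zero hd1
      rw [inner_sub_right] at e1
      linarith
    · linarith
  have := hall x h hh
  exact hmin2.trans (le_of_sq_le_sq this (norm_nonneg _))

/-- Thickness bound: bounded curvature and no short double critical pair bound the ball radius
from below. -/
lemma one_div_le_RO {Λ : ℝ} (hΛ : 0 < Λ)
    (hT : ∀ x y, ‖k.fd x - k.fd y‖ ≤ Λ * |x - y|)
    (hdc : ∀ x, ∀ h ∈ Ioo (Real.pi / Λ) (k.L - Real.pi / Λ),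
      ⟪k.f x - k.f (x + h), k.fd x⟫ = 0 → ⟪k.f x - k.f (x + h), k.fd (x + h)⟫ = 0 →
      2 / Λ ≤ ‖k.f x - k.f (x + h)‖) :
    1 / Λ ≤ RO k.f k.fd univ := by
  refine le_csInf k.ballRadius_set_nonempty ?_
  rintro r ⟨hr, s, -, t, -, w, hw, hws, hlt⟩
  by_contra! hrΛ
  obtain ⟨h, hh, hft, -⟩ := k.exists_mem_Ico_eq s t
  rw [hft, norm_sub_smul_lt_iff hw hr] at hlt
  set z := k.f (s + h) - k.f s with hz
  have hzw : 0 < ⟪z, w⟫ := by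
    by_contra! h0
    nlinarith [sq_nonneg ‖z‖]
  have hzw2 : ‖z‖ ^ 2 < 2 / Λ * ⟪z, w⟫ := by
    have : r * ⟪z, w⟫ < 1 / Λ * ⟪z, w⟫ := by gcongr
    have h3 : 2 / Λ * ⟪z, w⟫ = 2 * (1 / Λ * ⟪z, w⟫) := by ring
    linarith
  have hle : ⟪z, w⟫ ≤ ‖z‖ := by simpa [hw] using real_inner_le_norm z w
  have hzlt : ‖z‖ < 2 / Λ := by
    by_contra! h0
    have : 0 < ‖z‖ := hzw.trans_le hle
    have h2 : 2 / Λ * ⟪z, w⟫ ≤ ‖z‖ * ‖z‖ := by gcongr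
    nlinarith
  rcases le_total h (Real.pi / Λ) with h1 | h1
  · have := two_div_mul_inner_le_norm_sub_sq k.deriv k.unit hΛ hT s hh.1
      (by rw [le_div_iff₀ hΛ] at h1; linarith) hw hws
    linarith
  rcases le_total h (k.L - Real.pi / Λ) with h2 | h2
  · have := k.two_div_le_norm_sub hΛ hT hdc s ⟨h1, h2⟩
    rw [norm_sub_rev] at this
    linarith
  · have := two_div_mul_inner_le_norm_sub_sq (hasDerivAt_reverse k.deriv)
      (fun x => by rw [norm_neg, k.unit]) hΛ (norm_sub_reverse_le hT) (-s) (h := k.L - h)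
      (by linarith [hh.2])
      (by
        have h3 : k.L - h ≤ Real.pi / Λ := by linarith
        rw [le_div_iff₀ hΛ] at h3; linarith) hw (by rw [neg_neg, inner_neg_right, hws, neg_zero])
    have hper : Function.Periodic k.f k.L := k.per
    rw [neg_neg, show -(-s + (k.L - h)) = s + h - k.L by ring, hper.sub_eq, ← hz] at this
    linarith

lemma injRad_set_le {x y : ℝ} (hne : k.f x ≠ k.f y) (hx : ⟪k.f x - k.f y, k.fd x⟫ = 0)
    (hy : ⟪k.f x - k.f y, k.fd y⟫ = 0) : ∀ r ∈ ({0} ∪ {r : ℝ | 0 < r ∧ ∀ s t : ℝ, ∀ u w : Euc n,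
      ⟪u, k.fd s⟫ = 0 → ⟪w, k.fd t⟫ = 0 → ‖u‖ < r → ‖w‖ < r →
      k.f s + u = k.f t + w → k.f s = k.f t ∧ u = w} : Set ℝ), r ≤ ‖k.f x - k.f y‖ / 2 := by
  rintro r (rfl | ⟨-, h⟩)
  · positivity
  by_contra! hlt
  refine hne (h x y (-((1 / 2 : ℝ) • (k.f x - k.f y))) ((1 / 2 : ℝ) • (k.f x - k.f y))
    ?_ ?_ ?_ ?_ ?_).1
  · rw [inner_neg_left, real_inner_smul_left, hx]; simp
  · rw [real_inner_smul_left, hy, mul_zero]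
  · rw [norm_neg, norm_smul]; norm_num; linarith
  · rw [norm_smul]; norm_num; linarith
  · module

lemma RO_le_injRad : RO k.f k.fd univ ≤ injRad k.f k.fd := by
  obtain ⟨x, y, hne, hx, hy⟩ := k.exists_double_critical
  have hbdd := k.injRad_set_le hne hx hy
  rcases k.RO_nonneg.eq_or_lt with h0 | hpos
  · rw [← h0]
    exact le_csSup ⟨_, hbdd⟩ (Or.inl rfl)
  set R := RO k.f k.fd univ with hR
  refine le_csSup ⟨_, hbdd⟩ (Or.inr ⟨hpos, fun s t u w hu hw hur hwr heq => ?_⟩)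
  suffices h : k.f s = k.f t from ⟨h, by rw [h] at heq; exact add_left_cancel heq⟩
  wlog hwu : ‖w‖ ≤ ‖u‖ generalizing s t u w
  · exact (this t s w u hw hu hwr hur heq.symm (le_of_not_ge hwu)).symm
  by_contra hst
  rcases (norm_nonneg u).eq_or_lt with hu0 | hu0
  · have hw0 : w = 0 := norm_le_zero_iff.1 (hu0 ▸ hwu)
    rw [norm_eq_zero.1 hu0.symm, hw0, add_zero, add_zero] at heq
    exact hst heq
  have hune : u ≠ 0 := norm_pos_iff.1 hu0
  have hz : k.f t - k.f s = u - w := by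
    rw [sub_eq_sub_iff_add_eq_add, add_comm u, heq]
  have h1 := k.two_mul_RO_mul_inner_le (s := s) (t := t) (w := ‖u‖⁻¹ • u)
    (norm_smul_inv_norm hune) (by rw [real_inner_smul_left, hu, mul_zero])
  rw [inner_smul_right] at h1
  have hzpos : 0 < ‖k.f t - k.f s‖ := norm_pos_iff.2 (sub_ne_zero.2 (Ne.symm hst))
  have h2 : ‖k.f t - k.f s‖ ^ 2 ≤ 2 * ⟪k.f t - k.f s, u⟫ := by
    have h3 : ‖w‖ ^ 2 ≤ ‖u‖ ^ 2 := by gcongr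
    rw [hz, norm_sub_sq_real, inner_sub_left, real_inner_self_eq_norm_sq, real_inner_comm w u]
    rw [real_inner_comm]
    linarith
  have h4 : 1 < R * ‖u‖⁻¹ := by rwa [← div_eq_mul_inv, one_lt_div hu0]
  have h5 : 0 < ‖k.f t - k.f s‖ ^ 2 := by positivity
  nlinarith

lemma MDC_le {x y : ℝ} (hne : k.f x ≠ k.f y) (hx : ⟪k.f x - k.f y, k.fd x⟫ = 0)
    (hy : ⟪k.f x - k.f y, k.fd y⟫ = 0) : MDC k.f k.fd ≤ ‖k.f x - k.f y‖ := by
  refine csInf_le ⟨0, ?_⟩ ⟨x, y, hne, hx, hy, rfl⟩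
  rintro d ⟨x, y, -, -, -, rfl⟩
  exact norm_nonneg _

lemma injRad_le_half_MDC : injRad k.f k.fd ≤ MDC k.f k.fd / 2 := by
  refine csSup_le ⟨0, Or.inl rfl⟩ ?_
  intro r hr
  obtain ⟨x, y, hne, hx, hy⟩ := k.exists_double_critical
  have : 2 * r ≤ MDC k.f k.fd := by
    refine le_csInf ⟨_, x, y, hne, hx, hy, rfl⟩ ?_
    rintro d ⟨x, y, hne, hx, hy, rfl⟩
    have := k.injRad_set_le hne hx hy _ hr
    linarith
  linarith

lemma min_le_RO {Λ : ℝ} (hΛ : 0 < Λ) (hT : ∀ x y, ‖k.fd x - k.fd y‖ ≤ Λ * |x - y|) :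
    min (1 / Λ) (MDC k.f k.fd / 2) ≤ RO k.f k.fd univ := by
  set ρ := min (1 / Λ) (MDC k.f k.fd / 2) with hρ
  rcases le_or_gt ρ 0 with h0 | hpos
  · exact h0.trans k.RO_nonneg
  have h1 : Λ ≤ 1 / ρ := by
    rw [le_div_comm₀ hΛ hpos]
    exact min_le_left _ _
  have h2 := min_le_right (1 / Λ) (MDC k.f k.fd / 2)
  have := k.one_div_le_RO (Λ := 1 / ρ) (by positivity)
    (fun x y => (hT x y).trans (by gcongr)) (fun x h hh hx hy => ?_)
  · rwa [one_div_one_div] at this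
  · have hp : 0 < Real.pi / (1 / ρ) := by positivity
    have := k.MDC_le (k.f_ne_f_add x ⟨hp.trans hh.1, by linarith [hh.2]⟩) hx hy
    rw [div_div_eq_mul_div, div_one]
    linarith

lemma exists_angle_le (s : ℝ) : ∃ Λ : ℝ, Λ ∈ {Λ : ℝ | 0 ≤ Λ ∧ ∃ δ > 0, ∀ x ∈ univ, ∀ y ∈ univ,
    x ≠ y → |x - s| < δ → |y - s| < δ →
    InnerProductGeometry.angle (k.fd x) (k.fd y) ≤ Λ * |x - y|} := by
  obtain ⟨C, hC⟩ := k.lipd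
  refine ⟨C + 1, by positivity, 1, one_pos, fun x _ y _ _ _ _ => ?_⟩
  refine angle_le_of_norm_sub_le k.unit (by positivity) (fun x y => ?_) x y
  have := hC.dist_le_mul x y
  rw [dist_eq_norm, Real.dist_eq] at this
  exact this.trans (by gcongr; linarith)

lemma exists_local_angle_le {s Λ : ℝ} (h : curvAt k.fd univ s < Λ) :
    ∃ Λ' < Λ, 0 ≤ Λ' ∧ ∃ δ > 0, ∀ x y, x ≠ y → |x - s| < δ → |y - s| < δ →
      InnerProductGeometry.angle (k.fd x) (k.fd y) ≤ Λ' * |x - y| := by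
  obtain ⟨Λ', ⟨h0, δ, hδ, hloc⟩, hlt⟩ := exists_lt_of_csInf_lt (k.exists_angle_le s) h
  exact ⟨Λ', hlt, h0, δ, hδ, fun x y hxy hx hy => hloc x trivial y trivial hxy hx hy⟩

lemma curvAt_le {s Λ : ℝ} (h0 : 0 ≤ Λ) {δ : ℝ} (hδ : 0 < δ)
    (h : ∀ x y, x ≠ y → |x - s| < δ → |y - s| < δ →
      InnerProductGeometry.angle (k.fd x) (k.fd y) ≤ Λ * |x - y|) : curvAt k.fd univ s ≤ Λ :=
  csInf_le ⟨0, fun _ h => h.1⟩ ⟨h0, δ, hδ, fun x _ y _ => h x y⟩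

lemma bddAbove_curvAt : BddAbove (range fun s => curvAt k.fd univ s) := by
  obtain ⟨C, hC⟩ := k.lipd
  refine ⟨C + 1, ?_⟩
  rintro _ ⟨s, rfl⟩
  refine k.curvAt_le (by positivity) one_pos fun x y _ _ _ => ?_
  refine angle_le_of_norm_sub_le k.unit (by positivity) (fun x y => ?_) x y
  have := hC.dist_le_mul x y
  rw [dist_eq_norm, Real.dist_eq] at this
  exact this.trans (by gcongr; linarith)

lemma curvAt_le_supCurv (s : ℝ) : curvAt k.fd univ s ≤ k.supCurv :=
  le_ciSup k.bddAbove_curvAt s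

lemma norm_sub_le_supCurv (x y : ℝ) : ‖k.fd x - k.fd y‖ ≤ k.supCurv * |x - y| := by
  refine (norm_sub_le_angle (k.unit x) (k.unit y)).trans ?_
  have key : ∀ Λ > k.supCurv, InnerProductGeometry.angle (k.fd x) (k.fd y) ≤ Λ * |x - y| := by
    intro Λ hΛ
    refine angle_le_of_local k.continuous_fd k.unit (fun s => ?_) x y
    obtain ⟨Λ', hlt, -, δ, hδ, h⟩ := k.exists_local_angle_le ((k.curvAt_le_supCurv s).trans_lt hΛ)
    exact ⟨δ, hδ, fun x y hne hx hy => (h x y hne hx hy).trans (by gcongr)⟩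
  have h2 : Tendsto (fun Λ : ℝ => Λ * |x - y|) (𝓝[>] k.supCurv) (𝓝 (k.supCurv * |x - y|)) :=
    ((continuous_id.mul continuous_const).tendsto _).mono_left nhdsWithin_le_nhds
  exact ge_of_tendsto h2 (eventually_nhdsWithin_of_forall key)

lemma supCurv_pos : 0 < k.supCurv := by
  by_contra! h
  have hconst : ∀ x, k.fd x = k.fd 0 := fun x => by
    have := k.norm_sub_le_supCurv x 0
    exact sub_eq_zero.1 (norm_le_zero_iff.1
      (this.trans (mul_nonpos_of_nonpos_of_nonneg h (abs_nonneg _))))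
  have hd : ∀ s, HasDerivAt (fun s => k.f s - s • k.fd 0) 0 s := fun s => by
    have := (k.deriv s).sub ((hasDerivAt_id s).smul_const (k.fd 0))
    exact this.congr_deriv (by simp [hconst s])
  have h1 := is_const_of_deriv_eq_zero (fun s => (hd s).differentiableAt)
    (fun s => (hd s).deriv) k.L 0
  have hper := k.per 0
  rw [zero_add] at hper
  simp only [hper, zero_smul, sub_zero, sub_eq_self] at h1
  rcases smul_eq_zero.1 h1 with h2 | h2
  · exact k.Lpos.ne' h2
  · simpa [h2] using k.unit 0

end Knot

/-- A chord avoiding the tangent balls of radius `R` at its origin is almost tangent. -/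
lemma norm_sub_norm_smul_le {E : Type*} [NormedAddCommGroup E] [InnerProductSpace ℝ E]
    {z v : E} {R : ℝ} (hR : 0 < R) (hv : ‖v‖ = 1) (hzv : 0 ≤ ⟪z, v⟫) (hq : ‖z‖ / (2 * R) ≤ 1)
    (h : ∀ e : E, ‖e‖ = 1 → ⟪e, v⟫ = 0 → 2 * R * ⟪z, e⟫ ≤ ‖z‖ ^ 2) :
    ‖z - ‖z‖ • v‖ ≤ ‖z‖ * (‖z‖ / (2 * R) * (1 + ‖z‖ / (2 * R))) := by
  set q := ‖z‖ / (2 * R) with hqdef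
  have hq0 : 0 ≤ q := by positivity
  set a := ⟪z, v⟫ with ha
  set p := z - a • v with hp
  have hpv : ⟪p, v⟫ = 0 := by
    rw [hp, inner_sub_left, real_inner_smul_left, real_inner_self_eq_norm_sq, hv, ← ha]; ring
  have hpn : ‖p‖ ≤ ‖z‖ * q := by
    rcases eq_or_ne p 0 with h0 | h0
    · rw [h0, norm_zero]; positivity
    have h1 := h (‖p‖⁻¹ • p) (norm_smul_inv_norm h0) (by rw [real_inner_smul_left, hpv, mul_zero])
    have h2 : ⟪z, p⟫ = ‖p‖ ^ 2 := by
      have : z = p + a • v := by rw [hp]; abel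
      conv_lhs => rw [this]
      rw [inner_add_left, real_inner_self_eq_norm_sq, real_inner_smul_left, real_inner_comm, hpv]
      ring
    have hp0 : 0 < ‖p‖ := norm_pos_iff.2 h0
    have h3 : ‖p‖⁻¹ * ‖p‖ ^ 2 = ‖p‖ := by field_simp
    rw [inner_smul_right, h2, h3] at h1
    have h4 : ‖z‖ * q = ‖z‖ ^ 2 / (2 * R) := by rw [hqdef]; ring
    rw [h4, le_div_iff₀ (by positivity)]
    linarith
  have hpsq : ‖p‖ ^ 2 = ‖z‖ ^ 2 - a ^ 2 := by
    rw [hp, norm_sub_sq_real, inner_smul_right, norm_smul, hv, Real.norm_eq_abs, mul_one, sq_abs,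
      ← ha]
    ring
  have ha2 : ‖z‖ ^ 2 * (1 - q ^ 2) ≤ a ^ 2 := by
    have : ‖p‖ ^ 2 ≤ (‖z‖ * q) ^ 2 := by gcongr
    nlinarith
  have hal : ‖z‖ * (1 - q ^ 2 / 2 - q ^ 4 / 2) ≤ a := by
    refine le_of_sq_le_sq (le_trans ?_ ha2) hzv
    rw [mul_pow]
    gcongr
    have h4 : q ^ 2 ≤ 1 := pow_le_one₀ hq0 hq
    have h5 : (1 : ℝ) - q ^ 2 - (1 - q ^ 2 / 2 - q ^ 4 / 2) ^ 2 =
        q ^ 4 * (3 / 4 - q ^ 2 / 2 - q ^ 4 / 4) := by ring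
    have h6 : 0 ≤ q ^ 4 * (3 / 4 - q ^ 2 / 2 - q ^ 4 / 4) := by
      refine mul_nonneg (by positivity) ?_
      nlinarith [sq_nonneg q]
    linarith
  refine le_of_sq_le_sq ?_ (by positivity)
  have h7 : ‖z - ‖z‖ • v‖ ^ 2 = 2 * ‖z‖ * (‖z‖ - a) := by
    rw [norm_sub_sq_real, inner_smul_right, norm_smul, hv, Real.norm_eq_abs, mul_one, sq_abs, ← ha]
    ring
  rw [h7]
  have h8 : 2 * ‖z‖ * (‖z‖ - a) ≤ 2 * ‖z‖ * (‖z‖ * (q ^ 2 / 2 + q ^ 4 / 2)) := by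
    gcongr
    linarith
  refine h8.trans ?_
  have h9 : (‖z‖ * (q * (1 + q))) ^ 2 - 2 * ‖z‖ * (‖z‖ * (q ^ 2 / 2 + q ^ 4 / 2)) =
      2 * ‖z‖ ^ 2 * q ^ 3 := by ring
  have h10 : 0 ≤ 2 * ‖z‖ ^ 2 * q ^ 3 := by positivity
  linarith

namespace Knot

variable {n : ℕ} (k : Knot n)

lemma norm_fd_sub_le {R : ℝ} (hR : RO k.f k.fd univ = R) (hpos : 0 < R) {Λ : ℝ} (hΛ : 0 < Λ)
    (hT : ∀ x y, ‖k.fd x - k.fd y‖ ≤ Λ * |x - y|) {x y : ℝ} (h1 : Λ * |x - y| ≤ Real.pi / 2)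
    (h2 : |x - y| ≤ 2 * R) :
    ‖k.fd x - k.fd y‖ ≤ |x - y| / R * (1 + |x - y| / (2 * R)) := by
  wlog hxy : x ≤ y generalizing x y
  · rw [abs_sub_comm] at h1 h2
    rw [norm_sub_rev, abs_sub_comm]
    exact this h1 h2 (le_of_not_ge hxy)
  rcases hxy.eq_or_lt with rfl | hlt
  · simp
  set h := |x - y| with hh
  have hxh : y = x + h := by rw [hh, abs_sub_comm, abs_of_pos (by linarith)]; ring
  have hpos' : 0 < h := by linarith
  have hpi := Real.pi_pos
  have hsin : 0 ≤ Real.sin (Λ * h) / Λ := by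
    have := Real.sin_nonneg_of_nonneg_of_le_pi (x := Λ * h) (by positivity) (by linarith)
    positivity
  have hl := sin_div_le_inner_sub_left k.deriv k.unit hΛ hT x hpos'.le (by linarith)
  have hr := sin_div_le_inner_sub_right k.deriv k.unit hΛ hT x hpos'.le (by linarith)
  rw [← hxh] at hl hr
  set z := k.f y - k.f x with hz
  have hzh : ‖z‖ ≤ h := by
    have := Convex.norm_image_sub_le_of_norm_hasDerivWithin_le (f := k.f) (f' := k.fd) (C := 1)
      (s := univ) (fun s _ => (k.deriv s).hasDerivWithinAt) (fun s _ => (k.unit s).le) convex_univ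
      (mem_univ x) (mem_univ y)
    rw [one_mul, Real.norm_eq_abs, abs_sub_comm] at this
    exact this
  have hznz : 0 < ‖z‖ := norm_pos_iff.2 fun h0 => by
    have hs : 0 < Real.sin (Λ * h) := Real.sin_pos_of_pos_of_lt_pi (by positivity) (by linarith)
    have : 0 < Real.sin (Λ * h) / Λ := by positivity
    rw [h0, inner_zero_left] at hl
    linarith
  have hq : ‖z‖ / (2 * R) ≤ 1 := by rw [div_le_one (by positivity)]; linarith
  have hA := norm_sub_norm_smul_le hpos (k.unit x) (hsin.trans hl) hq fun e he hev => by
    have := k.two_mul_RO_mul_inner_le (s := x) (t := y) he hev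
    rwa [hR] at this
  have hB := norm_sub_norm_smul_le hpos (k.unit y) (hsin.trans hr) hq fun e he hev => by
    have := k.two_mul_RO_mul_inner_le (s := y) (t := x) (w := -e) (by rwa [norm_neg])
      (by rw [inner_neg_left, hev, neg_zero])
    rwa [hR, inner_neg_right, ← inner_neg_left, neg_sub, norm_sub_rev] at this
  have hsum : ‖z‖ * ‖k.fd x - k.fd y‖ ≤
      ‖z‖ * (2 * (‖z‖ / (2 * R) * (1 + ‖z‖ / (2 * R)))) := by
    have : ‖z‖ * ‖k.fd x - k.fd y‖ = ‖(z - ‖z‖ • k.fd y) - (z - ‖z‖ • k.fd x)‖ := by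
      rw [show (z - ‖z‖ • k.fd y) - (z - ‖z‖ • k.fd x) = ‖z‖ • (k.fd x - k.fd y) by
        rw [smul_sub]; abel, norm_smul, norm_norm]
    rw [this]
    refine (norm_sub_le _ _).trans ?_
    linarith
  refine (le_of_mul_le_mul_left hsum hznz).trans ?_
  have : 2 * (‖z‖ / (2 * R) * (1 + ‖z‖ / (2 * R))) = ‖z‖ / R * (1 + ‖z‖ / (2 * R)) := by
    field_simp
  rw [this]
  gcongr

lemma curvAt_le_inv_RO (hpos : 0 < RO k.f k.fd univ) (s : ℝ) :
    curvAt k.fd univ s ≤ (RO k.f k.fd univ)⁻¹ := by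
  set R := RO k.f k.fd univ with hR
  have hΛ := k.supCurv_pos
  set Λ := k.supCurv
  have key : ∀ c > (1 : ℝ), curvAt k.fd univ s ≤ c * (c * R⁻¹) := by
    intro c hc
    obtain ⟨ρ, hρ, hang⟩ := exists_angle_le_mul_norm_sub (E := Euc n) hc
    set m := min (min (Real.pi / 2 / Λ) (ρ / Λ)) (min (2 * R) (2 * R * (c - 1))) with hm
    have hmpos : 0 < m := by
      have : 0 < c - 1 := by linarith
      have := Real.pi_pos
      positivity
    refine k.curvAt_le (by positivity) (half_pos hmpos) fun x y _ hx hy => ?_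
    have hd : |x - y| ≤ m := by
      have := abs_sub_le x s y
      rw [abs_sub_comm s y] at this
      linarith
    have hm1 : |x - y| ≤ Real.pi / 2 / Λ :=
      hd.trans ((min_le_left _ _).trans (min_le_left _ _))
    have hm2 : |x - y| ≤ ρ / Λ := hd.trans ((min_le_left _ _).trans (min_le_right _ _))
    have hm3 : |x - y| ≤ 2 * R := hd.trans ((min_le_right _ _).trans (min_le_left _ _))
    have hm4 : |x - y| ≤ 2 * R * (c - 1) := hd.trans ((min_le_right _ _).trans (min_le_right _ _))
    rw [le_div_iff₀ hΛ] at hm1 hm2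
    have hchord := k.norm_fd_sub_le hR.symm hpos hΛ k.norm_sub_le_supCurv (x := x) (y := y)
      (by linarith) hm3
    have hsmall : ‖k.fd x - k.fd y‖ ≤ ρ := (k.norm_sub_le_supCurv x y).trans (by linarith)
    refine (hang _ _ (k.unit x) (k.unit y) hsmall).trans ?_
    rw [mul_assoc]
    gcongr
    refine hchord.trans ?_
    have h5 : |x - y| / (2 * R) ≤ c - 1 := by rw [div_le_iff₀ (by positivity)]; linarith
    calc |x - y| / R * (1 + |x - y| / (2 * R)) ≤ |x - y| / R * c := by gcongr; linarith
      _ = c * R⁻¹ * |x - y| := by ring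
  have h2 : Tendsto (fun c : ℝ => c * (c * R⁻¹)) (𝓝[>] 1) (𝓝 (1 * (1 * R⁻¹))) :=
    ((by fun_prop : Continuous fun c : ℝ => c * (c * R⁻¹)).tendsto 1).mono_left nhdsWithin_le_nhds
  rw [one_mul, one_mul] at h2
  exact ge_of_tendsto h2 (eventually_nhdsWithin_of_forall key)

end Knot

/-- A variation, on `[a, b]`, of the unit tangent field `T` with fixed end values: a unit field `S`
and a speed `w`, both `δ`-close to `T` and `1`, such that the curve with velocity `w • S` has
curvature at most `Λ`, displacement `v` and length at most `ℓ`. -/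
def TangentVariation {n : ℕ} (Λ δ : ℝ) (T : ℝ → Euc n) (a b : ℝ) (v : Euc n) (ℓ : ℝ) : Prop :=
  ∃ (S : ℝ → Euc n) (w : ℝ → ℝ), Measurable w ∧
    (∀ s ∈ Icc a b, |w s - 1| ≤ δ ∧ ‖S s‖ = 1 ∧ ‖S s - T s‖ ≤ δ) ∧ S a = T a ∧ S b = T b ∧
    (∀ x ∈ Icc a b, ∀ y ∈ Icc a b, x ≤ y → ‖S x - S y‖ ≤ Λ * ∫ t in x..y, w t) ∧
    ∫ t in a..b, w t • S t = v ∧ ∫ t in a..b, w t ≤ ℓ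

lemma intervalIntegrable_of_bound {E : Type*} [NormedAddCommGroup E] {w : ℝ → E} {a b M : ℝ}
    (hab : a ≤ b) (hw : AEStronglyMeasurable w (volume.restrict (Ioc a b)))
    (h : ∀ s ∈ Icc a b, ‖w s‖ ≤ M) : IntervalIntegrable w volume a b := by
  rw [intervalIntegrable_iff_integrableOn_Ioc_of_le hab]
  refine ⟨hw, HasFiniteIntegral.of_bounded (C := M) ?_⟩
  exact (ae_restrict_iff' measurableSet_Ioc).2 (.of_forall fun s hs => h s (Ioc_subset_Icc_self hs))

lemma intervalIntegrable_of_abs_sub_one_le {w : ℝ → ℝ} {a b δ : ℝ} (hab : a ≤ b)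
    (hw : Measurable w) (h : ∀ s ∈ Icc a b, |w s - 1| ≤ δ) : IntervalIntegrable w volume a b := by
  refine intervalIntegrable_of_bound (M := 1 + δ) hab hw.aestronglyMeasurable fun s hs => ?_
  have := abs_le.1 (h s hs)
  rw [Real.norm_eq_abs, abs_le]
  constructor <;> linarith

/-- The curvature bound forces the tangent field to be continuous. -/
lemma continuousOn_of_norm_sub_le_integral {n : ℕ} {S : ℝ → Euc n} {w : ℝ → ℝ} {a b Λ δ : ℝ}
    (hΛ : 0 ≤ Λ) (hw : Measurable w) (h : ∀ s ∈ Icc a b, |w s - 1| ≤ δ)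
    (hS : ∀ x ∈ Icc a b, ∀ y ∈ Icc a b, x ≤ y → ‖S x - S y‖ ≤ Λ * ∫ t in x..y, w t) :
    ContinuousOn S (Icc a b) := by
  have key : ∀ x ∈ Icc a b, ∀ y ∈ Icc a b, x ≤ y → ‖S x - S y‖ ≤ Λ * (1 + |δ|) * (y - x) := by
    intro x hx y hy hxy
    have hsub : Icc x y ⊆ Icc a b := Icc_subset_Icc hx.1 hy.2
    refine (hS x hx y hy hxy).trans ?_
    rw [mul_assoc]
    refine mul_le_mul_of_nonneg_left ?_ hΛ
    have := intervalIntegral.integral_mono_on hxy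
      (intervalIntegrable_of_abs_sub_one_le hxy hw fun s hs => h s (hsub hs))
      (intervalIntegrable_const (c := 1 + |δ|)) fun s hs => by
        have := abs_le.1 (h s (hsub hs)); have := le_abs_self δ; linarith
    rw [intervalIntegral.integral_const, smul_eq_mul] at this
    linarith
  refine LipschitzOnWith.continuousOn (K := (Λ * (1 + |δ|)).toNNReal) ?_
  refine LipschitzOnWith.of_dist_le_mul fun x hx y hy => ?_
  rw [Real.coe_toNNReal _ (by positivity), dist_eq_norm, Real.dist_eq]
  rcases le_total x y with hxy | hxy
  · rw [abs_of_nonpos (sub_nonpos.2 hxy), neg_sub]; exact key x hx y hy hxy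
  · rw [abs_of_nonneg (sub_nonneg.2 hxy), norm_sub_rev]; exact key y hy x hx hxy

namespace TangentVariation

variable {n : ℕ} {Λ δ : ℝ} {T : ℝ → Euc n} {a b c ℓ ℓ₁ ℓ₂ : ℝ} {v v₁ v₂ : Euc n}

lemma refl (hδ : 0 ≤ δ) (hu : ∀ x, ‖T x‖ = 1)
    (hT : ∀ x y, ‖T x - T y‖ ≤ Λ * |x - y|) :
    TangentVariation Λ δ T a b (∫ t in a..b, T t) (b - a) := by
  refine ⟨T, fun _ => 1, measurable_const, fun s _ => by simp [hu, hδ], rfl, rfl, ?_, by simp,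
    by simp⟩
  intro x _ y _ hxy
  have := hT x y
  rw [abs_of_nonpos (by linarith), neg_sub] at this
  simpa using this

lemma trans (hΛ : 0 ≤ Λ) (hab : a ≤ b) (hbc : b ≤ c) (h₁ : TangentVariation Λ δ T a b v₁ ℓ₁)
    (h₂ : TangentVariation Λ δ T b c v₂ ℓ₂) :
    TangentVariation Λ δ T a c (v₁ + v₂) (ℓ₁ + ℓ₂) := by
  obtain ⟨S₁, w₁, hm₁, hb₁, hl₁, hr₁, hS₁, hv₁, hL₁⟩ := h₁
  obtain ⟨S₂, w₂, hm₂, hb₂, hl₂, hr₂, hS₂, hv₂, hL₂⟩ := h₂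
  have hc₁ := continuousOn_of_norm_sub_le_integral hΛ hm₁ (fun s hs => (hb₁ s hs).1) hS₁
  have hc₂ := continuousOn_of_norm_sub_le_integral hΛ hm₂ (fun s hs => (hb₂ s hs).1) hS₂
  set S : ℝ → Euc n := fun s => if s ≤ b then S₁ s else S₂ s with hSdef
  set w : ℝ → ℝ := fun s => if s ≤ b then w₁ s else w₂ s with hwdef
  have eS₁ : ∀ s ≤ b, S s = S₁ s := fun s hs => if_pos hs
  have ew₁ : ∀ s ≤ b, w s = w₁ s := fun s hs => if_pos hs
  have eS₂ : ∀ s, b ≤ s → S s = S₂ s := fun s hs => by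
    rcases hs.eq_or_lt with rfl | hs
    · rw [eS₁ _ le_rfl, hr₁, hl₂]
    · exact if_neg hs.not_ge
  have ew₂ : ∀ s, b < s → w s = w₂ s := fun s hs => if_neg hs.not_ge
  have hm : Measurable w := Measurable.ite measurableSet_Iic hm₁ hm₂
  have hb : ∀ s ∈ Icc a c, |w s - 1| ≤ δ ∧ ‖S s‖ = 1 ∧ ‖S s - T s‖ ≤ δ := by
    intro s hs
    rcases le_or_gt s b with h | h
    · rw [ew₁ s h, eS₁ s h]; exact hb₁ s ⟨hs.1, h⟩
    · rw [ew₂ s h, eS₂ s h.le]; exact hb₂ s ⟨h.le, hs.2⟩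
  have iw₁ : ∀ {x y}, x ≤ y → y ≤ b → ∫ t in x..y, w t = ∫ t in x..y, w₁ t := fun hxy hy => by
    refine intervalIntegral.integral_congr fun t ht => ew₁ t ?_
    rw [uIcc_of_le hxy] at ht; exact ht.2.trans hy
  have iw₂ : ∀ {x y}, x ≤ y → b ≤ x → ∫ t in x..y, w t = ∫ t in x..y, w₂ t := fun hxy hx => by
    refine intervalIntegral.integral_congr_ae (.of_forall fun t ht => ew₂ t ?_)
    rw [uIoc_of_le hxy] at ht; exact hx.trans_lt ht.1
  have int : ∀ {x y}, x ≤ y → a ≤ x → y ≤ c → IntervalIntegrable w volume x y :=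
    fun hxy hx hy => intervalIntegrable_of_abs_sub_one_le hxy hm fun s hs =>
      (hb s ⟨hx.trans hs.1, hs.2.trans hy⟩).1
  have iv₁ : ∫ t in a..b, w t • S t = v₁ := by
    rw [← hv₁]
    refine intervalIntegral.integral_congr fun t ht => ?_
    rw [uIcc_of_le hab] at ht
    simp only [ew₁ t ht.2, eS₁ t ht.2]
  have iv₂ : ∫ t in b..c, w t • S t = v₂ := by
    rw [← hv₂]
    refine intervalIntegral.integral_congr_ae (.of_forall fun t ht => ?_)
    rw [uIoc_of_le hbc] at ht
    simp only [ew₂ t ht.1, eS₂ t ht.1.le]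
  have hcS₁ : ContinuousOn S (Icc a b) := hc₁.congr fun s hs => eS₁ s hs.2
  have hcS₂ : ContinuousOn S (Icc b c) := hc₂.congr fun s hs => eS₂ s hs.1
  refine ⟨S, w, hm, hb, by rw [eS₁ a hab, hl₁], by rw [eS₂ c hbc, hr₂], ?_, ?_, ?_⟩
  · intro x hx y hy hxy
    rcases le_total y b with h | h
    · rw [iw₁ hxy h, eS₁ x (hxy.trans h), eS₁ y h]
      exact hS₁ x ⟨hx.1, hxy.trans h⟩ y ⟨hy.1, h⟩ hxy
    rcases le_total b x with h' | h'
    · rw [iw₂ hxy h', eS₂ x h', eS₂ y h]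
      exact hS₂ x ⟨h', hx.2⟩ y ⟨h, hy.2⟩ hxy
    rw [← intervalIntegral.integral_add_adjacent_intervals (int h' hx.1 hbc) (int h hab hy.2),
      iw₁ h' le_rfl, iw₂ h le_rfl, eS₁ x h', eS₂ y h, mul_add]
    refine (norm_sub_le_norm_sub_add_norm_sub _ (S₁ b) _).trans (add_le_add ?_ ?_)
    · exact hS₁ x ⟨hx.1, h'⟩ b ⟨hab, le_rfl⟩ h'
    · rw [hr₁, ← hl₂]; exact hS₂ b ⟨le_rfl, hbc⟩ y ⟨h, hy.2⟩ h
  · rw [← intervalIntegral.integral_add_adjacent_intervals, iv₁, iv₂]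
    · exact (int hab le_rfl hbc).smul_continuousOn (by rwa [uIcc_of_le hab])
    · exact (int hbc hab le_rfl).smul_continuousOn (by rwa [uIcc_of_le hbc])
  · rw [← intervalIntegral.integral_add_adjacent_intervals (int hab le_rfl hbc)
      (int hbc hab le_rfl), iw₁ hab le_rfl, iw₂ hbc le_rfl]
    exact add_le_add hL₁ hL₂

end TangentVariation

/-- Normalization of vectors is `r⁻¹`-Lipschitz outside the ball of radius `r`. -/
lemma norm_inv_norm_smul_sub_le {E : Type*} [NormedAddCommGroup E] [InnerProductSpace ℝ E]
    {u v : E} {r : ℝ} (hr : 0 < r) (hu : r ≤ ‖u‖) (hv : r ≤ ‖v‖) :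
    r * ‖‖u‖⁻¹ • u - ‖v‖⁻¹ • v‖ ≤ ‖u - v‖ := by
  have hu0 : 0 < ‖u‖ := hr.trans_le hu
  have hv0 : 0 < ‖v‖ := hr.trans_le hv
  refine abs_le_of_sq_le_sq' ?_ (norm_nonneg _) |>.2
  have h1 : ‖‖u‖⁻¹ • u - ‖v‖⁻¹ • v‖ ^ 2 = 2 - 2 * (⟪u, v⟫ / (‖u‖ * ‖v‖)) := by
    rw [norm_sub_sq_real, norm_smul, norm_smul, inner_smul_left, inner_smul_right]
    simp only [norm_inv, norm_norm, conj_trivial]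
    field_simp
    ring
  set q := ⟪u, v⟫ / (‖u‖ * ‖v‖) with hq
  have hin : ⟪u, v⟫ = q * (‖u‖ * ‖v‖) := by rw [hq]; field_simp
  have hq1 : q ≤ 1 := by
    rw [hq, div_le_one (by positivity)]; exact real_inner_le_norm u v
  rw [mul_pow, h1, norm_sub_sq_real, hin]
  have h2 : r ^ 2 ≤ ‖u‖ * ‖v‖ := by rw [sq]; gcongr
  have h3 := mul_nonneg (sub_nonneg.2 h2) (sub_nonneg.2 hq1)
  nlinarith [sq_nonneg (‖u‖ - ‖v‖)]

lemma norm_inv_norm_smul_sub_self {E : Type*} [NormedAddCommGroup E] [NormedSpace ℝ E]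
    {u : E} (hu : u ≠ 0) : ‖‖u‖⁻¹ • u - u‖ = |‖u‖ - 1| := by
  have h0 : 0 < ‖u‖ := norm_pos_iff.2 hu
  have : ‖u‖⁻¹ • u - u = (‖u‖⁻¹ - 1) • u := by rw [sub_smul, one_smul]
  rw [this, norm_smul, Real.norm_eq_abs, ← abs_of_pos h0, ← abs_mul, abs_of_pos h0, sub_mul,
    inv_mul_cancel₀ h0.ne', one_mul, abs_sub_comm]

namespace TangentVariation

variable {n : ℕ} {Λ Λ' δ : ℝ} {T : ℝ → Euc n} {a b : ℝ}

/-- Where the curvature is smaller than `Λ`, the tangent field may be perturbed freely. -/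
lemma of_add {V : ℝ → Euc n} {η : ℝ} (hab : a ≤ b) (hΛ : Λ' < Λ) (hΛ' : 0 ≤ Λ') (hη : 0 ≤ η)
    (hηδ : 2 * η ≤ δ) (hη1 : η ≤ 1 / 2) (hη2 : Λ' + η ≤ Λ * (1 - 2 * η))
    (hu : ∀ x, ‖T x‖ = 1) (hTm : Continuous T) (hVm : Continuous V)
    (hT : ∀ x ∈ Icc a b, ∀ y ∈ Icc a b, ‖T x - T y‖ ≤ Λ' * |x - y|)
    (hVb : ∀ x ∈ Icc a b, ‖V x‖ ≤ η) (hVa : V a = 0) (hVb' : V b = 0)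
    (hV : ∀ x ∈ Icc a b, ∀ y ∈ Icc a b, ‖V x - V y‖ ≤ η * |x - y|) :
    TangentVariation Λ δ T a b ((∫ t in a..b, T t) + ∫ t in a..b, V t)
      (b - a + (∫ t in a..b, ⟪T t, V t⟫) + ∫ t in a..b, ‖V t‖ ^ 2 / 2) := by
  have hσc : Continuous fun t => T t + V t := hTm.add hVm
  have hlow : ∀ x ∈ Icc a b, |‖T x + V x‖ - 1| ≤ η := fun x hx => by
    have := abs_norm_sub_norm_le (T x + V x) (T x)
    rw [hu, add_sub_cancel_left] at this
    exact this.trans (hVb x hx)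
  have hne : ∀ x ∈ Icc a b, T x + V x ≠ 0 := fun x hx h => by
    have := hlow x hx
    rw [h, norm_zero] at this; norm_num at this; linarith
  refine ⟨fun t => ‖T t + V t‖⁻¹ • (T t + V t), fun t => ‖T t + V t‖, hσc.norm.measurable,
    fun s hs => ⟨(hlow s hs).trans (by linarith), ?_, ?_⟩, ?_, ?_, ?_, ?_, ?_⟩
  · rw [norm_smul, norm_inv, norm_norm, inv_mul_cancel₀ (norm_ne_zero_iff.2 (hne s hs))]
  · have h1 := norm_inv_norm_smul_sub_self (hne s hs)
    have h2 := norm_sub_le_norm_sub_add_norm_sub (‖T s + V s‖⁻¹ • (T s + V s)) (T s + V s) (T s)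
    rw [h1, add_sub_cancel_left] at h2
    linarith [hlow s hs, hVb s hs]
  · simp [hVa, hu]
  · simp [hVb', hu]
  · intro x hx y hy hxy
    have hr : ∀ z ∈ Icc a b, 1 - η ≤ ‖T z + V z‖ := fun z hz => by
      linarith [(abs_le.1 (hlow z hz)).1]
    have h1 := norm_inv_norm_smul_sub_le (by linarith) (hr x hx) (hr y hy)
    have h2 : ‖T x + V x - (T y + V y)‖ ≤ (Λ' + η) * (y - x) := by
      rw [add_sub_add_comm]
      have := (norm_add_le _ _).trans (add_le_add (hT x hx y hy) (hV x hx y hy))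
      rw [abs_of_nonpos (by linarith)] at this
      linarith
    have h3 : (1 - η) * (y - x) ≤ ∫ t in x..y, ‖T t + V t‖ := by
      have := intervalIntegral.integral_mono_on hxy (intervalIntegrable_const (c := 1 - η))
        (hσc.norm.intervalIntegrable (μ := volume) x y)
        fun s hs => hr s ⟨hx.1.trans hs.1, hs.2.trans hy.2⟩
      rw [intervalIntegral.integral_const, smul_eq_mul] at this
      linarith
    have h4 : (Λ' + η) * (y - x) ≤ Λ * ((1 - η) * (1 - η)) * (y - x) := by
      refine mul_le_mul_of_nonneg_right (hη2.trans ?_) (by linarith)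
      refine mul_le_mul_of_nonneg_left ?_ (by linarith)
      nlinarith [sq_nonneg η]
    have h5 : (1 - η) * ‖‖T x + V x‖⁻¹ • (T x + V x) - ‖T y + V y‖⁻¹ • (T y + V y)‖ ≤
        (1 - η) * (Λ * ∫ t in x..y, ‖T t + V t‖) := by
      have := mul_le_mul_of_nonneg_left h3 (show 0 ≤ (1 - η) * Λ from
        mul_nonneg (by linarith) (by linarith))
      linarith
    exact le_of_mul_le_mul_left h5 (by linarith)
  · rw [← intervalIntegral.integral_add (hTm.intervalIntegrable _ _) (hVm.intervalIntegrable _ _)]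
    refine intervalIntegral.integral_congr fun t ht => ?_
    rw [uIcc_of_le hab] at ht
    exact smul_inv_smul₀ (norm_ne_zero_iff.2 (hne t ht)) _
  · have hc1 : Continuous fun t => ⟪T t, V t⟫ := hTm.inner hVm
    have hc2 : Continuous fun t => ‖V t‖ ^ 2 / 2 := by fun_prop
    have h1 : ∫ t in a..b, ‖T t + V t‖ ≤ ∫ t in a..b, (1 + ⟪T t, V t⟫ + ‖V t‖ ^ 2 / 2) := by
      refine intervalIntegral.integral_mono_on hab (hσc.norm.intervalIntegrable _ _)
        (((continuous_const.add hc1).add hc2).intervalIntegrable _ _) fun t _ => ?_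
      have := norm_add_sq_real (T t) (V t)
      rw [hu] at this
      nlinarith [sq_nonneg (‖T t + V t‖ - 1)]
    rw [intervalIntegral.integral_add (Continuous.intervalIntegrable (by fun_prop) _ _)
      (hc2.intervalIntegrable _ _), intervalIntegral.integral_add
      (continuous_const.intervalIntegrable _ _) (hc1.intervalIntegrable _ _)] at h1
    simpa using h1

end TangentVariation

lemma abs_bump_sub_le {a b x y : ℝ} (hx : x ∈ Icc a b) (hy : y ∈ Icc a b) :
    |(x - a) * (b - x) - (y - a) * (b - y)| ≤ (b - a) * |x - y| := by
  have : (x - a) * (b - x) - (y - a) * (b - y) = (a + b - x - y) * (x - y) := by ring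
  rw [this, abs_mul]
  refine mul_le_mul_of_nonneg_right (abs_le.2 ?_) (abs_nonneg _)
  constructor <;> linarith [hx.1, hx.2, hy.1, hy.2]

lemma bump_nonneg {a b x : ℝ} (hx : x ∈ Icc a b) : 0 ≤ (x - a) * (b - x) :=
  mul_nonneg (sub_nonneg.2 hx.1) (sub_nonneg.2 hx.2)

lemma bump_le {a b x : ℝ} (hx : x ∈ Icc a b) : (x - a) * (b - x) ≤ (b - a) ^ 2 := by
  rw [sq]
  exact mul_le_mul (by linarith [hx.2]) (by linarith [hx.1]) (by linarith [hx.2])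
    (by linarith [hx.1, hx.2])

lemma integral_bump_pos {a b : ℝ} (hab : a < b) : 0 < ∫ t in a..b, (t - a) * (b - t) := by
  refine intervalIntegral.integral_pos hab (by fun_prop)
    (fun x hx => bump_nonneg (Ioc_subset_Icc_self hx)) ⟨(a + b) / 2, ?_, ?_⟩
  · constructor <;> linarith
  · exact mul_pos (by linarith) (by linarith)

namespace TangentVariation

variable {n : ℕ} {Λ Λ' δ : ℝ} {T : ℝ → Euc n} {a b : ℝ}

lemma exists_amplitude (hΛ : Λ' < Λ) (hΛ' : 0 ≤ Λ') (hδ : 0 < δ) : ∃ η₀ > 0, ∀ η ≤ η₀,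
    2 * η ≤ δ ∧ η ≤ 1 / 2 ∧ Λ' + η ≤ Λ * (1 - 2 * η) := by
  have h0 : 0 < 1 + 2 * Λ := by linarith
  refine ⟨min (δ / 2) (min (1 / 2) ((Λ - Λ') / (1 + 2 * Λ))), ?_, fun η hη => ?_⟩
  · have := div_pos (sub_pos.2 hΛ) h0
    positivity
  · obtain ⟨h1, h2⟩ := le_min_iff.1 hη
    obtain ⟨h2, h3⟩ := le_min_iff.1 h2
    rw [le_div_iff₀ h0] at h3
    exact ⟨by linarith, h2, by linarith⟩

/-- If the curvature is smaller than `Λ` and the tangent field is not constant, then the curve can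
be shortened with the same end points and end directions. -/
lemma exists_shorter_of_ne (hΛ : Λ' < Λ) (hΛ' : 0 ≤ Λ') (hδ : 0 < δ)
    (hu : ∀ x, ‖T x‖ = 1) (hTm : Continuous T)
    (hT : ∀ x ∈ Icc a b, ∀ y ∈ Icc a b, ‖T x - T y‖ ≤ Λ' * |x - y|)
    {p q : ℝ} (hp : p ∈ Ioo a b) (hq : q ∈ Ioo a b) (hpq : T p ≠ T q) :
    ∃ ℓ < b - a, TangentVariation Λ δ T a b (∫ t in a..b, T t) ℓ := by
  have hab : a < b := hp.1.trans hp.2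
  have hI := integral_bump_pos hab
  set I := ∫ t in a..b, (t - a) * (b - t)
  set m : Euc n := I⁻¹ • ∫ t in a..b, ((t - a) * (b - t)) • T t with hm
  set W : ℝ → Euc n := fun t => ((t - a) * (b - t)) • (T t - m) with hW
  have hWc : Continuous W := by fun_prop
  have hW0 : ∫ t in a..b, W t = 0 := by
    have h1 : Continuous fun t => ((t - a) * (b - t)) • T t := by fun_prop
    have h2 : Continuous fun t => ((t - a) * (b - t)) • m := by fun_prop
    simp only [hW, smul_sub]
    rw [intervalIntegral.integral_sub (h1.intervalIntegrable _ _) (h2.intervalIntegrable _ _),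
      intervalIntegral.integral_smul_const, hm, smul_inv_smul₀ hI.ne', sub_self]
  have hJ : 0 < ∫ t in a..b, ⟪T t, W t⟫ := by
    have e1 : ∫ t in a..b, ⟪m, W t⟫ = 0 := by
      have := (innerSL ℝ m).intervalIntegral_comp_comm (hWc.intervalIntegrable (μ := volume) a b)
      simpa [hW0] using this
    have c1 : Continuous fun t => ⟪T t, W t⟫ := hTm.inner hWc
    have c2 : Continuous fun t => ⟪m, W t⟫ := continuous_const.inner hWc
    have e2 : ∫ t in a..b, ⟪T t, W t⟫ = ∫ t in a..b, (t - a) * (b - t) * ‖T t - m‖ ^ 2 := by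
      rw [← sub_zero (∫ t in a..b, ⟪T t, W t⟫), ← e1,
        ← intervalIntegral.integral_sub (c1.intervalIntegrable _ _) (c2.intervalIntegrable _ _)]
      refine intervalIntegral.integral_congr fun t _ => ?_
      simp only [hW, inner_smul_right]
      rw [← mul_sub, ← inner_sub_left, real_inner_self_eq_norm_sq]
    rw [e2]
    refine intervalIntegral.integral_pos hab (by fun_prop)
      (fun x hx => mul_nonneg (bump_nonneg (Ioc_subset_Icc_self hx)) (sq_nonneg _)) ?_
    have pos : ∀ c ∈ Ioo a b, T c ≠ m → 0 < (c - a) * (b - c) * ‖T c - m‖ ^ 2 := fun c hc h =>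
      mul_pos (mul_pos (sub_pos.2 hc.1) (sub_pos.2 hc.2))
        (pow_pos (norm_pos_iff.2 (sub_ne_zero.2 h)) 2)
    by_cases h : T p = m
    · exact ⟨q, Ioo_subset_Icc_self hq, pos q hq fun h' => hpq (h.trans h'.symm)⟩
    · exact ⟨p, Ioo_subset_Icc_self hp, pos p hp h⟩
  set J := ∫ t in a..b, ⟪T t, W t⟫
  set N := ∫ t in a..b, ‖W t‖ ^ 2 / 2 with hN
  have hN0 : 0 ≤ N := intervalIntegral.integral_nonneg hab.le fun t _ => by positivity
  set M := (b - a) ^ 2 * (1 + ‖m‖) + ((b - a) * (1 + ‖m‖) + (b - a) ^ 2 * Λ') + 1 with hM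
  have hba : 0 < b - a := sub_pos.2 hab
  have hMpos : 0 < M := by positivity
  have hTm' : ∀ x, ‖T x - m‖ ≤ 1 + ‖m‖ := fun x => by
    have := norm_sub_le (T x) m; rwa [hu] at this
  have hWb : ∀ x ∈ Icc a b, ‖W x‖ ≤ M := fun x hx => by
    rw [hW, norm_smul, Real.norm_eq_abs, abs_of_nonneg (bump_nonneg hx)]
    have h1 := mul_le_mul (bump_le hx) (hTm' x) (norm_nonneg _) (by positivity)
    have h2 : 0 ≤ (b - a) * (1 + ‖m‖) + (b - a) ^ 2 * Λ' := by positivity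
    linarith
  have hWL : ∀ x ∈ Icc a b, ∀ y ∈ Icc a b, ‖W x - W y‖ ≤ M * |x - y| := fun x hx y hy => by
    have e : W x - W y = ((x - a) * (b - x) - (y - a) * (b - y)) • (T x - m) +
        ((y - a) * (b - y)) • (T x - T y) := by simp only [hW]; module
    rw [e]
    refine (norm_add_le _ _).trans ?_
    rw [norm_smul, norm_smul, Real.norm_eq_abs, Real.norm_eq_abs, abs_of_nonneg (bump_nonneg hy)]
    have h1 := mul_le_mul (abs_bump_sub_le hx hy) (hTm' x) (norm_nonneg _) (by positivity)
    have h2 := mul_le_mul (bump_le hy) (hT x hx y hy) (norm_nonneg _) (by positivity)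
    have h3 : 0 ≤ ((b - a) ^ 2 * (1 + ‖m‖) + 1) * |x - y| := by positivity
    rw [hM]; linarith
  obtain ⟨η₀, hη₀, hη⟩ := exists_amplitude (Λ := Λ) hΛ hΛ' hδ
  set ε := min (η₀ / M) (J / (2 * (N + 1))) with hε
  have hεpos : 0 < ε := by positivity
  have hε1 : ε * M ≤ η₀ := (le_div_iff₀ hMpos).1 (min_le_left _ _)
  have hε2 : ε * (2 * (N + 1)) ≤ J := (le_div_iff₀ (by positivity)).1 (min_le_right _ _)
  obtain ⟨g1, g2, g3⟩ := hη (ε * M) hε1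
  have key := of_add (V := fun t => (-ε) • W t) hab.le hΛ hΛ' (by positivity) g1 g2 g3 hu hTm
    (by fun_prop) hT
    (fun x hx => by
      rw [norm_smul, norm_neg, Real.norm_eq_abs, abs_of_pos hεpos]
      exact mul_le_mul_of_nonneg_left (hWb x hx) hεpos.le) (by simp [hW]) (by simp [hW])
    (fun x hx y hy => by
      rw [← smul_sub, norm_smul, norm_neg, Real.norm_eq_abs, abs_of_pos hεpos, mul_assoc]
      exact mul_le_mul_of_nonneg_left (hWL x hx y hy) hεpos.le)
  have e3 : ∫ t in a..b, ‖(-ε) • W t‖ ^ 2 / 2 = ε ^ 2 * N := by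
    rw [hN, ← intervalIntegral.integral_const_mul]
    refine intervalIntegral.integral_congr fun t _ => ?_
    simp only [norm_smul, norm_neg, mul_pow, Real.norm_eq_abs, sq_abs]
    ring
  simp only [intervalIntegral.integral_smul, hW0, smul_zero, add_zero, inner_smul_right,
    intervalIntegral.integral_const_mul, e3] at key
  refine ⟨_, ?_, key⟩
  nlinarith [mul_pos hεpos hJ, mul_pos hεpos hεpos]

end TangentVariation

lemma absolutelyContinuous_of_abs_sub_le {f : ℝ → ℝ} {x y K : ℝ} (hxy : x ≤ y)
    (h : ∀ s ∈ Icc x y, ∀ t ∈ Icc x y, |f s - f t| ≤ K * |s - t|) :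
    AbsolutelyContinuousOnInterval f x y := by
  refine LipschitzOnWith.absolutelyContinuousOnInterval (K := K.toNNReal) ?_
  rw [uIcc_of_le hxy]
  refine LipschitzOnWith.of_dist_le_mul fun s hs t ht => ?_
  rw [Real.dist_eq, Real.dist_eq]
  refine (h s hs t ht).trans (mul_le_mul_of_nonneg_right ?_ (abs_nonneg _))
  exact Real.le_coe_toNNReal K

/-- A mean value inequality for Lipschitz curves. -/
lemma norm_sub_le_integral_of_norm_deriv_le {E : Type*} [NormedAddCommGroup E]
    [InnerProductSpace ℝ E] {σ : ℝ → E} {g : ℝ → ℝ} {x y K : ℝ} (hxy : x ≤ y)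
    (hσ : ∀ s ∈ Icc x y, ∀ t ∈ Icc x y, ‖σ s - σ t‖ ≤ K * |s - t|)
    (hg : IntervalIntegrable g volume x y)
    (h : ∀ᵐ t, t ∈ Ioo x y → ∃ σ', HasDerivAt σ σ' t ∧ ‖σ'‖ ≤ g t) :
    ‖σ x - σ y‖ ≤ ∫ t in x..y, g t := by
  set e := σ y - σ x with he
  have hac : AbsolutelyContinuousOnInterval (fun t => ⟪e, σ t⟫) x y := by
    refine absolutelyContinuous_of_abs_sub_le (K := ‖e‖ * K) hxy fun s hs t ht => ?_
    rw [← inner_sub_right, mul_assoc]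
    exact (abs_real_inner_le_norm _ _).trans
      (mul_le_mul_of_nonneg_left (hσ s hs t ht) (norm_nonneg _))
  have h1 := hac.integral_deriv_eq_sub
  rw [← inner_sub_right, real_inner_self_eq_norm_sq] at h1
  have h2 : ∫ t in x..y, deriv (fun t => ⟪e, σ t⟫) t ≤ ∫ t in x..y, ‖e‖ * g t := by
    refine intervalIntegral.integral_mono_ae_restrict hxy hac.intervalIntegrable_deriv
      (hg.const_mul _) ?_
    rw [Measure.restrict_congr_set Ioo_ae_eq_Icc.symm]
    refine (ae_restrict_iff' measurableSet_Ioo).2 ?_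
    filter_upwards [h] with t ht hmem
    obtain ⟨σ', h3, h4⟩ := ht hmem
    have h5 : HasDerivAt (fun t => ⟪e, σ t⟫) ⟪e, σ'⟫ t := by
      simpa using (hasDerivAt_const t e).inner ℝ h3
    rw [h5.deriv]
    exact (real_inner_le_norm _ _).trans (mul_le_mul_of_nonneg_left h4 (norm_nonneg _))
  rw [h1, intervalIntegral.integral_const_mul] at h2
  rw [norm_sub_rev, ← he]
  rcases (norm_nonneg e).eq_or_lt with h0 | h0
  · rw [← h0]
    refine intervalIntegral.integral_nonneg_of_ae_restrict hxy ?_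
    rw [Measure.restrict_congr_set Ioo_ae_eq_Icc.symm]
    refine (ae_restrict_iff' measurableSet_Ioo).2 ?_
    filter_upwards [h] with t ht hmem
    obtain ⟨σ', -, h4⟩ := ht hmem
    exact (norm_nonneg _).trans h4
  · rw [sq] at h2
    exact le_of_mul_le_mul_left h2 h0

lemma norm_deriv_le_of_norm_sub_le {E : Type*} [NormedAddCommGroup E] [NormedSpace ℝ E]
    {T : ℝ → E} {Λ : ℝ} (hΛ : 0 ≤ Λ) (hT : ∀ x y, ‖T x - T y‖ ≤ Λ * |x - y|) (s : ℝ) :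
    ‖deriv T s‖ ≤ Λ := by
  have : LipschitzWith Λ.toNNReal T := LipschitzWith.of_dist_le_mul fun x y => by
    rw [dist_eq_norm, Real.dist_eq, Real.coe_toNNReal _ hΛ]; exact hT x y
  simpa [hΛ] using norm_deriv_le_of_lipschitz (x₀ := s) this

lemma ae_differentiableAt_of_norm_sub_le {n : ℕ} {T : ℝ → Euc n} {Λ : ℝ} (hΛ : 0 ≤ Λ)
    (hT : ∀ x y, ‖T x - T y‖ ≤ Λ * |x - y|) : ∀ᵐ s, DifferentiableAt ℝ T s := by
  have : LipschitzWith Λ.toNNReal T := LipschitzWith.of_dist_le_mul fun x y => by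
    rw [dist_eq_norm, Real.dist_eq, Real.coe_toNNReal _ hΛ]; exact hT x y
  exact this.ae_differentiableAt

section ConformalField

variable {E : Type*} [NormedAddCommGroup E] [InnerProductSpace ℝ E] {p u v : E}

lemma norm_sub_inner_smul_le (hp : ‖p‖ = 1) (hu : ‖u‖ = 1) : ‖p - ⟪p, u⟫ • u‖ ≤ 1 := by
  have h : ‖p - ⟪p, u⟫ • u‖ ^ 2 = 1 - ⟪p, u⟫ ^ 2 := by
    rw [norm_sub_sq_real, norm_smul, hp, hu, inner_smul_right, Real.norm_eq_abs, mul_one, sq_abs]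
    ring
  nlinarith [sq_nonneg ⟪p, u⟫, norm_nonneg (p - ⟪p, u⟫ • u)]

lemma inner_sub_inner_smul_self (hu : ‖u‖ = 1) : ⟪u, p - ⟪p, u⟫ • u⟫ = 0 := by
  rw [inner_sub_right, inner_smul_right, real_inner_self_eq_norm_sq, hu, real_inner_comm]; ring

lemma norm_inner_smul_sub_le (hp : ‖p‖ = 1) (hu : ‖u‖ = 1) (hv : ‖v‖ = 1) :
    ‖(p - ⟪p, u⟫ • u) - (p - ⟪p, v⟫ • v)‖ ≤ 2 * ‖u - v‖ := by
  have e : (p - ⟪p, u⟫ • u) - (p - ⟪p, v⟫ • v) = -(⟪p, u - v⟫ • u + ⟪p, v⟫ • (u - v)) := by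
    rw [inner_sub_right]; module
  rw [e, norm_neg]
  refine (norm_add_le _ _).trans ?_
  rw [norm_smul, norm_smul, hu, Real.norm_eq_abs, Real.norm_eq_abs]
  have h1 := abs_real_inner_le_norm p (u - v)
  have h2 := abs_real_inner_le_norm p v
  rw [hp, one_mul] at h1 h2
  rw [hv] at h2
  nlinarith [norm_nonneg (u - v)]

lemma abs_inner_le_one (hp : ‖p‖ = 1) (hu : ‖u‖ = 1) : |⟪p, u⟫| ≤ 1 := by
  simpa [hp, hu] using abs_real_inner_le_norm p u

lemma norm_add_smul_sub_inner_smul_sq (hu : ‖u‖ = 1) (r : ℝ) :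
    ‖u + r • (p - ⟪p, u⟫ • u)‖ ^ 2 = 1 + r ^ 2 * ‖p - ⟪p, u⟫ • u‖ ^ 2 := by
  rw [norm_add_sq_real, inner_smul_right, inner_sub_inner_smul_self hu, norm_smul, hu, mul_pow,
    Real.norm_eq_abs, sq_abs]
  ring

/-- The velocity of `T + ε τ (p - ⟪p, T⟫ T)` is controlled by a conformal factor. Here `u` is the
value of `T`, `v` its derivative, `r` and `r'` are those of `τ`. -/
lemma norm_conformal_deriv_le {Λ K ε r r' : ℝ} (hΛ : 0 < Λ) (hε : 0 ≤ ε)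
    (hp : ‖p‖ = 1) (hu : ‖u‖ = 1) (huv : ⟪u, v⟫ = 0) (hv : ‖v‖ ≤ Λ) (hK : 0 ≤ K) (hr : |r| ≤ K)
    (hr' : |r'| ≤ K) (hεK : 2 * (ε * K) ≤ 1)
    (hψ : ε * (K / Λ + K) ≤ 1 / 2) :
    ‖v + ε • (r' • (p - ⟪p, u⟫ • u) - r • (⟪p, v⟫ • u + ⟪p, u⟫ • v))‖ ≤
      Λ * (1 + ε * (r' * ⟪p, v⟫ / Λ ^ 2 - r * ⟪p, u⟫) + ε ^ 2 * ((K + 2 * K * Λ) ^ 2 / Λ ^ 2)) := by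
  set c := ⟪p, u⟫ with hc
  set c' := ⟪p, v⟫ with hc'
  set X' := r' • (p - c • u) - r • (c' • u + c • v) with hX'
  set ψ := r' * c' / Λ ^ 2 - r * c with hψd
  set B := (K + 2 * K * Λ) ^ 2 / Λ ^ 2 with hB
  have hc1 : |c| ≤ 1 := abs_inner_le_one hp hu
  have hc1' : |c'| ≤ Λ := by
    have := abs_real_inner_le_norm p v; rw [hp, one_mul] at this; exact this.trans hv
  have hXn : ‖X'‖ ≤ K + 2 * K * Λ := by
    have h1 : ‖r' • (p - c • u)‖ ≤ K * 1 := by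
      rw [norm_smul]; exact mul_le_mul hr' (norm_sub_inner_smul_le hp hu) (norm_nonneg _) hK
    have h2 : ‖c' • u + c • v‖ ≤ 2 * Λ := by
      refine (norm_add_le _ _).trans ?_
      rw [norm_smul, norm_smul, hu, Real.norm_eq_abs, Real.norm_eq_abs]
      nlinarith [norm_nonneg v, abs_nonneg c]
    have h3 : ‖r • (c' • u + c • v)‖ ≤ K * (2 * Λ) := by
      rw [norm_smul]; exact mul_le_mul hr h2 (norm_nonneg _) hK
    have := norm_sub_le (r' • (p - c • u)) (r • (c' • u + c • v))
    linarith
  have hvX : ⟪v, X'⟫ = r' * c' - r * c * ‖v‖ ^ 2 := by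
    rw [hX', inner_sub_right, inner_smul_right, inner_smul_right, inner_sub_right, inner_add_right,
      inner_smul_right, inner_smul_right, real_inner_comm u v, huv, real_inner_comm p v, ← hc',
      inner_smul_right, real_inner_self_eq_norm_sq]
    ring
  have hB0 : 0 ≤ B := by positivity
  have hBΛ : Λ ^ 2 * B = (K + 2 * K * Λ) ^ 2 := by rw [hB]; field_simp
  have hψΛ : Λ ^ 2 * ψ = r' * c' - Λ ^ 2 * (r * c) := by rw [hψd]; field_simp
  have hψb : |ψ| ≤ K / Λ + K := by
    have h1 : |r' * c' / Λ ^ 2| ≤ K / Λ := by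
      rw [abs_div, abs_mul, abs_of_pos (by positivity : 0 < Λ ^ 2), div_le_div_iff₀ (by positivity)
        hΛ]
      have := mul_le_mul hr' hc1' (abs_nonneg _) hK
      nlinarith
    have h2 : |r * c| ≤ K := by
      rw [abs_mul]; have := mul_le_mul hr hc1 (abs_nonneg _) hK; linarith
    exact (abs_sub _ _).trans (add_le_add h1 h2)
  have hεψ : |ε * ψ| ≤ 1 / 2 := by
    rw [abs_mul, abs_of_nonneg hε]; exact (mul_le_mul_of_nonneg_left hψb hε).trans hψ
  have hεrc : 2 * (ε * (r * c)) ≤ 1 := by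
    have h2 : r * c ≤ K := by
      refine (le_abs_self _).trans ?_
      rw [abs_mul]; have := mul_le_mul hr hc1 (abs_nonneg _) hK; linarith
    have := mul_le_mul_of_nonneg_left h2 hε
    linarith
  obtain ⟨hl, hu'⟩ := abs_le.1 hεψ
  have hfin : ‖v + ε • X'‖ ^ 2 ≤ (Λ * (1 + ε * ψ + ε ^ 2 * B)) ^ 2 := by
    rw [norm_add_sq_real, inner_smul_right, hvX, norm_smul, mul_pow, Real.norm_eq_abs, sq_abs]
    have h1 : ‖v‖ ^ 2 * (1 - 2 * (ε * (r * c))) ≤ Λ ^ 2 * (1 - 2 * (ε * (r * c))) :=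
      mul_le_mul_of_nonneg_right (by gcongr) (by linarith)
    have h2 : ε ^ 2 * ‖X'‖ ^ 2 ≤ ε ^ 2 * (Λ ^ 2 * B) := by rw [hBΛ]; gcongr
    have h3 : Λ ^ 2 * (1 + 2 * (ε * ψ) + ε ^ 2 * B) ≤ (Λ * (1 + ε * ψ + ε ^ 2 * B)) ^ 2 := by
      rw [mul_pow]
      refine mul_le_mul_of_nonneg_left ?_ (sq_nonneg _)
      have h4 : 0 ≤ ε ^ 2 * B := by positivity
      nlinarith [sq_nonneg (ε * ψ), mul_nonneg h4 (show 0 ≤ 1 + 2 * (ε * ψ) by linarith),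
        sq_nonneg (ε ^ 2 * B)]
    have h5 : Λ ^ 2 * (1 + 2 * (ε * ψ) + ε ^ 2 * B) =
        Λ ^ 2 * (1 - 2 * (ε * (r * c))) + 2 * ε * (r' * c') + ε ^ 2 * (Λ ^ 2 * B) := by
      linear_combination 2 * ε * hψΛ
    linarith
  refine abs_le_of_sq_le_sq' hfin (mul_nonneg hΛ.le ?_) |>.2
  have : 0 ≤ ε ^ 2 * B := by positivity
  linarith

end ConformalField

lemma inner_deriv_eq_zero_of_norm_eq_one {E : Type*} [NormedAddCommGroup E]
    [InnerProductSpace ℝ E] {T : ℝ → E} {T' : E} {s : ℝ} (hu : ∀ x, ‖T x‖ = 1)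
    (h : HasDerivAt T T' s) : ⟪T s, T'⟫ = 0 := by
  have h1 := h.inner ℝ h
  have h2 : HasDerivAt (fun t => ⟪T t, T t⟫) 0 s := by
    simp_rw [real_inner_self_eq_norm_sq, hu]; exact hasDerivAt_const _ _
  have h3 := h1.unique h2
  rw [real_inner_comm (T s) T'] at h3
  linarith

lemma hasDerivAt_add_smul_conformal {E : Type*} [NormedAddCommGroup E] [InnerProductSpace ℝ E]
    {T : ℝ → E} {T' p : E} {τ : ℝ → ℝ} {τ' s : ℝ} (ε : ℝ) (hT : HasDerivAt T T' s)
    (hτ : HasDerivAt τ τ' s) :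
    HasDerivAt (fun t => T t + ε • τ t • (p - ⟪p, T t⟫ • T t))
      (T' + ε • (τ' • (p - ⟪p, T s⟫ • T s) - τ s • (⟪p, T'⟫ • T s + ⟪p, T s⟫ • T'))) s := by
  have h1 : HasDerivAt (fun t => ⟪p, T t⟫) ⟪p, T'⟫ s := by
    simpa using (hasDerivAt_const s p).inner ℝ hT
  have h2 : HasDerivAt (fun t => p - ⟪p, T t⟫ • T t) (-(⟪p, T s⟫ • T' + ⟪p, T'⟫ • T s)) s :=
    (h1.smul hT).const_sub p
  have h3 : HasDerivAt (fun t => τ t • (p - ⟪p, T t⟫ • T t))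
      (τ s • (-(⟪p, T s⟫ • T' + ⟪p, T'⟫ • T s)) + τ' • (p - ⟪p, T s⟫ • T s)) s := hτ.smul h2
  refine (hT.add (h3.const_smul ε)).congr_deriv ?_
  module

namespace TangentVariation

variable {n : ℕ} {Λ δ K b d : ℝ} {T : ℝ → Euc n} {p : Euc n} {τ τ' : ℝ → ℝ}

set_option maxHeartbeats 1000000 in
/-- The variation of the tangent field along the conformal fields `τ (p - ⟪p, T⟫ T)`. -/
lemma conformal (hΛ : 0 < Λ) (hδ : 0 < δ) (hbd : b ≤ d) (hu : ∀ x, ‖T x‖ = 1)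
    (hT : ∀ x y, ‖T x - T y‖ ≤ Λ * |x - y|) (hp : ‖p‖ = 1) (hb : T b = p) (hd : T d = p)
    (hK : 0 ≤ K) (hτc : Continuous τ) (hτm : Measurable τ') (hτ : ∀ x ∈ Icc b d, |τ x| ≤ K)
    (hτ' : ∀ x ∈ Icc b d, |τ' x| ≤ K)
    (hτL : ∀ x ∈ Icc b d, ∀ y ∈ Icc b d, |τ x - τ y| ≤ K * |x - y|)
    (hder : ∀ᵐ x, x ∈ Ioo b d → HasDerivAt τ (τ' x) x) :
    ∃ M ≥ 0, ∃ ε₀ > 0, ∀ ε > 0, ε ≤ ε₀ → ∃ v,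
      TangentVariation Λ δ T b d v (d - b +
        ε * (∫ t in b..d, (τ' t * ⟪p, deriv T t⟫ / Λ ^ 2 - τ t * ⟪p, T t⟫)) + M * ε ^ 2) ∧
      ‖v - (∫ t in b..d, T t) - ε • ∫ t in b..d, (τ t • (p - ⟪p, T t⟫ • T t) +
        (τ' t * ⟪p, deriv T t⟫ / Λ ^ 2 - τ t * ⟪p, T t⟫) • T t)‖ ≤ M * ε ^ 2 := by
  have hTc : Continuous T := continuous_of_norm_sub_le hT
  set X : ℝ → Euc n := fun t => τ t • (p - ⟪p, T t⟫ • T t) with hX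
  set ψ : ℝ → ℝ := fun t => τ' t * ⟪p, deriv T t⟫ / Λ ^ 2 - τ t * ⟪p, T t⟫ with hψ
  have hXc : Continuous X := by
    have : Continuous fun t => ⟪p, T t⟫ := continuous_const.inner hTc
    fun_prop
  have hψm : Measurable ψ := by
    have h1 : Measurable fun t => ⟪p, deriv T t⟫ := (measurable_deriv T).const_inner
    have h2 : Measurable fun t => ⟪p, T t⟫ := (continuous_const.inner hTc).measurable
    exact ((hτm.mul h1).div_const _).sub (hτc.measurable.mul h2)
  set B := (K + 2 * K * Λ) ^ 2 / Λ ^ 2 with hB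
  set P := K / Λ + K with hP
  have hB0 : 0 ≤ B := by positivity
  have hP0 : 0 ≤ P := by positivity
  have hKP : K ≤ P := by rw [hP]; linarith [div_nonneg hK hΛ.le]
  have hTd := norm_deriv_le_of_norm_sub_le hΛ.le hT
  have hψb : ∀ t ∈ Icc b d, |ψ t| ≤ P := fun t ht => by
    have h1 : |τ' t * ⟪p, deriv T t⟫ / Λ ^ 2| ≤ K / Λ := by
      have h0 := abs_real_inner_le_norm p (deriv T t)
      rw [hp, one_mul] at h0
      rw [abs_div, abs_mul, abs_of_pos (by positivity : 0 < Λ ^ 2),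
        div_le_div_iff₀ (by positivity) hΛ]
      have := mul_le_mul (hτ' t ht) (h0.trans (hTd t)) (abs_nonneg _) hK
      nlinarith
    have h2 : |τ t * ⟪p, T t⟫| ≤ K := by
      rw [abs_mul]
      have := mul_le_mul (hτ t ht) (abs_inner_le_one hp (hu t)) (abs_nonneg _) hK; linarith
    exact (abs_sub _ _).trans (add_le_add h1 h2)
  have hXb : ∀ t ∈ Icc b d, ‖X t‖ ≤ K := fun t ht => by
    rw [hX, norm_smul]
    have := mul_le_mul (hτ t ht) (norm_sub_inner_smul_le hp (hu t)) (norm_nonneg _) hK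
    simpa using this
  have hXL : ∀ x ∈ Icc b d, ∀ y ∈ Icc b d, ‖X x - X y‖ ≤ (K + K * (2 * Λ)) * |x - y| := by
    intro x hx y hy
    have e : X x - X y = (τ x - τ y) • (p - ⟪p, T x⟫ • T x) +
        τ y • ((p - ⟪p, T x⟫ • T x) - (p - ⟪p, T y⟫ • T y)) := by simp only [hX]; module
    rw [e]
    refine (norm_add_le _ _).trans ?_
    rw [norm_smul, norm_smul, Real.norm_eq_abs, Real.norm_eq_abs]
    have h1 := mul_le_mul (hτL x hx y hy) (norm_sub_inner_smul_le hp (hu x)) (norm_nonneg _)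
      (by positivity)
    have h2 := mul_le_mul (hτ y hy) ((norm_inner_smul_sub_le hp (hu x) (hu y)).trans
      (mul_le_mul_of_nonneg_left (hT x y) zero_le_two)) (norm_nonneg _) hK
    linarith
  set M₁ := 2 * K ^ 2 + P * K + B * (1 + K) with hM₁
  have hM₁0 : 0 ≤ M₁ := by positivity
  set A := P + B + K ^ 2 + K + 1 with hA
  have hA0 : 0 < A := by positivity
  have hbd' : 0 ≤ d - b := sub_nonneg.2 hbd
  refine ⟨(M₁ + B) * (d - b), by positivity, min 1 (min (δ / A) (1 / (2 * A))), by positivity,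
    fun ε hε hεle => ?_⟩
  obtain ⟨hε1, hεle⟩ := le_min_iff.1 hεle
  obtain ⟨hεδ, hεA⟩ := le_min_iff.1 hεle
  rw [le_div_iff₀ hA0] at hεδ
  rw [le_div_iff₀ (by positivity)] at hεA
  have hεsq : ε ^ 2 ≤ ε := by nlinarith
  have hterm : ∀ {y z : ℝ}, 0 ≤ y → 0 ≤ z → y + z ≤ A → ε * y + ε ^ 2 * z ≤ ε * A := by
    intro y z _ hz hyz
    nlinarith [mul_le_mul_of_nonneg_right hεsq hz]
  set σ : ℝ → Euc n := fun t => T t + ε • X t with hσ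
  set w : ℝ → ℝ := fun t => 1 + ε * ψ t + ε ^ 2 * B with hw
  have hσc : Continuous σ := by fun_prop
  have hwm : Measurable w := (measurable_const.add (hψm.const_mul _)).add_const _
  have hσsq : ∀ t, ‖σ t‖ ^ 2 = 1 + ε ^ 2 * ‖X t‖ ^ 2 := fun t => by
    have := norm_add_smul_sub_inner_smul_sq (p := p) (hu t) (ε * τ t)
    simp only [hσ, hX, smul_smul, norm_smul, Real.norm_eq_abs, mul_pow, sq_abs] at this ⊢
    linarith
  have hσ1 : ∀ t, 1 ≤ ‖σ t‖ := fun t => by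
    have := hσsq t
    nlinarith [norm_nonneg (σ t), mul_nonneg (sq_nonneg ε) (sq_nonneg ‖X t‖)]
  have hσ2 : ∀ t ∈ Icc b d, |‖σ t‖ - 1| ≤ ε ^ 2 * K ^ 2 := fun t ht => by
    rw [abs_of_nonneg (by linarith [hσ1 t])]
    have h1 : ε ^ 2 * ‖X t‖ ^ 2 ≤ ε ^ 2 * K ^ 2 := by gcongr; exact hXb t ht
    nlinarith [hσsq t, hσ1 t]
  have hσ0 : ∀ t, σ t ≠ 0 := fun t => norm_pos_iff.1 (one_pos.trans_le (hσ1 t))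
  have hwb : ∀ t ∈ Icc b d, |w t - 1| ≤ ε * P + ε ^ 2 * B := fun t ht => by
    have e : w t - 1 = ε * ψ t + ε ^ 2 * B := by simp only [hw]; ring
    rw [e]
    refine (abs_add_le _ _).trans ?_
    rw [abs_mul, abs_of_pos hε, abs_of_nonneg (by positivity : 0 ≤ ε ^ 2 * B)]
    have := mul_le_mul_of_nonneg_left (hψb t ht) hε.le
    linarith
  have hwδ : ∀ t ∈ Icc b d, |w t - 1| ≤ δ := fun t ht =>
    ((hwb t ht).trans (hterm hP0 hB0 (by rw [hA]; linarith [sq_nonneg K]))).trans hεδ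
  set S : ℝ → Euc n := fun t => ‖σ t‖⁻¹ • σ t with hS
  have hSc : Continuous S := by
    have : Continuous fun t => ‖σ t‖⁻¹ :=
      hσc.norm.inv₀ fun t => norm_ne_zero_iff.2 (hσ0 t)
    exact this.smul hσc
  have hSσ : ∀ t ∈ Icc b d, ‖S t - σ t‖ ≤ ε ^ 2 * K ^ 2 := fun t ht => by
    rw [hS]; dsimp only; rw [norm_inv_norm_smul_sub_self (hσ0 t)]; exact hσ2 t ht
  have hwi : IntervalIntegrable w volume b d := intervalIntegrable_of_abs_sub_one_le hbd hwm hwδ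
  have hψi : IntervalIntegrable ψ volume b d :=
    intervalIntegrable_of_bound hbd hψm.aestronglyMeasurable hψb
  have hX0 : ∀ t, T t = p → S t = T t := fun t ht => by
    have : X t = 0 := by
      simp only [hX, ht, real_inner_self_eq_norm_sq, hp]; simp
    simp [hS, hσ, this, hu]
  refine ⟨∫ t in b..d, w t • S t, ⟨S, w, hwm, fun s hs => ⟨hwδ s hs, ?_, ?_⟩, hX0 b hb, hX0 d hd,
    ?_, rfl, ?_⟩, ?_⟩
  · rw [hS, norm_smul, norm_inv, norm_norm, inv_mul_cancel₀ (norm_ne_zero_iff.2 (hσ0 s))]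
  · have h1 := norm_sub_le_norm_sub_add_norm_sub (S s) (σ s) (T s)
    have h2 : ‖σ s - T s‖ ≤ ε * K := by
      simp only [hσ, add_sub_cancel_left, norm_smul, Real.norm_eq_abs, abs_of_pos hε]
      exact mul_le_mul_of_nonneg_left (hXb s hs) hε.le
    have h3 := hterm hK (sq_nonneg K) (by rw [hA]; linarith)
    linarith [hSσ s hs]
  · intro x hx y hy hxy
    have hsub : Icc x y ⊆ Icc b d := Icc_subset_Icc hx.1 hy.2
    have h1 := norm_inv_norm_smul_sub_le one_pos (hσ1 x) (hσ1 y)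
    rw [one_mul] at h1
    refine h1.trans ?_
    rw [← intervalIntegral.integral_const_mul]
    refine norm_sub_le_integral_of_norm_deriv_le (K := Λ + ε * (K + K * (2 * Λ))) hxy ?_ ?_ ?_
    · intro s hs t ht
      have e : σ s - σ t = (T s - T t) + ε • (X s - X t) := by simp only [hσ]; module
      rw [e]
      refine (norm_add_le _ _).trans ?_
      rw [norm_smul, Real.norm_eq_abs, abs_of_pos hε]
      have := mul_le_mul_of_nonneg_left (hXL s (hsub hs) t (hsub ht)) hε.le
      linarith [hT s t]
    · exact (intervalIntegrable_of_abs_sub_one_le hxy hwm fun s hs =>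
        hwδ s (hsub hs)).const_mul _
    · filter_upwards [hder, ae_differentiableAt_of_norm_sub_le hΛ.le hT] with t h2 h3 ht
      have ht' : t ∈ Icc b d := hsub (Ioo_subset_Icc_self ht)
      have h2 := h2 ⟨hx.1.trans_lt ht.1, ht.2.trans_le hy.2⟩
      have h3 := h3.hasDerivAt
      have h5 := hasDerivAt_add_smul_conformal (p := p) ε h3 h2
      refine ⟨_, h5, ?_⟩
      have h6 := norm_conformal_deriv_le hΛ hε.le hp (hu t)
        (inner_deriv_eq_zero_of_norm_eq_one hu h3) (hTd t) hK (hτ t ht') (hτ' t ht') (ε := ε)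
        (by nlinarith [sq_nonneg K]) (by nlinarith [sq_nonneg K])
      exact h6
  · simp only [hw]
    rw [intervalIntegral.integral_add (intervalIntegrable_const.add (hψi.const_mul _))
      intervalIntegrable_const, intervalIntegral.integral_add intervalIntegrable_const
      (hψi.const_mul _), intervalIntegral.integral_const_mul]
    simp only [intervalIntegral.integral_const, smul_eq_mul]
    nlinarith [mul_nonneg (mul_nonneg hM₁0 hbd') (sq_nonneg ε)]
  · have hwS : IntervalIntegrable (fun t => w t • S t) volume b d :=
      hwi.smul_continuousOn hSc.continuousOn
    have hTi : IntervalIntegrable T volume b d := hTc.intervalIntegrable _ _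
    have hXψ : IntervalIntegrable (fun t => X t + ψ t • T t) volume b d :=
      (hXc.intervalIntegrable _ _).add (hψi.smul_continuousOn hTc.continuousOn)
    have hXψε : IntervalIntegrable (fun t => ε • (X t + ψ t • T t)) volume b d := hXψ.smul ε
    change ‖(∫ t in b..d, w t • S t) - (∫ t in b..d, T t) - ε • ∫ t in b..d, (X t + ψ t • T t)‖ ≤ _
    rw [← intervalIntegral.integral_smul, ← intervalIntegral.integral_sub hwS hTi,
      ← intervalIntegral.integral_sub (hwS.sub hTi) hXψε]
    have : ∀ t ∈ uIoc b d, ‖w t • S t - T t - ε • (X t + ψ t • T t)‖ ≤ M₁ * ε ^ 2 := by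
      intro t ht
      rw [uIoc_of_le hbd] at ht
      have ht := Ioc_subset_Icc_self ht
      have e : w t • S t - T t - ε • (X t + ψ t • T t) =
          w t • (S t - σ t) + (ε ^ 2) • (ψ t • X t + B • σ t) := by
        simp only [hw, hσ]; module
      rw [e]
      refine (norm_add_le _ _).trans ?_
      rw [norm_smul, norm_smul, Real.norm_eq_abs, Real.norm_eq_abs, abs_of_nonneg (sq_nonneg ε)]
      have h1 : |w t| ≤ 2 := by
        have h2 := (hwb t ht).trans (hterm hP0 hB0 (by rw [hA]; linarith [sq_nonneg K]))
        have h3 := abs_sub_abs_le_abs_sub (w t) 1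
        rw [abs_one] at h3
        linarith
      have h2 : ‖σ t‖ ≤ 1 + K := by
        refine (norm_add_le _ _).trans ?_
        rw [hu, norm_smul, Real.norm_eq_abs, abs_of_pos hε]
        nlinarith [hXb t ht, norm_nonneg (X t)]
      have h3 : ‖ψ t • X t + B • σ t‖ ≤ P * K + B * (1 + K) := by
        refine (norm_add_le _ _).trans ?_
        rw [norm_smul (ψ t) (X t), norm_smul B (σ t), Real.norm_eq_abs, Real.norm_eq_abs,
          abs_of_nonneg hB0]
        exact add_le_add (mul_le_mul (hψb t ht) (hXb t ht) (norm_nonneg _) hP0)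
          (mul_le_mul_of_nonneg_left h2 hB0)
      have h4 := mul_le_mul h1 (hSσ t ht) (norm_nonneg _) zero_le_two
      have h5 := mul_le_mul_of_nonneg_left h3 (sq_nonneg ε)
      rw [hM₁]; linarith
    refine (intervalIntegral.norm_integral_le_of_norm_le_const this).trans ?_
    rw [abs_of_nonneg hbd']
    nlinarith [mul_nonneg (mul_nonneg hB0 hbd') (sq_nonneg ε)]

end TangentVariation

namespace TangentVariation

variable {n : ℕ} {Λ δ K a b d : ℝ} {T : ℝ → Euc n} {p : Euc n} {τ τ' : ℝ → ℝ}

set_option maxHeartbeats 1000000 in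
/-- A conformal variation with negative first variation of length shortens a closed curve which
contains a straight segment. -/
lemma exists_shorter_of_first_variation_neg (hΛ : 0 < Λ) (hδ : 0 < δ) (hab : a < b) (hbd : b ≤ d)
    (hu : ∀ x, ‖T x‖ = 1) (hT : ∀ x y, ‖T x - T y‖ ≤ Λ * |x - y|)
    (hTp : ∀ x ∈ Icc a b, T x = p) (hd : T d = p) (hclosed : ∫ t in a..d, T t = 0)
    (hK : 0 ≤ K) (hτc : Continuous τ) (hτm : Measurable τ') (hτ : ∀ x ∈ Icc b d, |τ x| ≤ K)
    (hτ' : ∀ x ∈ Icc b d, |τ' x| ≤ K)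
    (hτL : ∀ x ∈ Icc b d, ∀ y ∈ Icc b d, |τ x - τ y| ≤ K * |x - y|)
    (hder : ∀ᵐ x, x ∈ Ioo b d → HasDerivAt τ (τ' x) x)
    (hQ : ∫ t in b..d, (1 - ⟪p, T t⟫) *
      (τ' t * ⟪p, deriv T t⟫ / Λ ^ 2 - τ t * (1 + 2 * ⟪p, T t⟫)) < 0) :
    ∃ ℓ < d - a, TangentVariation Λ δ T a d 0 ℓ := by
  have hb : T b = p := hTp b ⟨hab.le, le_rfl⟩
  have hp : ‖p‖ = 1 := hb ▸ hu b
  have hTc : Continuous T := continuous_of_norm_sub_le hT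
  obtain ⟨M, hM, ε₁, hε₁, hvar⟩ :=
    conformal hΛ hδ hbd hu hT hp hb hd hK hτc hτm hτ hτ' hτL hder
  set ψ : ℝ → ℝ := fun t => τ' t * ⟪p, deriv T t⟫ / Λ ^ 2 - τ t * ⟪p, T t⟫ with hψ
  set X : ℝ → Euc n := fun t => τ t • (p - ⟪p, T t⟫ • T t) with hX
  set Z := ∫ t in b..d, (X t + ψ t • T t) with hZ
  have hcin : Continuous fun t => ⟪p, T t⟫ := continuous_const.inner hTc
  have hψi : IntervalIntegrable ψ volume b d := by
    have h1 : IntervalIntegrable (fun t => τ' t * ⟪p, deriv T t⟫) volume b d := by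
      refine intervalIntegrable_of_bound (M := K * Λ) hbd
        (hτm.mul (measurable_deriv T).const_inner).aestronglyMeasurable fun t ht => ?_
      rw [norm_mul]
      have h0 := abs_real_inner_le_norm p (deriv T t)
      rw [hp, one_mul] at h0
      exact mul_le_mul (hτ' t ht) (h0.trans (norm_deriv_le_of_norm_sub_le hΛ.le hT t))
        (norm_nonneg _) hK
    exact (h1.div_const _).sub ((hτc.mul hcin).intervalIntegrable _ _)
  have hXψ : IntervalIntegrable (fun t => X t + ψ t • T t) volume b d := by
    have hXc : Continuous X := by fun_prop
    exact (hXc.intervalIntegrable _ _).add (hψi.smul_continuousOn hTc.continuousOn)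
  have hQ' : (∫ t in b..d, ψ t) - ⟪p, Z⟫ < 0 := by
    have e1 : ⟪p, Z⟫ = ∫ t in b..d, ⟪p, X t + ψ t • T t⟫ := by
      simpa using ((innerSL ℝ p).intervalIntegral_comp_comm hXψ).symm
    have hi : IntervalIntegrable (fun t => ⟪p, X t + ψ t • T t⟫) volume b d := by
      rw [intervalIntegrable_iff] at hXψ ⊢
      exact (innerSL ℝ p).integrable_comp hXψ
    rw [e1, ← intervalIntegral.integral_sub hψi hi]
    refine lt_of_eq_of_lt (intervalIntegral.integral_congr fun t _ => ?_) hQ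
    simp only [hX, hψ, inner_add_right, inner_smul_right, inner_sub_right,
      real_inner_self_eq_norm_sq, hp]
    ring
  have hI := integral_bump_pos hab
  set I := ∫ t in a..b, (t - a) * (b - t) with hId
  set N := ∫ t in a..b, ((t - a) * (b - t)) ^ 2 / 2 with hN
  have hN0 : 0 ≤ N := intervalIntegral.integral_nonneg hab.le fun t _ => by positivity
  set A := (b - a) ^ 2 + (b - a) with hA
  have hba : 0 < b - a := sub_pos.2 hab
  have hA0 : 0 < A := by positivity
  set R := I⁻¹ * (‖Z‖ + M) with hR
  have hR0 : 0 ≤ R := by positivity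
  obtain ⟨η₀, hη₀, hη⟩ := exists_amplitude hΛ le_rfl hδ
  set q := -((∫ t in b..d, ψ t) - ⟪p, Z⟫) with hq
  have hq0 : 0 < q := neg_pos.2 hQ'
  set G := 2 * M + N * R ^ 2 with hG
  have hG0 : 0 ≤ G := by positivity
  set ε := min (min 1 ε₁) (min (η₀ / (A * (R + 1))) (q / (2 * (G + 1)))) with hε
  have hεpos : 0 < ε := by positivity
  have hε1 : ε ≤ 1 := (min_le_left _ _).trans (min_le_left _ _)
  have hεε₁ : ε ≤ ε₁ := (min_le_left _ _).trans (min_le_right _ _)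
  have hεη : ε * (A * (R + 1)) ≤ η₀ :=
    (le_div_iff₀ (by positivity)).1 ((min_le_right _ _).trans (min_le_left _ _))
  have hεG : ε * (2 * (G + 1)) ≤ q :=
    (le_div_iff₀ (by positivity)).1 ((min_le_right _ _).trans (min_le_right _ _))
  obtain ⟨v, hv, hvE⟩ := hvar ε hεpos hεε₁
  set E := v - ∫ t in b..d, T t with hE
  set D : Euc n := -(I⁻¹ • E) with hD
  have hεsq : ε ^ 2 ≤ ε := by nlinarith
  have hEn : ‖E‖ ≤ ε * (‖Z‖ + M) := by
    have h1 := norm_add_le (E - ε • Z) (ε • Z)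
    rw [sub_add_cancel, norm_smul, Real.norm_eq_abs, abs_of_pos hεpos] at h1
    nlinarith [mul_le_mul_of_nonneg_left hεsq hM]
  have hDn : ‖D‖ ≤ ε * R := by
    rw [hD, norm_neg, norm_smul, norm_inv, Real.norm_eq_abs, abs_of_pos hI, hR]
    have := mul_le_mul_of_nonneg_left hEn (inv_nonneg.2 hI.le)
    linarith
  have hAD : A * ‖D‖ ≤ η₀ := by
    have h1 := mul_le_mul_of_nonneg_left hDn hA0.le
    nlinarith [mul_pos hεpos hA0]
  obtain ⟨g1, g2, g3⟩ := hη (A * ‖D‖) hAD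
  have hseg := of_add (V := fun t => ((t - a) * (b - t)) • D) hab.le hΛ le_rfl (by positivity)
    g1 g2 g3 hu hTc (by fun_prop)
    (fun x hx y hy => by rw [hTp x hx, hTp y hy]; simp)
    (fun x hx => by
      rw [norm_smul, Real.norm_eq_abs, abs_of_nonneg (bump_nonneg hx)]
      exact mul_le_mul_of_nonneg_right ((bump_le hx).trans (by linarith)) (norm_nonneg _))
    (by simp) (by simp)
    (fun x hx y hy => by
      rw [← sub_smul, norm_smul, Real.norm_eq_abs, mul_right_comm]
      refine mul_le_mul_of_nonneg_right ((abs_bump_sub_le hx hy).trans ?_) (norm_nonneg _)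
      exact mul_le_mul_of_nonneg_right (by nlinarith) (abs_nonneg _))
  have e1 : ∫ t in a..b, ⟪T t, ((t - a) * (b - t)) • D⟫ = -⟪p, E⟫ := by
    have : ∫ t in a..b, ⟪T t, ((t - a) * (b - t)) • D⟫ =
        ∫ t in a..b, (t - a) * (b - t) * ⟪p, D⟫ := by
      refine intervalIntegral.integral_congr fun t ht => ?_
      rw [uIcc_of_le hab.le] at ht
      simp only [hTp t ht, inner_smul_right]
    rw [this, intervalIntegral.integral_mul_const, ← hId, hD, inner_neg_right, inner_smul_right]
    field_simp
  have e2 : ∫ t in a..b, ‖((t - a) * (b - t)) • D‖ ^ 2 / 2 = N * ‖D‖ ^ 2 := by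
    rw [hN, ← intervalIntegral.integral_mul_const]
    refine intervalIntegral.integral_congr fun t _ => ?_
    simp only [norm_smul, mul_pow, Real.norm_eq_abs, sq_abs]
    ring
  have e3 : ∫ t in a..b, ((t - a) * (b - t)) • D = -E := by
    rw [intervalIntegral.integral_smul_const, ← hId, hD, smul_neg, smul_inv_smul₀ hI.ne']
  rw [e1, e2, e3] at hseg
  have hall := hseg.trans hΛ.le hab.le hbd hv
  have e4 : (∫ t in a..b, T t) + -E + v = 0 := by
    rw [← hclosed, ← intervalIntegral.integral_add_adjacent_intervals
      (hTc.intervalIntegrable a b) (hTc.intervalIntegrable b d), hE]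
    abel
  rw [e4] at hall
  refine ⟨_, ?_, hall⟩
  have h1 : -⟪p, E⟫ ≤ -(ε * ⟪p, Z⟫) + M * ε ^ 2 := by
    have := abs_real_inner_le_norm p (E - ε • Z)
    rw [hp, one_mul, inner_sub_right, inner_smul_right] at this
    have := (abs_le.1 (this.trans hvE)).1
    linarith
  have h2 : N * ‖D‖ ^ 2 ≤ N * (ε * R) ^ 2 := by gcongr
  have h3 : ε * (ε * (2 * (G + 1))) ≤ ε * q := mul_le_mul_of_nonneg_left hεG hεpos.le
  have h4 : ε * q = -(ε * ∫ t in b..d, ψ t) + ε * ⟪p, Z⟫ := by rw [hq]; ring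
  have h5 : ε ^ 2 * G = 2 * (M * ε ^ 2) + N * (ε * R) ^ 2 := by rw [hG]; ring
  have h6 : 0 < ε ^ 2 := by positivity
  nlinarith [mul_nonneg h6.le hG0]

end TangentVariation

lemma integral_eq_sub_of_ae_hasDerivAt {F F' : ℝ → ℝ} {x y : ℝ} (hxy : x ≤ y)
    (hac : AbsolutelyContinuousOnInterval F x y)
    (h : ∀ᵐ t, t ∈ Ioo x y → HasDerivAt F (F' t) t) : ∫ t in x..y, F' t = F y - F x := by
  rw [← hac.integral_deriv_eq_sub]
  refine intervalIntegral.integral_congr_ae_restrict ?_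
  rw [uIoc_of_le hxy, Measure.restrict_congr_set Ioo_ae_eq_Ioc.symm]
  refine (ae_restrict_iff' measurableSet_Ioo).2 ?_
  filter_upwards [h] with t ht hmem
  exact (ht hmem).deriv.symm

/-- Let `c` be a function with `|c| ≤ 1` and `|c'| ≤ Λ`, equal to `1` at the left end of an interval.
If the first variation of length in the direction of every conformal field is nonnegative, then
`c` has nonnegative mean. -/
lemma integral_nonneg_of_first_variation_nonneg {c c' : ℝ → ℝ} {Λ b d : ℝ} (hΛ : 0 < Λ)
    (hbd : b ≤ d) (hcL : ∀ x y, |c x - c y| ≤ Λ * |x - y|) (hc1 : ∀ x, |c x| ≤ 1)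
    (hcm : Measurable c') (hc' : ∀ x, |c' x| ≤ Λ) (hder : ∀ᵐ x, HasDerivAt c (c' x) x)
    (hb : c b = 1)
    (hQ : ∀ K : ℝ, 0 ≤ K → ∀ τ τ' : ℝ → ℝ, Continuous τ → Measurable τ' →
      (∀ x ∈ Icc b d, |τ x| ≤ K) → (∀ x ∈ Icc b d, |τ' x| ≤ K) →
      (∀ x ∈ Icc b d, ∀ y ∈ Icc b d, |τ x - τ y| ≤ K * |x - y|) →
      (∀ᵐ x, x ∈ Ioo b d → HasDerivAt τ (τ' x) x) →
      0 ≤ ∫ t in b..d, (1 - c t) * (τ' t * c' t / Λ ^ 2 - τ t * (1 + 2 * c t))) :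
    0 ≤ ∫ t in b..d, c t := by
  have hcc : Continuous c := continuous_of_norm_sub_le (Λ := Λ) hcL
  have hQ0 : ∀ K : ℝ, 0 ≤ K → ∀ τ τ' : ℝ → ℝ, Continuous τ → Measurable τ' →
      (∀ x ∈ Icc b d, |τ x| ≤ K) → (∀ x ∈ Icc b d, |τ' x| ≤ K) →
      (∀ x ∈ Icc b d, ∀ y ∈ Icc b d, |τ x - τ y| ≤ K * |x - y|) →
      (∀ᵐ x, x ∈ Ioo b d → HasDerivAt τ (τ' x) x) →
      ∫ t in b..d, (1 - c t) * (τ' t * c' t / Λ ^ 2 - τ t * (1 + 2 * c t)) = 0 := by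
    intro K hK τ τ' h1 h2 h3 h4 h5 h6
    refine le_antisymm ?_ (hQ K hK τ τ' h1 h2 h3 h4 h5 h6)
    have := hQ K hK (fun t => -τ t) (fun t => -τ' t) h1.neg h2.neg
      (fun x hx => by rw [abs_neg]; exact h3 x hx) (fun x hx => by rw [abs_neg]; exact h4 x hx)
      (fun x hx y hy => by rw [neg_sub_neg, abs_sub_comm]; exact h5 x hx y hy)
      (by filter_upwards [h6] with x hx hmem using (hx hmem).neg)
    rw [← neg_nonneg, ← intervalIntegral.integral_neg]
    refine this.trans_eq (intervalIntegral.integral_congr fun t _ => ?_)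
    ring
  -- the primitive `Y` of the Euler-Lagrange equation
  set G : ℝ → ℝ := fun t => -Λ ^ 2 * ((1 - c t) * (1 + 2 * c t)) with hG
  have hGc : Continuous G := by fun_prop
  set Y : ℝ → ℝ := fun s => ∫ t in b..s, G t with hY
  have hYd : ∀ s, HasDerivAt Y (G s) s := fun s =>
    intervalIntegral.integral_hasDerivAt_right (hGc.intervalIntegrable _ _)
      (hGc.stronglyMeasurableAtFilter _ _) hGc.continuousAt
  have hYc : Continuous Y := continuous_iff_continuousAt.2 fun s => (hYd s).continuousAt
  have hYb : Y b = 0 := intervalIntegral.integral_same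
  have hYend : Y d = 0 := by
    have h := hQ0 1 zero_le_one (fun _ => 1) (fun _ => 0) continuous_const measurable_const
      (by simp) (by simp) (by simp) (.of_forall fun x _ => hasDerivAt_const x 1)
    have e : Y d = Λ ^ 2 * ∫ t in b..d, (1 - c t) * (0 * c' t / Λ ^ 2 - 1 * (1 + 2 * c t)) := by
      rw [hY, ← intervalIntegral.integral_const_mul]
      refine intervalIntegral.integral_congr fun t _ => ?_
      simp only [hG]; ring
    rw [e, h, mul_zero]
  have hYac : ∀ {x y : ℝ}, AbsolutelyContinuousOnInterval Y x y := fun {x y} =>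
    (ContDiff.contDiffOn (contDiff_one_iff_deriv.2 ⟨fun s => (hYd s).differentiableAt, by
      rw [show deriv Y = G from funext fun s => (hYd s).deriv]; exact hGc⟩)
      ).absolutelyContinuousOnInterval
  set y : ℝ → ℝ := fun t => (1 - c t) * c' t with hy
  have hym : Measurable y := (measurable_const.sub hcc.measurable).mul hcm
  have hyb : ∀ t, |y t| ≤ 2 * Λ := fun t => by
    rw [hy, abs_mul]
    refine mul_le_mul ?_ (hc' t) (abs_nonneg _) zero_le_two
    refine (abs_sub _ _).trans ?_
    rw [abs_one]; linarith [hc1 t]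
  obtain ⟨MY, hMY⟩ := isCompact_Icc.exists_bound_of_continuousOn (hYc.continuousOn (s := Icc b d))
  have hMY0 : 0 ≤ MY := (norm_nonneg _).trans (hMY b ⟨le_rfl, hbd⟩)
  set z : ℝ → ℝ := fun t => y t - Y t with hz
  have hzm : Measurable z := hym.sub hYc.measurable
  have hyi : ∀ s t, IntervalIntegrable y volume s t := fun s t => by
    rw [intervalIntegrable_iff]
    exact Measure.integrableOn_of_bounded (M := 2 * Λ) measure_Ioc_lt_top.ne
      hym.aestronglyMeasurable (.of_forall hyb)
  have hzi : ∀ s t, IntervalIntegrable z volume s t := fun s t =>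
    (hyi s t).sub (hYc.intervalIntegrable s t)
  have hzb : ∀ t ∈ Icc b d, |z t| ≤ 2 * Λ + MY := fun t ht =>
    (abs_sub _ _).trans (add_le_add (hyb t) (hMY t ht))
  have hyY : ∀ᵐ t, t ∈ Ioo b d → y t = Y t := by
    set τ : ℝ → ℝ := fun s => ∫ t in b..s, z t with hτ
    have hτc : Continuous τ := intervalIntegral.continuous_primitive hzi b
    have hτL : ∀ s ∈ Icc b d, ∀ t ∈ Icc b d, |τ s - τ t| ≤ (2 * Λ + MY) * |s - t| := by
      intro s hs t ht
      rw [hτ, intervalIntegral.integral_interval_sub_left (hzi _ _) (hzi _ _)]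
      refine intervalIntegral.norm_integral_le_of_norm_le_const (f := z) (C := 2 * Λ + MY)
        fun x hx => hzb x ?_
      exact ordConnected_Icc.uIcc_subset ht hs (uIoc_subset_uIcc hx)
    have hτd : ∀ᵐ t, t ∈ Ioo b d → HasDerivAt τ (z t) t := by
      filter_upwards [(hzi b d).ae_hasDerivAt_integral] with t ht hmem
      have hmem' : t ∈ uIcc b d := by rw [uIcc_of_le hbd]; exact Ioo_subset_Icc_self hmem
      exact ht hmem' b left_mem_uIcc
    set K := (2 * Λ + MY) * (1 + (d - b)) with hK
    have hdb : 0 ≤ d - b := sub_nonneg.2 hbd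
    have hKle : 2 * Λ + MY ≤ K := by
      rw [hK]; nlinarith
    have hτb : τ b = 0 := intervalIntegral.integral_same
    have h := hQ0 K (by positivity) τ z hτc hzm
      (fun x hx => by
        have h1 := hτL x hx b ⟨le_rfl, hbd⟩
        rw [hτb, sub_zero, abs_of_nonneg (sub_nonneg.2 hx.1)] at h1
        refine h1.trans (mul_le_mul_of_nonneg_left ?_ (by positivity))
        linarith [hx.2])
      (fun x hx => (hzb x hx).trans hKle)
      (fun x hx y hy => (hτL x hx y hy).trans
        (mul_le_mul_of_nonneg_right hKle (abs_nonneg _))) hτd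
    have hparts : ∫ t in b..d, (z t * Y t + τ t * G t) = 0 := by
      have := integral_eq_sub_of_ae_hasDerivAt (F := fun t => τ t * Y t) hbd
        ((absolutelyContinuous_of_abs_sub_le hbd hτL).mul hYac)
        (F' := fun t => z t * Y t + τ t * G t) (by
          filter_upwards [hτd] with t ht hmem using (ht hmem).mul (hYd t))
      rw [this, hYend, hYb]; ring
    have i1 : IntervalIntegrable (fun t => z t * Y t + τ t * G t) volume b d :=
      ((hzi b d).mul_continuousOn hYc.continuousOn).add ((hτc.mul hGc).intervalIntegrable _ _)
    have i2 : IntervalIntegrable (fun t => z t ^ 2) volume b d := by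
      refine intervalIntegrable_of_bound (M := (2 * Λ + MY) ^ 2) hbd
        (hzm.pow_const 2).aestronglyMeasurable fun t ht => ?_
      rw [norm_pow]; exact pow_le_pow_left₀ (norm_nonneg _) (hzb t ht) 2
    have hsq : ∫ t in b..d, z t ^ 2 = 0 := by
      have e : ∫ t in b..d, (z t ^ 2 + (z t * Y t + τ t * G t)) = Λ ^ 2 *
          ∫ t in b..d, (1 - c t) * (z t * c' t / Λ ^ 2 - τ t * (1 + 2 * c t)) := by
        rw [← intervalIntegral.integral_const_mul]
        refine intervalIntegral.integral_congr fun t _ => ?_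
        simp only [hz, hy, hG]
        field_simp
        ring
      rw [h, mul_zero, intervalIntegral.integral_add i2 i1, hparts, add_zero] at e
      exact e
    rw [intervalIntegral.integral_of_le hbd, integral_eq_zero_iff_of_nonneg_ae
      (.of_forall fun t => sq_nonneg (z t)) i2.1] at hsq
    have hsq := (ae_restrict_iff' measurableSet_Ioc).1 hsq
    filter_upwards [hsq] with t ht hmem
    have := pow_eq_zero_iff two_ne_zero |>.1 (ht (Ioo_subset_Ioc_self hmem))
    exact sub_eq_zero.1 this
  -- conservation of energy
  have henergy : ∀ s ∈ Icc b d, Y s ^ 2 = Λ ^ 2 * ((1 - c s) ^ 3 * (1 + c s)) := by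
    intro s hs
    have hcac : AbsolutelyContinuousOnInterval c b s :=
      absolutelyContinuous_of_abs_sub_le hs.1 fun x _ y _ => hcL x y
    have hpoly : AbsolutelyContinuousOnInterval (fun t => Λ ^ 2 * ((1 - c t) ^ 3 * (1 + c t)))
        b s := by
      have hone : AbsolutelyContinuousOnInterval (fun _ : ℝ => (1 : ℝ)) b s :=
        absolutelyContinuous_of_abs_sub_le (K := 0) hs.1 (by simp)
      have hu := hone.fun_sub hcac
      have := (((hu.fun_mul hu).fun_mul hu).fun_mul (hone.fun_add hcac)).const_mul (Λ ^ 2)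
      convert this using 2
      ring
    have h := integral_eq_sub_of_ae_hasDerivAt
      (F := fun t => Y t * Y t - Λ ^ 2 * ((1 - c t) ^ 3 * (1 + c t))) hs.1
      ((hYac.fun_mul hYac).fun_sub hpoly) (F' := fun _ => 0) (by
        filter_upwards [hyY, hder] with t h1 h2 hmem
        have h1 := h1 ⟨hmem.1, hmem.2.trans_le hs.2⟩
        have h3 := ((hYd t).mul (hYd t)).sub
          ((((h2.const_sub 1).pow 3).mul (h2.const_add 1)).const_mul (Λ ^ 2))
        refine h3.congr_deriv ?_
        rw [← h1]
        simp only [hy, hG, Nat.cast_ofNat, Nat.add_one_sub_one, Pi.pow_apply]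
        ring)
    simp only [hYb, hb, intervalIntegral.integral_zero] at h
    linarith
  have hc'sq : ∀ᵐ t, t ∈ Ioo b d →
      (1 - c t) ^ 2 * c' t ^ 2 = Λ ^ 2 * ((1 - c t) ^ 3 * (1 + c t)) := by
    filter_upwards [hyY] with t ht hmem
    rw [← henergy t (Ioo_subset_Icc_self hmem), ← ht hmem, hy]; ring
  -- the test functions `1 / (1 - c + κ)`
  have hκ : ∀ κ > 0, ∫ t in b..d, (((1 - c t) / (1 - c t + κ)) ^ 2 * (1 + c t) -
      (1 - c t) / (1 - c t + κ) * (1 + 2 * c t)) = 0 := by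
    intro κ hκ
    have hu0 : ∀ t, κ ≤ 1 - c t + κ := fun t => by linarith [(abs_le.1 (hc1 t)).2]
    have hpos : ∀ t, 0 < 1 - c t + κ := fun t => hκ.trans_le (hu0 t)
    have hsq : ∀ s t, κ ^ 2 ≤ (1 - c s + κ) * (1 - c t + κ) := fun s t => by
      rw [sq]; exact mul_le_mul (hu0 s) (hu0 t) hκ.le (hpos s).le
    set K := κ⁻¹ + Λ / κ ^ 2 with hK
    have hK0 : 0 ≤ K := by positivity
    have h := hQ0 K hK0 (fun t => (1 - c t + κ)⁻¹) (fun t => c' t / (1 - c t + κ) ^ 2)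
      ((by fun_prop : Continuous fun t => 1 - c t + κ).inv₀ fun t => (hpos t).ne')
      (hcm.div ((by fun_prop : Continuous fun t => (1 - c t + κ) ^ 2).measurable))
      (fun x _ => by
        rw [abs_inv, abs_of_pos (hpos x)]
        have : 0 ≤ Λ / κ ^ 2 := by positivity
        linarith [inv_anti₀ hκ (hu0 x)])
      (fun x _ => by
        rw [abs_div, abs_of_pos (pow_pos (hpos x) 2)]
        have h1 : |c' x| / (1 - c x + κ) ^ 2 ≤ Λ / κ ^ 2 :=
          div_le_div₀ hΛ.le (hc' x) (by positivity) (by rw [sq (1 - c x + κ)]; exact hsq x x)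
        have : 0 ≤ κ⁻¹ := by positivity
        linarith)
      (fun x _ y _ => by
        have e : (1 - c x + κ)⁻¹ - (1 - c y + κ)⁻¹ =
            (c x - c y) / ((1 - c x + κ) * (1 - c y + κ)) := by
          have := (hpos x).ne'; have := (hpos y).ne'
          field_simp; ring
        rw [e, abs_div, abs_of_pos (mul_pos (hpos x) (hpos y))]
        refine (div_le_div₀ (by positivity) (hcL x y) (by positivity) (hsq x y)).trans ?_
        rw [mul_div_right_comm]
        refine mul_le_mul_of_nonneg_right ?_ (abs_nonneg _)
        have : 0 ≤ κ⁻¹ := by positivity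
        linarith)
      (by
        filter_upwards [hder] with x hx _
        refine (((hx.const_sub 1).add_const κ).fun_inv (hpos x).ne').congr_deriv ?_
        rw [neg_neg])
    rw [← h]
    refine intervalIntegral.integral_congr_ae_restrict ?_
    rw [uIoc_of_le hbd, Measure.restrict_congr_set Ioo_ae_eq_Ioc.symm]
    refine (ae_restrict_iff' measurableSet_Ioo).2 ?_
    filter_upwards [hc'sq] with t ht hmem
    have ht := ht hmem
    have := (hpos t).ne'
    by_cases hc : 1 - c t = 0
    · simp [hc]
    have h2 : c' t ^ 2 = Λ ^ 2 * ((1 - c t) * (1 + c t)) := by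
      have h3 : (1 - c t) ^ 2 ≠ 0 := pow_ne_zero 2 hc
      refine mul_left_cancel₀ h3 (ht.trans ?_)
      ring
    have h3 : c' t / (1 - c t + κ) ^ 2 * c' t / Λ ^ 2 =
        (1 - c t) * (1 + c t) / (1 - c t + κ) ^ 2 := by
      rw [div_mul_eq_mul_div, ← sq, h2]
      field_simp
    rw [h3]
    field_simp
  have hlim : Tendsto (fun k : ℕ => ∫ t in b..d, (c t + (((1 - c t) / (1 - c t + 1 / (k + 1))) ^ 2 *
      (1 + c t) - (1 - c t) / (1 - c t + 1 / (k + 1)) * (1 + 2 * c t)))) atTop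
      (𝓝 (∫ t in b..d, if c t = 1 then 1 else 0)) := by
    have hk : ∀ k : ℕ, (0 : ℝ) < 1 / (k + 1) := fun k => Nat.one_div_pos_of_nat
    have hpos : ∀ (k : ℕ) t, 0 < 1 - c t + 1 / (k + 1) := fun k t => by
      linarith [(abs_le.1 (hc1 t)).2, hk k]
    refine intervalIntegral.tendsto_integral_filter_of_dominated_convergence (fun _ => 6)
      (.of_forall fun k => ?_) (.of_forall fun k => .of_forall fun t _ => ?_)
      intervalIntegrable_const (.of_forall fun t _ => ?_)
    · have hr : Continuous fun t => (1 - c t) / (1 - c t + 1 / ((k : ℝ) + 1)) :=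
        Continuous.div (by fun_prop) (by fun_prop) fun t => (hpos k t).ne'
      exact Continuous.aestronglyMeasurable (by fun_prop)
    · obtain ⟨h1, h2⟩ := abs_le.1 (hc1 t)
      set r := (1 - c t) / (1 - c t + 1 / ((k : ℝ) + 1)) with hr
      have hr0 : 0 ≤ r := div_nonneg (by linarith) (hpos k t).le
      have hr1 : r ≤ 1 := (div_le_one (hpos k t)).2 (by linarith [hk k])
      have h3 : 0 ≤ r ^ 2 * (1 + c t) := mul_nonneg (sq_nonneg _) (by linarith)
      have h4 : r ^ 2 * (1 + c t) ≤ 1 * 2 :=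
        mul_le_mul (by nlinarith) (by linarith) (by linarith) zero_le_one
      rw [Real.norm_eq_abs, abs_le]
      constructor <;> nlinarith
    · by_cases hc : c t = 1
      · simp [hc]
      · rw [if_neg hc]
        have hr : Tendsto (fun k : ℕ => (1 - c t) / (1 - c t + 1 / ((k : ℝ) + 1))) atTop (𝓝 1) := by
          have hne : 1 - c t ≠ 0 := sub_ne_zero.2 (Ne.symm hc)
          have := (tendsto_const_nhds (x := 1 - c t)).div ((tendsto_const_nhds (x := 1 - c t)).add
            (tendsto_one_div_add_atTop_nhds_zero_nat (𝕜 := ℝ))) (by simpa using hne)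
          rw [add_zero, div_self hne] at this
          exact this
        have := (((hr.pow 2).mul_const (1 + c t)).sub (hr.mul_const (1 + 2 * c t))).const_add (c t)
        convert this using 2
        ring
  have hconst : ∀ k : ℕ, ∫ t in b..d, (c t + (((1 - c t) / (1 - c t + 1 / ((k : ℝ) + 1))) ^ 2 *
      (1 + c t) - (1 - c t) / (1 - c t + 1 / (k + 1)) * (1 + 2 * c t))) = ∫ t in b..d, c t := by
    intro k
    have hk : (0 : ℝ) < 1 / (k + 1) := Nat.one_div_pos_of_nat
    have hr : Continuous fun t => (1 - c t) / (1 - c t + 1 / ((k : ℝ) + 1)) :=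
      Continuous.div (by fun_prop) (by fun_prop) fun t => by
        have := (abs_le.1 (hc1 t)).2
        exact (by linarith : 0 < 1 - c t + 1 / ((k : ℝ) + 1)).ne'
    rw [intervalIntegral.integral_add (hcc.intervalIntegrable _ _)
      (Continuous.intervalIntegrable (by fun_prop) _ _), hκ _ hk, add_zero]
  simp only [hconst] at hlim
  rw [tendsto_nhds_unique tendsto_const_nhds hlim]
  exact intervalIntegral.integral_nonneg hbd fun t _ => by split_ifs <;> norm_num

namespace TangentVariation

variable {n : ℕ} {Λ Λ' δ a b d : ℝ} {T : ℝ → Euc n}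

/-- A closed curve whose curvature is smaller than the maximal allowed value on some interval can be
shortened by arbitrarily small variations. -/
theorem exists_shorter (hΛ : Λ' < Λ) (hΛ' : 0 ≤ Λ') (hδ : 0 < δ) (hab : a < b) (hbd : b ≤ d)
    (hu : ∀ x, ‖T x‖ = 1) (hT : ∀ x y, ‖T x - T y‖ ≤ Λ * |x - y|)
    (hT' : ∀ x ∈ Icc a b, ∀ y ∈ Icc a b, ‖T x - T y‖ ≤ Λ' * |x - y|) (had : T d = T a)
    (hclosed : ∫ t in a..d, T t = 0) :
    ∃ ℓ < d - a, TangentVariation Λ δ T a d 0 ℓ := by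
  have hΛ0 : 0 < Λ := hΛ'.trans_lt hΛ
  have hTc : Continuous T := continuous_of_norm_sub_le hT
  have hsplit : (∫ t in a..b, T t) + ∫ t in b..d, T t = 0 := by
    rw [intervalIntegral.integral_add_adjacent_intervals (hTc.intervalIntegrable _ _)
      (hTc.intervalIntegrable _ _), hclosed]
  by_cases hne : ∃ p ∈ Ioo a b, ∃ q ∈ Ioo a b, T p ≠ T q
  · obtain ⟨p, hp, q, hq, hpq⟩ := hne
    obtain ⟨ℓ, hℓ, hv⟩ := exists_shorter_of_ne hΛ hΛ' hδ hu hTc hT' hp hq hpq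
    have := hv.trans hΛ0.le hab.le hbd (refl hδ.le hu hT)
    rw [hsplit] at this
    exact ⟨_, by linarith, this⟩
  push Not at hne
  have hmid : (a + b) / 2 ∈ Ioo a b := ⟨by linarith, by linarith⟩
  set p := T ((a + b) / 2)
  have hTp : ∀ x ∈ Icc a b, T x = p := by
    have : EqOn T (fun _ => p) (closure (Ioo a b)) :=
      EqOn.closure (fun x hx => hne x hx _ hmid) hTc continuous_const
    rwa [closure_Ioo hab.ne] at this
  have hpa : T a = p := hTp a ⟨le_rfl, hab.le⟩
  have hp : ‖p‖ = 1 := hu _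
  by_contra hno
  have h0 := integral_nonneg_of_first_variation_nonneg (c := fun t => ⟪p, T t⟫)
    (c' := fun t => ⟪p, deriv T t⟫) hΛ0 hbd
    (fun x y => by
      rw [← inner_sub_right]
      refine (abs_real_inner_le_norm _ _).trans ?_
      rw [hp, one_mul]; exact hT x y)
    (fun x => abs_inner_le_one hp (hu x)) (measurable_deriv T).const_inner
    (fun x => by
      refine (abs_real_inner_le_norm _ _).trans ?_
      rw [hp, one_mul]; exact norm_deriv_le_of_norm_sub_le hΛ0.le hT x)
    (by
      filter_upwards [ae_differentiableAt_of_norm_sub_le hΛ0.le hT] with x hx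
      simpa using (hasDerivAt_const x p).inner ℝ hx.hasDerivAt)
    (by rw [hTp b ⟨hab.le, le_rfl⟩, real_inner_self_eq_norm_sq, hp, one_pow])
    (fun K hK τ τ' h1 h2 h3 h4 h5 h6 => by
      by_contra hlt
      exact hno (exists_shorter_of_first_variation_neg hΛ0 hδ hab hbd hu hT hTp (had.trans hpa)
        hclosed hK h1 h2 h3 h4 h5 h6 (not_le.1 hlt)))
  have h1 : ∫ t in a..b, T t = (b - a) • p := by
    rw [← intervalIntegral.integral_const]
    exact intervalIntegral.integral_congr fun t ht => hTp t (by rwa [uIcc_of_le hab.le] at ht)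
  have h2 : ∫ t in b..d, ⟪p, T t⟫ = ⟪p, ∫ t in b..d, T t⟫ :=
    (innerSL ℝ p).intervalIntegral_comp_comm (hTc.intervalIntegrable _ _)
  rw [h2, eq_neg_of_add_eq_zero_right hsplit, h1, inner_neg_right, inner_smul_right,
    real_inner_self_eq_norm_sq, hp] at h0
  linarith

end TangentVariation

/-- A Lipschitz function on an interval with equal values at both ends has a periodic Lipschitz
extension. -/
lemma exists_periodic_extension {E : Type*} [NormedAddCommGroup E] {g : ℝ → E} {P Λ : ℝ}
    (hP : 0 < P) (hΛ : 0 ≤ Λ) (hg : ∀ x ∈ Icc 0 P, ∀ y ∈ Icc 0 P, ‖g x - g y‖ ≤ Λ * |x - y|)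
    (h0 : g 0 = g P) :
    ∃ G : ℝ → E, (∀ x, G (x + P) = G x) ∧ (∀ x ∈ Icc 0 P, G x = g x) ∧
      ∀ x y, ‖G x - G y‖ ≤ Λ * |x - y| := by
  have hper : ∀ x, P * Int.fract ((x + P) / P) = P * Int.fract (x / P) := fun x => by
    rw [add_div, div_self hP.ne', Int.fract_add_one]
  refine ⟨fun x => g (P * Int.fract (x / P)), fun x => by simp only [hper], fun x hx => ?_, ?_⟩
  · rcases hx.2.eq_or_lt with rfl | hlt
    · simp [div_self hP.ne', h0]
    · simp only []
      rw [Int.fract_eq_self.2 ⟨div_nonneg hx.1 hP.le, (div_lt_one hP).2 hlt⟩,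
        mul_div_cancel₀ _ hP.ne']
  have key : ∀ x y, x ≤ y →
      ‖g (P * Int.fract (x / P)) - g (P * Int.fract (y / P))‖ ≤ Λ * (y - x) := by
    intro x y hxy
    have hmem : ∀ z, P * Int.fract (z / P) ∈ Icc 0 P := fun z =>
      ⟨mul_nonneg hP.le (Int.fract_nonneg _), mul_le_of_le_one_right hP.le (Int.fract_lt_one _).le⟩
    have hz : ∀ z, P * Int.fract (z / P) = z - ⌊z / P⌋ * P := fun z => by
      rw [← Int.self_sub_floor, mul_sub, mul_div_cancel₀ _ hP.ne', mul_comm P]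
    have hfl : ⌊x / P⌋ ≤ ⌊y / P⌋ := Int.floor_mono (by gcongr)
    rcases hfl.eq_or_lt with heq | hlt
    · refine (hg _ (hmem x) _ (hmem y)).trans_eq ?_
      rw [hz, hz, heq, abs_sub_comm]
      rw [abs_of_nonneg] <;> linarith
    · have h1 := hg _ (hmem x) P ⟨hP.le, le_rfl⟩
      have h2 := hg 0 ⟨le_rfl, hP.le⟩ _ (hmem y)
      rw [abs_sub_comm, abs_of_nonneg (sub_nonneg.2 (hmem x).2)] at h1
      rw [zero_sub, abs_neg, abs_of_nonneg (hmem y).1] at h2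
      have hle : ((⌊x / P⌋ : ℝ) + 1) ≤ ⌊y / P⌋ := by exact_mod_cast hlt
      calc ‖g (P * Int.fract (x / P)) - g (P * Int.fract (y / P))‖
          = ‖(g (P * Int.fract (x / P)) - g P) + (g 0 - g (P * Int.fract (y / P)))‖ := by
            rw [h0]; congr 1; abel
        _ ≤ Λ * (P - P * Int.fract (x / P)) + Λ * (P * Int.fract (y / P)) :=
            (norm_add_le _ _).trans (add_le_add h1 h2)
        _ = Λ * (y - x - (⌊y / P⌋ - (⌊x / P⌋ + 1)) * P) := by rw [hz, hz]; ring
        _ ≤ Λ * (y - x) := by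
            refine mul_le_mul_of_nonneg_left ?_ hΛ
            nlinarith
  intro x y
  rcases le_total x y with h | h
  · refine (key x y h).trans_eq ?_
    rw [abs_sub_comm, abs_of_nonneg (sub_nonneg.2 h)]
  · rw [norm_sub_rev, abs_of_nonneg (sub_nonneg.2 h)]
    exact key y x h

/-- Change of variables for the primitive of a bounded measurable function. -/
lemma integral_comp_primitive {n : ℕ} {G : ℝ → Euc n} {w : ℝ → ℝ} {a b M : ℝ} (hab : a ≤ b)
    (hG : Continuous G) (hw : Measurable w) (hM : ∀ x, |w x| ≤ M) :
    ∫ t in a..b, w t • G (∫ u in a..t, w u) = ∫ t in (0 : ℝ)..∫ u in a..b, w u, G t := by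
  have hwi : ∀ x y, IntervalIntegrable w volume x y := fun x y => by
    rw [intervalIntegrable_iff]
    exact Measure.integrableOn_of_bounded (M := M) measure_Ioc_lt_top.ne
      hw.aestronglyMeasurable (.of_forall hM)
  set φ : ℝ → ℝ := fun s => ∫ u in a..s, w u with hφ
  have hφL : ∀ x y, |φ x - φ y| ≤ M * |x - y| := fun x y => by
    rw [hφ]; simp only []
    rw [intervalIntegral.integral_interval_sub_left (hwi _ _) (hwi _ _)]
    exact intervalIntegral.norm_integral_le_of_norm_le_const (f := w) fun t _ => hM t
  have hφc : Continuous φ := continuous_of_norm_sub_le (Λ := M) hφL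
  have hM0 : 0 ≤ M := (abs_nonneg _).trans (hM 0)
  set v := (∫ t in a..b, w t • G (φ t)) - ∫ t in (0 : ℝ)..φ b, G t with hv
  have hwG : IntervalIntegrable (fun t => w t • G (φ t)) volume a b :=
    (hwi a b).smul_continuousOn (hG.comp hφc).continuousOn
  set F : ℝ → ℝ := fun s => ∫ t in (0 : ℝ)..s, ⟪v, G t⟫ with hF
  have hvG : Continuous fun t => ⟪v, G t⟫ := continuous_const.inner hG
  have hFd : ∀ s, HasDerivAt F ⟪v, G s⟫ s := fun s =>
    intervalIntegral.integral_hasDerivAt_right (hvG.intervalIntegrable _ _)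
      (hvG.stronglyMeasurableAtFilter _ _) hvG.continuousAt
  obtain ⟨B, hB⟩ := (isCompact_Icc.image hφc).isBounded.exists_norm_le (E := ℝ)
    (s := φ '' Icc a b)
  obtain ⟨N, hN⟩ := (isCompact_Icc (a := -B) (b := B)).exists_bound_of_continuousOn hvG.continuousOn
  have hFL : ∀ s ∈ Icc a b, ∀ t ∈ Icc a b, |F (φ s) - F (φ t)| ≤ N * M * |s - t| := by
    intro s hs t ht
    have hs' := abs_le.1 (hB _ (mem_image_of_mem φ hs))
    have ht' := abs_le.1 (hB _ (mem_image_of_mem φ ht))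
    rw [hF]; simp only []
    rw [intervalIntegral.integral_interval_sub_left (hvG.intervalIntegrable _ _)
      (hvG.intervalIntegrable _ _)]
    have h0 : 0 ≤ N := (norm_nonneg _).trans (hN _ hs')
    refine (intervalIntegral.norm_integral_le_of_norm_le_const (C := N) fun x hx => hN x
      (ordConnected_Icc.uIcc_subset ht' hs' (uIoc_subset_uIcc hx))).trans ?_
    rw [mul_assoc]
    exact mul_le_mul_of_nonneg_left (hφL s t) h0
  have hder : ∀ᵐ t, t ∈ Ioo a b → HasDerivAt (fun s => F (φ s)) ⟪v, w t • G (φ t)⟫ t := by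
    filter_upwards [(hwi a b).ae_hasDerivAt_integral] with t ht hmem
    have h1 : HasDerivAt φ (w t) t :=
      ht (by rw [uIcc_of_le hab]; exact Ioo_subset_Icc_self hmem) a left_mem_uIcc
    refine ((hFd (φ t)).comp t h1).congr_deriv ?_
    rw [inner_smul_right, mul_comm]
  have h1 := integral_eq_sub_of_ae_hasDerivAt hab (absolutelyContinuous_of_abs_sub_le hab hFL) hder
  have h2 : ∫ t in a..b, ⟪v, w t • G (φ t)⟫ = ⟪v, ∫ t in a..b, w t • G (φ t)⟫ :=
    (innerSL ℝ v).intervalIntegral_comp_comm hwG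
  have h3 : F (φ b) = ⟪v, ∫ t in (0 : ℝ)..φ b, G t⟫ :=
    (innerSL ℝ v).intervalIntegral_comp_comm (hG.intervalIntegrable _ _)
  have h4 : F (φ a) = 0 := by
    have : φ a = 0 := intervalIntegral.integral_same
    rw [this]; exact intervalIntegral.integral_same
  have h5 : ⟪v, v⟫ = 0 := by
    nth_rewrite 2 [hv]
    rw [inner_sub_right, ← h2, h1, h4, h3, sub_zero, sub_self]
  exact sub_eq_zero.1 (inner_self_eq_zero.1 h5)

/-- Reparametrizing a variation of a closed curve by arclength. -/
lemma TangentVariation.exists_periodic {n : ℕ} {Λ δ a L ℓ : ℝ} {T : ℝ → Euc n}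
    (h : TangentVariation Λ δ T a (a + L) 0 ℓ) (hΛ : 0 < Λ) (hL : 0 < L)
    (hδ1 : δ ≤ 1 / 2) (hper : ∀ x, T (x + L) = T x) :
    ∃ L' : ℝ, ∃ G : ℝ → Euc n, 0 < L' ∧ L' ≤ ℓ ∧ |L' - L| ≤ δ * L ∧ (∀ x, G (x + L') = G x) ∧
      (∀ x, ‖G x‖ = 1) ∧ (∀ x y, ‖G x - G y‖ ≤ Λ * |x - y|) ∧ ∫ t in (0 : ℝ)..L', G t = 0 ∧
      ∀ s, ‖G (L' * s) - T (L * s)‖ ≤ (1 + 2 * Λ * L) * δ := by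
  obtain ⟨S, w₀, hwm, hb, hSa, hSb, hSL, hS0, hℓ⟩ := h
  have haL : a ≤ a + L := by linarith
  have hδ0 : 0 ≤ δ := (abs_nonneg _).trans (hb a ⟨le_rfl, haL⟩).1
  set w : ℝ → ℝ := (Icc a (a + L)).piecewise w₀ 1 with hw
  have hweq : ∀ s ∈ Icc a (a + L), w s = w₀ s := fun s hs => piecewise_eq_of_mem _ _ _ hs
  have hwm' : Measurable w := hwm.piecewise measurableSet_Icc measurable_const
  have hw1 : ∀ s, |w s - 1| ≤ δ := fun s => by
    by_cases hs : s ∈ Icc a (a + L)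
    · rw [hweq s hs]; exact (hb s hs).1
    · rw [hw, piecewise_eq_of_notMem _ _ _ hs]; simpa using hδ0
  have hwM : ∀ s, |w s| ≤ 3 / 2 := fun s => by
    have := abs_le.1 (hw1 s)
    exact abs_le.2 ⟨by linarith, by linarith⟩
  have hwi : ∀ x y, IntervalIntegrable w volume x y := fun x y => by
    rw [intervalIntegrable_iff]
    exact Measure.integrableOn_of_bounded (M := 3 / 2) measure_Ioc_lt_top.ne
      hwm'.aestronglyMeasurable (.of_forall hwM)
  set φ : ℝ → ℝ := fun s => ∫ u in a..s, w u with hφ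
  have hφsub : ∀ x y, φ y - φ x = ∫ u in x..y, w u := fun x y =>
    intervalIntegral.integral_interval_sub_left (hwi _ _) (hwi _ _)
  have hφδ : ∀ x y, |φ y - φ x - (y - x)| ≤ δ * |y - x| := fun x y => by
    have : φ y - φ x - (y - x) = ∫ u in x..y, (w u - 1) := by
      rw [intervalIntegral.integral_sub (hwi _ _) intervalIntegrable_const, hφsub]; simp
    rw [this]
    exact intervalIntegral.norm_integral_le_of_norm_le_const (f := fun u => w u - 1)
      fun t _ => hw1 t
  have hφc : Continuous φ := intervalIntegral.continuous_primitive hwi a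
  have hφmono : StrictMono φ := fun x y hxy => by
    have h1 := abs_le.1 (hφδ x y)
    rw [abs_of_pos (sub_pos.2 hxy)] at h1
    nlinarith [h1.1]
  have hφa : φ a = 0 := intervalIntegral.integral_same
  set L' := φ (a + L) with hL'
  have hL'0 : 0 < L' := hφa ▸ hφmono (by linarith : a < a + L)
  have hφL := hφδ a (a + L)
  rw [hφa, sub_zero, add_sub_cancel_left, abs_of_pos hL] at hφL
  have hL'w : L' = ∫ u in a..(a + L), w₀ u :=
    intervalIntegral.integral_congr fun t ht => hweq t (by rwa [uIcc_of_le haL] at ht)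
  have hsurj : ∀ t ∈ Icc 0 L', ∃ s ∈ Icc a (a + L), φ s = t := fun t ht =>
    intermediate_value_Icc haL hφc.continuousOn (by rwa [hφa])
  choose! σ hσmem hσ using hsurj
  have hσφ : ∀ s ∈ Icc a (a + L), φ s ∈ Icc 0 L' ∧ σ (φ s) = s := fun s hs => by
    have hm : φ s ∈ Icc 0 L' := ⟨hφa ▸ hφmono.monotone hs.1, hφmono.monotone hs.2⟩
    exact ⟨hm, hφmono.injective (hσ _ hm)⟩
  have hSle : ∀ x ∈ Icc 0 L', ∀ y ∈ Icc 0 L', x ≤ y → ‖S (σ x) - S (σ y)‖ ≤ Λ * (y - x) := by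
    intro x hx y hy hxy
    have hle : σ x ≤ σ y := hφmono.le_iff_le.1 (by rwa [hσ x hx, hσ y hy])
    refine (hSL _ (hσmem x hx) _ (hσmem y hy) hle).trans_eq ?_
    rw [← intervalIntegral.integral_congr (f := w) fun t ht => hweq t ?_, ← hφsub, hσ x hx, hσ y hy]
    exact ordConnected_Icc.uIcc_subset (hσmem x hx) (hσmem y hy) ht
  have hSg : ∀ x ∈ Icc 0 L', ∀ y ∈ Icc 0 L', ‖S (σ x) - S (σ y)‖ ≤ Λ * |x - y| := by
    intro x hx y hy
    rcases le_total x y with hxy | hxy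
    · rw [abs_sub_comm, abs_of_nonneg (sub_nonneg.2 hxy)]; exact hSle x hx y hy hxy
    · rw [abs_of_nonneg (sub_nonneg.2 hxy), norm_sub_rev]; exact hSle y hy x hx hxy
  have hσ0 : σ 0 = a := by
    have := (hσφ a ⟨le_rfl, haL⟩).2; rwa [hφa] at this
  have hσL : σ L' = a + L := (hσφ (a + L) ⟨haL, le_rfl⟩).2
  obtain ⟨G, hGper, hGeq, hGL⟩ := exists_periodic_extension (g := fun t => S (σ t)) hL'0 hΛ.le hSg
    (by simp only [hσ0, hσL, hSa, hSb, hper])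
  have hGc : Continuous G := continuous_of_norm_sub_le hGL
  have hGfr : ∀ u, G (L' * u) = G (L' * Int.fract u) := fun u => by
    have hp : Function.Periodic G L' := hGper
    nth_rewrite 1 [← Int.fract_add_floor u]
    rw [mul_add, mul_comm L' (⌊u⌋ : ℝ)]
    exact hp.int_mul ⌊u⌋ _
  have hTfr : ∀ u, T (a + L * u) = T (a + L * Int.fract u) := fun u => by
    have hp : Function.Periodic T L := hper
    nth_rewrite 1 [← Int.fract_add_floor u]
    rw [mul_add, mul_comm L (⌊u⌋ : ℝ), ← add_assoc]
    exact hp.int_mul ⌊u⌋ _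
  have hmem : ∀ u, L' * Int.fract u ∈ Icc 0 L' := fun u =>
    ⟨mul_nonneg hL'0.le (Int.fract_nonneg _),
      mul_le_of_le_one_right hL'0.le (Int.fract_lt_one _).le⟩
  have hclose : ∀ u, ‖G (L' * u) - T (a + L * u)‖ ≤ (1 + 2 * Λ * L) * δ := by
    intro u
    rw [hGfr, hTfr]
    set r := Int.fract u with hr
    have hr0 : 0 ≤ r := Int.fract_nonneg u
    have hr1 : r ≤ 1 := (Int.fract_lt_one u).le
    have hs : a + L * r ∈ Icc a (a + L) := ⟨by nlinarith, by nlinarith⟩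
    obtain ⟨hφm, hφs⟩ := hσφ _ hs
    have h1 : ‖G (L' * r) - G (φ (a + L * r))‖ ≤ Λ * (2 * L * δ) := by
      refine (hGL _ _).trans (mul_le_mul_of_nonneg_left ?_ hΛ.le)
      have h2 := hφδ a (a + L * r)
      rw [hφa, sub_zero, add_sub_cancel_left, abs_of_nonneg (mul_nonneg hL.le hr0)] at h2
      have e : L' * r - φ (a + L * r) = (L' - L) * r - (φ (a + L * r) - L * r) := by ring
      rw [e]
      refine (abs_sub _ _).trans ?_
      rw [abs_mul, abs_of_nonneg hr0]
      have h3 : |L' - L| * r ≤ δ * L * 1 := mul_le_mul hφL hr1 hr0 (by positivity)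
      have h4 : δ * (L * r) ≤ δ * L := by
        rw [← mul_assoc]; exact mul_le_of_le_one_right (by positivity) hr1
      linarith
    have h2 : G (φ (a + L * r)) = S (a + L * r) := by rw [hGeq _ hφm, hφs]
    calc ‖G (L' * r) - T (a + L * r)‖
        ≤ ‖G (L' * r) - G (φ (a + L * r))‖ + ‖G (φ (a + L * r)) - T (a + L * r)‖ :=
          norm_sub_le_norm_sub_add_norm_sub _ _ _
      _ ≤ Λ * (2 * L * δ) + δ := add_le_add h1 (h2 ▸ (hb _ hs).2.2)
      _ = (1 + 2 * Λ * L) * δ := by ring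
  have hint : ∫ t in (0 : ℝ)..L', G t = 0 := by
    rw [← integral_comp_primitive haL hGc hwm' hwM, ← hS0]
    refine intervalIntegral.integral_congr fun t ht => ?_
    rw [uIcc_of_le haL] at ht
    obtain ⟨hφm, hφs⟩ := hσφ _ ht
    have : G (∫ u in a..t, w u) = S t := (hGeq _ hφm).trans (by rw [hφs])
    simp only [this, hweq t ht]
  have hper' : Function.Periodic G L' := hGper
  refine ⟨L', fun t => G (t - L' * (a / L)), hL'0, hL'w.trans_le hℓ, hφL, fun x => ?_, fun x => ?_,
    fun x y => ?_, ?_, fun s => ?_⟩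
  · simp only []
    rw [add_sub_right_comm]; exact hGper _
  · simp only []
    rw [show x - L' * (a / L) = L' * (x / L' - a / L) by field_simp, hGfr, hGeq _ (hmem _)]
    exact (hb _ (hσmem _ (hmem _))).2.1
  · simpa using hGL (x - L' * (a / L)) (y - L' * (a / L))
  · rw [intervalIntegral.integral_comp_sub_right (fun t => G t), ← hint]
    have := hper'.intervalIntegral_add_eq (0 - L' * (a / L)) 0
    rw [zero_add] at this
    rw [← this]; congr 1; ring
  · have h1 := hclose (s - a / L)
    rwa [mul_sub, mul_sub, mul_div_cancel₀ _ hL.ne', add_sub_cancel] at h1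

/-- A positive continuous function which is periodic in the first variable is bounded away from
zero when the second variable stays in a compact interval. -/
lemma exists_pos_le_of_periodic {F : ℝ → ℝ → ℝ} (r s : ℝ)
    (hF : Continuous fun z : ℝ × ℝ => F z.1 z.2) (hper : ∀ v, Function.Periodic (fun u => F u v) 1)
    (hpos : ∀ u, ∀ v ∈ Icc r s, 0 < F u v) : ∃ m > 0, ∀ u, ∀ v ∈ Icc r s, m ≤ F u v := by
  obtain ⟨m, hm, hle⟩ := ((isCompact_Icc (a := (0 : ℝ)) (b := 1)).prod
    (isCompact_Icc (a := r) (b := s))).exists_forall_le' hF.continuousOn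
    (a := 0) fun z hz => hpos z.1 z.2 hz.2
  refine ⟨m, hm, fun u v hv => ?_⟩
  have h := hle (Int.fract u, v) ⟨⟨Int.fract_nonneg u, (Int.fract_lt_one u).le⟩, hv⟩
  have e : F u v = F (Int.fract u) v := by
    have := (hper v).int_mul ⌊u⌋ (Int.fract u)
    simp only [mul_one, Int.fract_add_floor] at this
    exact this
  rwa [e]

namespace Knot

variable {n : ℕ} (k : Knot n)

lemma periodic_rescaled : Function.Periodic (fun s => k.f (k.L * s)) 1 := fun s => by
  simp only [mul_add, mul_one, k.per]

lemma periodic_rescaled_fd : Function.Periodic (fun s => k.fd (k.L * s)) 1 := fun s => by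
  simp only [mul_add, mul_one, k.perd]

lemma hasDerivAt_rescaled (s : ℝ) :
    HasDerivAt (fun s => k.f (k.L * s)) (k.L • k.fd (k.L * s)) s := by
  have h := (k.deriv (k.L * s)).scomp s ((hasDerivAt_id s).const_mul k.L)
  exact h.congr_deriv (by rw [mul_one])

/-- Closed curves `C¹`-close to a knot are embedded. -/
lemma exists_injOn_of_close : ∃ ε > 0, ∀ g g' : ℝ → Euc n, Function.Periodic g 1 →
    (∀ s, HasDerivAt g (g' s) s) → (∀ s, ‖g s - k.f (k.L * s)‖ ≤ ε) →
    (∀ s, ‖g' s - k.L • k.fd (k.L * s)‖ ≤ ε) → InjOn g (Ico 0 1) := by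
  have hL := k.Lpos
  obtain ⟨C, hC⟩ := k.lipd
  have hCb : ∀ x y, ‖k.fd x - k.fd y‖ ≤ C * |x - y| := fun x y => by
    simpa [dist_eq_norm] using hC.dist_le_mul x y
  set r : ℝ := min (1 / 2) (1 / (4 * (C * k.L + 1))) with hr
  have hr0 : 0 < r := by positivity
  have hCr : C * k.L * r ≤ 1 / 4 := by
    have h1 : r ≤ 1 / (4 * (C * k.L + 1)) := min_le_right _ _
    rw [le_div_iff₀ (by positivity)] at h1
    linarith
  obtain ⟨m, hm, hle⟩ := exists_pos_le_of_periodic (F := fun u v =>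
    ‖k.f (k.L * u) - k.f (k.L * (u + v))‖) r (1 - r)
    (by have := k.continuous_f; fun_prop)
    (fun v u => by
      have h1 := k.periodic_rescaled u
      have h2 := k.periodic_rescaled (u + v)
      simp only [add_right_comm u 1 v] at *
      rw [h1, h2])
    (fun u v hv => by
      refine norm_sub_pos_iff.2 ?_
      rw [mul_add]
      refine k.f_ne_f_add _ ⟨mul_pos hL (hr0.trans_le hv.1), ?_⟩
      nlinarith [hv.2])
  refine ⟨min (m / 4) (k.L / 4), by positivity, fun g g' hper hd h0 h1 => ?_⟩
  set ε := min (m / 4) (k.L / 4) with hε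
  have hεm : ε ≤ m / 4 := min_le_left _ _
  have hεL : ε ≤ k.L / 4 := min_le_right _ _
  have hnear : ∀ x, ∀ h ∈ Ioc 0 r, g (x + h) ≠ g x := by
    intro x h hh heq
    have hbound := Convex.norm_image_sub_le_of_norm_hasDerivWithin_le
      (f := fun y => g y - (y - x) • (k.L • k.fd (k.L * x)))
      (f' := fun y => g' y - (1 : ℝ) • (k.L • k.fd (k.L * x))) (C := k.L / 2)
      (s := Icc x (x + h)) (x := x) (y := x + h)
      (fun y _ => ((hd y).sub (((hasDerivAt_id y).sub_const x).smul_const _)).hasDerivWithinAt)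
      (fun y hy => by
        have e : g' y - (1 : ℝ) • k.L • k.fd (k.L * x) =
          (g' y - k.L • k.fd (k.L * y)) + k.L • (k.fd (k.L * y) - k.fd (k.L * x)) := by module
        rw [e]
        refine (norm_add_le _ _).trans ?_
        rw [norm_smul, Real.norm_eq_abs, abs_of_pos hL]
        have h2 := hCb (k.L * y) (k.L * x)
        rw [← mul_sub, abs_mul, abs_of_pos hL, abs_of_nonneg (sub_nonneg.2 hy.1)] at h2
        have h3 : C * (k.L * (y - x)) ≤ 1 / 4 := by
          refine le_trans ?_ hCr
          rw [← mul_assoc]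
          exact mul_le_mul_of_nonneg_left (by linarith [hy.2, hh.2]) (by positivity)
        have h4 := mul_le_mul_of_nonneg_left (h2.trans h3) hL.le
        linarith [h1 y])
      (convex_Icc _ _) ⟨le_rfl, by linarith [hh.1]⟩ ⟨by linarith [hh.1], le_rfl⟩
    rw [heq] at hbound
    simp only [add_sub_cancel_left, sub_self, zero_smul, sub_zero] at hbound
    rw [sub_sub_cancel_left, norm_neg, norm_smul, norm_smul, k.unit, Real.norm_eq_abs,
      Real.norm_eq_abs, abs_of_pos hL, abs_of_pos hh.1] at hbound
    nlinarith [hh.1]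
  have hne : ∀ x, ∀ h ∈ Ioo (0 : ℝ) 1, g (x + h) ≠ g x := by
    intro x h hh
    rcases le_or_gt h r with h2 | h2
    · exact hnear x h ⟨hh.1, h2⟩
    rcases le_or_gt h (1 - r) with h3 | h3
    · intro heq
      have h4 := hle x h ⟨h2.le, h3⟩
      have h5 : ‖k.f (k.L * x) - k.f (k.L * (x + h))‖ ≤ ε + ε := by
        have e : k.f (k.L * x) - k.f (k.L * (x + h)) =
          (g (x + h) - k.f (k.L * (x + h))) - (g x - k.f (k.L * x)) := by rw [heq]; abel
        rw [e]
        exact (norm_sub_le _ _).trans (add_le_add (h0 _) (h0 _))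
      linarith
    · have h4 := hnear (x + h - 1) (1 - h) ⟨by linarith [hh.2], by linarith⟩
      rw [sub_add_sub_cancel, add_sub_cancel_right] at h4
      have h5 := hper (x + h - 1)
      rw [sub_add_cancel] at h5
      rw [h5]; exact h4.symm
  intro x hx y hy hxy
  by_contra hxy'
  rcases lt_or_gt_of_ne hxy' with h | h
  · have := hne x (y - x) ⟨by linarith, by linarith [hx.1, hy.2]⟩
    rw [add_sub_cancel] at this
    exact this hxy.symm
  · have := hne y (x - y) ⟨by linarith, by linarith [hy.1, hx.2]⟩
    rw [add_sub_cancel] at this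
    exact this hxy

/-- Knots of curvature at most `Λ` which are `C¹`-close to a knot without short double critical
pairs have ball radius at least `1 / Λ`. -/
lemma exists_one_div_le_RO_of_close {Λ : ℝ} (hΛ : 0 < Λ) (hM : 1 / Λ < MDC k.f k.fd / 2) :
    ∃ ε > 0, ∀ η : Knot n, η.L ≤ k.L → (∀ x y, ‖η.fd x - η.fd y‖ ≤ Λ * |x - y|) →
      (∀ s, ‖η.f (η.L * s) - k.f (k.L * s)‖ ≤ ε) →
      (∀ s, ‖η.L • η.fd (η.L * s) - k.L • k.fd (k.L * s)‖ ≤ ε) →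
      1 / Λ ≤ RO η.f η.fd univ := by
  have hL := k.Lpos
  set r : ℝ := Real.pi / (Λ * k.L) with hr
  have hr0 : 0 < r := by have := Real.pi_pos; positivity
  set A : ℝ → ℝ → Euc n := fun u v => k.f (k.L * u) - k.f (k.L * (u + v)) with hA
  set B : ℝ → Euc n := fun u => k.L • k.fd (k.L * u) with hB
  have hBn : ∀ u, ‖B u‖ = k.L := fun u => by
    rw [hB]; simp only []
    rw [norm_smul, k.unit, mul_one, Real.norm_eq_abs, abs_of_pos hL]
  have hAper : ∀ u v, A (u + 1) v = A u v := fun u v => by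
    have h1 := k.periodic_rescaled u
    have h2 := k.periodic_rescaled (u + v)
    simp only [hA, add_right_comm u 1 v] at *
    rw [h1, h2]
  have hBper : ∀ u, B (u + 1) = B u := fun u => by
    have h1 := k.periodic_rescaled_fd u
    simp only [hB] at *
    rw [h1]
  have hAc : Continuous fun z : ℝ × ℝ => A z.1 z.2 := by
    have := k.continuous_f; fun_prop
  have hBc : Continuous B := by
    have := k.continuous_fd; fun_prop
  obtain ⟨m, hm, hle⟩ := exists_pos_le_of_periodic (F := fun u v =>
    max (‖A u v‖ - 2 / Λ) (max |⟪A u v, B u⟫| |⟪A u v, B (u + v)⟫|)) r (1 - r)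
    (by fun_prop)
    (fun v u => by
      simp only [hAper, hBper, add_right_comm u 1 v])
    (fun u v hv => by
      by_contra hle
      obtain ⟨h1, h2⟩ := max_le_iff.1 (not_lt.1 hle)
      obtain ⟨h2, h3⟩ := max_le_iff.1 h2
      rw [abs_nonpos_iff, inner_smul_right, mul_eq_zero, or_iff_right hL.ne'] at h2 h3
      have hne : k.f (k.L * u) ≠ k.f (k.L * (u + v)) := by
        rw [mul_add]
        refine k.f_ne_f_add _ ⟨mul_pos hL (hr0.trans_le hv.1), ?_⟩
        nlinarith [hv.2]
      have h4 := k.MDC_le hne h2 h3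
      have h5 : 2 / Λ = 2 * (1 / Λ) := by ring
      linarith)
  set ε := m / (2 * (2 + 2 * k.L + 2 / Λ)) with hε
  have hε0 : 0 < ε := by positivity
  have hεm : ε * (2 + 2 * k.L + 2 / Λ) < m := by
    have : ε * (2 + 2 * k.L + 2 / Λ) = m / 2 := by rw [hε]; field_simp
    linarith
  refine ⟨ε, hε0, fun η hηL hlip h0 h1 => ?_⟩
  have hηL0 := η.Lpos
  refine η.one_div_le_RO hΛ hlip fun x h hh hd1 hd2 => ?_
  by_contra! hlt
  set u := x / η.L with hu
  set v := h / η.L with hv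
  have hxu : η.L * u = x := mul_div_cancel₀ _ hηL0.ne'
  have hxuv : η.L * (u + v) = x + h := by rw [mul_add, hxu, hv, mul_div_cancel₀ _ hηL0.ne']
  have hvr : r ≤ v := by
    have h2 : r ≤ Real.pi / Λ / η.L := by
      rw [hr, ← div_div]
      exact div_le_div_of_nonneg_left (by have := Real.pi_pos; positivity) hηL0 hηL
    exact h2.trans (by rw [hv]; gcongr; exact hh.1.le)
  have hvr' : v ≤ 1 - r := by
    have h2 : r ≤ Real.pi / Λ / η.L := by
      rw [hr, ← div_div]
      exact div_le_div_of_nonneg_left (by have := Real.pi_pos; positivity) hηL0 hηL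
    have h3 : v ≤ (η.L - Real.pi / Λ) / η.L := by rw [hv]; gcongr; exact hh.2.le
    rw [sub_div, div_self hηL0.ne'] at h3
    linarith
  set A' := η.f x - η.f (x + h) with hA'
  have hAA : ‖A u v - A'‖ ≤ 2 * ε := by
    have e : A u v - A' = (η.f (η.L * (u + v)) - k.f (k.L * (u + v))) -
        (η.f (η.L * u) - k.f (k.L * u)) := by rw [hxu, hxuv, hA']; simp only [hA]; abel
    rw [e]
    refine (norm_sub_le _ _).trans ?_
    linarith [h0 u, h0 (u + v)]
  have hcrit : ∀ s, ⟪A', η.fd (η.L * s)⟫ = 0 → |⟪A u v, B s⟫| < m := by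
    intro s hs
    have e : ⟪A u v, B s⟫ = ⟪A u v - A', B s⟫ + ⟪A', B s - η.L • η.fd (η.L * s)⟫ := by
      rw [inner_sub_left (A u v) A', inner_sub_right A' (B s), inner_smul_right A' (η.fd _), hs]; ring
    rw [e]
    refine (abs_add_le _ _).trans_lt ?_
    have h2 := abs_real_inner_le_norm (A u v - A') (B s)
    have h3 := abs_real_inner_le_norm A' (B s - η.L • η.fd (η.L * s))
    rw [hBn] at h2
    rw [norm_sub_rev (B s)] at h3
    have h4 : ‖A u v - A'‖ * k.L ≤ 2 * ε * k.L := mul_le_mul_of_nonneg_right hAA hL.le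
    have h5 : ‖A'‖ * ‖η.L • η.fd (η.L * s) - B s‖ ≤ 2 / Λ * ε :=
      mul_le_mul hlt.le (h1 s) (norm_nonneg _) (by positivity)
    nlinarith
  refine absurd (hle u v ⟨hvr, hvr'⟩) (not_le.2 (max_lt ?_ (max_lt ?_ ?_)))
  · have h2 : ‖A u v‖ ≤ ‖A u v - A'‖ + ‖A'‖ := norm_le_norm_sub_add _ _
    have h3 : 0 < 2 / Λ := by positivity
    nlinarith
  · exact hcrit u (by rw [hxu]; exact hd1)
  · exact hcrit (u + v) (by rw [hxuv]; exact hd2)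

end Knot

namespace Knot

variable {n : ℕ} (k : Knot n)

/-- A closed curve of curvature at most `Λ` whose tangent field is close to that of a knot is a knot
in the same class which is `C¹`-close to it, and its ball radius is at least `1 / Λ` as long as
the given knot has no short double critical pairs. -/
lemma exists_knot_of_tangent {Λ ε : ℝ} (hΛ : 0 < Λ) (hε : 0 < ε)
    (hM : 1 / Λ < MDC k.f k.fd / 2) :
    ∃ δ > 0, ∀ (L' : ℝ) (G : ℝ → Euc n), 0 < L' → L' ≤ k.L → |L' - k.L| ≤ δ →
      (∀ x, G (x + L') = G x) → (∀ x, ‖G x‖ = 1) → (∀ x y, ‖G x - G y‖ ≤ Λ * |x - y|) →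
      ∫ t in (0 : ℝ)..L', G t = 0 → (∀ s, ‖G (L' * s) - k.fd (k.L * s)‖ ≤ δ) →
      ∃ η : Knot n, η.L = L' ∧ SameKnotClass k η ∧
        (∀ s, ‖η.f (η.L * s) - k.f (k.L * s)‖ +
          ‖η.L • η.fd (η.L * s) - k.L • k.fd (k.L * s)‖ < ε) ∧ 1 / Λ ≤ RO η.f η.fd univ := by
  have hL := k.Lpos
  obtain ⟨ε₁, hε₁, hinj⟩ := k.exists_injOn_of_close
  obtain ⟨ε₂, hε₂, hRO⟩ := k.exists_one_div_le_RO_of_close hΛ hM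
  set μ := min (ε / 3) (min ε₁ ε₂) with hμ
  have hμ0 : 0 < μ := by positivity
  have hμε : μ ≤ ε / 3 := min_le_left _ _
  have hμ₁ : μ ≤ ε₁ := (min_le_right _ _).trans (min_le_left _ _)
  have hμ₂ : μ ≤ ε₂ := (min_le_right _ _).trans (min_le_right _ _)
  refine ⟨μ / (1 + k.L), by positivity, fun L' G hL'0 hL' hLL hper hu hlip hint hclose => ?_⟩
  have hGc : Continuous G := continuous_of_norm_sub_le hlip
  set g : ℝ → Euc n := fun t => k.f 0 + ∫ u in (0 : ℝ)..t, G u with hg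
  have hgd : ∀ s, HasDerivAt g (G s) s := fun s =>
    (intervalIntegral.integral_hasDerivAt_right (hGc.intervalIntegrable _ _)
      (hGc.stronglyMeasurableAtFilter _ _) hGc.continuousAt).const_add _
  have hperG : Function.Periodic G L' := hper
  have hgper : ∀ s, g (s + L') = g s := fun s => by
    have h1 := hperG.intervalIntegral_add_eq s 0
    rw [zero_add, hint] at h1
    simp only [hg]
    rw [← intervalIntegral.integral_add_adjacent_intervals (hGc.intervalIntegrable 0 s)
      (hGc.intervalIntegrable s (s + L')), h1, add_zero]
  have hgc : Continuous g := continuous_iff_continuousAt.2 fun s => (hgd s).continuousAt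
  set gr : ℝ → Euc n := fun s => g (L' * s) with hgr
  have hgrper : Function.Periodic gr 1 := fun s => by
    simp only [hgr, mul_add, mul_one, hgper]
  have hgrd : ∀ s, HasDerivAt gr (L' • G (L' * s)) s := fun s => by
    have h := (hgd (L' * s)).scomp s ((hasDerivAt_id s).const_mul L')
    exact h.congr_deriv (by rw [mul_one])
  have hd1 : ∀ s, ‖L' • G (L' * s) - k.L • k.fd (k.L * s)‖ ≤ μ := fun s => by
    have e : L' • G (L' * s) - k.L • k.fd (k.L * s) =
      (L' - k.L) • G (L' * s) + k.L • (G (L' * s) - k.fd (k.L * s)) := by module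
    rw [e]
    refine (norm_add_le _ _).trans ?_
    rw [norm_smul, norm_smul, hu, mul_one, Real.norm_eq_abs, Real.norm_eq_abs, abs_of_pos hL]
    refine (add_le_add hLL (mul_le_mul_of_nonneg_left (hclose s) hL.le)).trans_eq ?_
    field_simp
  have hd0 : ∀ s, ‖gr s - k.f (k.L * s)‖ ≤ μ := fun s => by
    have hp : Function.Periodic (fun s => gr s - k.f (k.L * s)) 1 :=
      hgrper.sub k.periodic_rescaled
    have h1 := hp.int_mul ⌊s⌋ (Int.fract s)
    simp only [mul_one, Int.fract_add_floor] at h1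
    rw [h1]
    set r := Int.fract s
    have hr0 : 0 ≤ r := Int.fract_nonneg s
    have hr1 : r ≤ 1 := (Int.fract_lt_one s).le
    have h2 := Convex.norm_image_sub_le_of_norm_hasDerivWithin_le
      (f := fun s => gr s - k.f (k.L * s)) (s := univ) (x := 0) (y := r)
      (fun y _ => ((hgrd y).sub (k.hasDerivAt_rescaled y)).hasDerivWithinAt)
      (fun y _ => hd1 y) convex_univ (mem_univ _) (mem_univ _)
    have h3 : gr 0 - k.f (k.L * 0) = 0 := by simp [hgr, hg]
    simp only [h3, sub_zero, Real.norm_eq_abs, abs_of_nonneg hr0] at h2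
    exact h2.trans (mul_le_of_le_one_right hμ0.le hr1)
  have hmix : ∀ t ∈ Icc (0 : ℝ) 1,
      InjOn (fun s => (1 - t) • k.f (k.L * s) + t • gr s) (Ico 0 1) := by
    intro t ht
    refine hinj _ (fun s => (1 - t) • (k.L • k.fd (k.L * s)) + t • (L' • G (L' * s))) ?_
      (fun s => ((k.hasDerivAt_rescaled s).const_smul (1 - t)).add ((hgrd s).const_smul t))
      (fun s => ?_) fun s => ?_
    · intro s
      have h1 := k.periodic_rescaled s
      have h2 := hgrper s
      simp only at h1
      simp only [h1, h2]
    · have e : (1 - t) • k.f (k.L * s) + t • gr s - k.f (k.L * s) =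
        t • (gr s - k.f (k.L * s)) := by module
      rw [e, norm_smul, Real.norm_eq_abs, abs_of_nonneg ht.1]
      exact (mul_le_of_le_one_left (norm_nonneg _) ht.2).trans ((hd0 s).trans hμ₁)
    · have e : (1 - t) • (k.L • k.fd (k.L * s)) + t • (L' • G (L' * s)) - k.L • k.fd (k.L * s) =
        t • (L' • G (L' * s) - k.L • k.fd (k.L * s)) := by module
      rw [e, norm_smul, Real.norm_eq_abs, abs_of_nonneg ht.1]
      exact (mul_le_of_le_one_left (norm_nonneg _) ht.2).trans ((hd1 s).trans hμ₁)
  have hginj : InjOn g (Ico 0 L') := by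
    intro x hx y hy hxy
    have h1 := hmix 1 ⟨zero_le_one, le_rfl⟩
    have hm : ∀ z ∈ Ico 0 L', z / L' ∈ Ico (0 : ℝ) 1 := fun z hz =>
      ⟨div_nonneg hz.1 hL'0.le, (div_lt_one hL'0).2 hz.2⟩
    have h2 := h1 (hm x hx) (hm y hy) (by
      simp only [hgr, mul_div_cancel₀ _ hL'0.ne', hxy, sub_self, zero_smul])
    exact (div_left_inj' hL'0.ne').1 h2
  refine ⟨⟨L', hL'0, g, G, hgper, hper, hgd, hu, ⟨Λ.toNNReal, LipschitzWith.of_dist_le_mul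
    fun x y => ?_⟩, hginj⟩, rfl, ⟨fun t s => (1 - t) • k.f (k.L * s) + t • gr s, ?_, fun t s => ?_,
      fun s => ?_, fun s => ?_, hmix⟩, fun s => ?_, hRO _ hL' hlip (fun s => (hd0 s).trans hμ₂)
      fun s => (hd1 s).trans hμ₂⟩
  · rw [dist_eq_norm, Real.dist_eq, Real.coe_toNNReal _ hΛ.le]; exact hlip x y
  · have := k.continuous_f
    exact Continuous.continuousOn (by fun_prop)
  · have h1 := k.periodic_rescaled s
    have h2 := hgrper s
    simp only at h1
    simp only [h1, h2]
  · simp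
  · simp [hgr]
  · have h0 := hd0 s
    have h1 := hd1 s
    simp only [hgr] at h0 ⊢
    linarith

/-- If a relatively extremal knot of curvature at most `Λ` has no short double critical pairs and
ball radius `1 / Λ`, then its curvature is at least `Λ` everywhere. -/
lemma le_curvAt_of_relativelyExtremal (hext : RelativelyExtremal k) {Λ : ℝ} (hΛ : 0 < Λ)
    (hlip : ∀ x y, ‖k.fd x - k.fd y‖ ≤ Λ * |x - y|) (hRO : RO k.f k.fd univ = 1 / Λ)
    (hM : 1 / Λ < MDC k.f k.fd / 2) (s : ℝ) : Λ ≤ curvAt k.fd univ s := by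
  have hL := k.Lpos
  by_contra! hlt
  obtain ⟨Λ', hΛ', hΛ'0, ρ, hρ, hang⟩ := exists_local_angle_le k hlt
  obtain ⟨ε, hε, hmin⟩ := hext
  obtain ⟨δ, hδ, hknot⟩ := k.exists_knot_of_tangent hΛ hε hM
  set r := min (ρ / 2) k.L with hr
  have hr0 : 0 < r := by positivity
  have hrρ : r ≤ ρ / 2 := min_le_left _ _
  have hlip' : ∀ x ∈ Icc s (s + r), ∀ y ∈ Icc s (s + r), ‖k.fd x - k.fd y‖ ≤ Λ' * |x - y| := by
    intro x hx y hy
    rcases eq_or_ne x y with rfl | hxy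
    · simp
    refine (norm_sub_le_angle (k.unit x) (k.unit y)).trans (hang x y hxy ?_ ?_)
    · rw [abs_lt]; constructor <;> linarith [hx.1, hx.2]
    · rw [abs_lt]; constructor <;> linarith [hy.1, hy.2]
  have hclosed : ∫ t in s..(s + k.L), k.fd t = 0 := by
    rw [intervalIntegral.integral_eq_sub_of_hasDerivAt (fun t _ => k.deriv t)
      (k.continuous_fd.intervalIntegrable _ _), k.per, sub_self]
  set δ' := min (1 / 2) (min (δ / k.L) (δ / (1 + 2 * Λ * k.L))) with hδ'
  obtain ⟨ℓ, hℓ, hv⟩ := TangentVariation.exists_shorter (δ := δ') hΛ' hΛ'0 (by positivity)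
    (by linarith : s < s + r) (by linarith [min_le_right (ρ / 2) k.L] : s + r ≤ s + k.L) k.unit hlip
    hlip' (k.perd s) hclosed
  obtain ⟨L', G, hL'0, hL'ℓ, hLL, hper, hu, hGlip, hint, hclose⟩ :=
    hv.exists_periodic hΛ hL (min_le_left _ _) k.perd
  have hδ1 : δ' * k.L ≤ δ :=
    (le_div_iff₀ hL).1 ((min_le_right _ _).trans (min_le_left _ _))
  have hδ2 : (1 + 2 * Λ * k.L) * δ' ≤ δ := by
    rw [mul_comm]
    exact (le_div_iff₀ (by positivity)).1 ((min_le_right _ _).trans (min_le_right _ _))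
  have hlt' : L' < k.L := by linarith
  obtain ⟨η, hηL, hclass, hηε, hηRO⟩ := hknot L' G hL'0 hlt'.le (hLL.trans hδ1) hper hu hGlip hint
    fun t => (hclose t).trans hδ2
  have h := hmin η hclass hηε
  unfold ropelength at h
  rw [hRO, hηL] at h
  have h1 : L' / RO η.f η.fd univ ≤ L' / (1 / Λ) :=
    div_le_div_of_nonneg_left hL'0.le (by positivity) hηRO
  have h2 : L' / (1 / Λ) < k.L / (1 / Λ) := div_lt_div_of_pos_right hlt' (by positivity)
  linarith

end Knot

/-- For a relatively extremal knot whose generalized curvature is not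
identically `R_O(K)⁻¹`, the thickness equals `MDC(K)/2`; equivalently, if
`MDC(K)/2 > R_O(K) = F_k(γ)` then `κγ ≡ F_k(γ)⁻¹`. -/
theorem statement_4 {n : ℕ} (hn : 2 ≤ n) (γ : Knot n)
    (hext : RelativelyExtremal γ) :
    ((¬ ∀ s : ℝ, curvAt γ.fd Set.univ s = (RO γ.f γ.fd Set.univ)⁻¹) →
      injRad γ.f γ.fd = MDC γ.f γ.fd / 2) ∧
    ((MDC γ.f γ.fd / 2 > RO γ.f γ.fd Set.univ ∧ RO γ.f γ.fd Set.univ = γ.Fk) →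
      ∀ s : ℝ, curvAt γ.fd Set.univ s = (γ.Fk)⁻¹) := by
  have hcurv : MDC γ.f γ.fd / 2 > RO γ.f γ.fd Set.univ ∧ RO γ.f γ.fd Set.univ = γ.Fk →
      ∀ s : ℝ, curvAt γ.fd Set.univ s = (γ.Fk)⁻¹ := by
    rintro ⟨hM, hRO⟩ s
    unfold Knot.Fk at hRO ⊢
    rw [hRO] at hM
    rw [inv_inv]
    rw [← one_div] at hRO hM
    exact le_antisymm (γ.curvAt_le_supCurv s)
      (γ.le_curvAt_of_relativelyExtremal hext γ.supCurv_pos γ.norm_sub_le_supCurv hRO hM s)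
  refine ⟨fun hne => ?_, hcurv⟩
  have hmin := γ.min_le_RO γ.supCurv_pos γ.norm_sub_le_supCurv
  rcases le_or_gt (MDC γ.f γ.fd / 2) (1 / γ.supCurv) with h | h
  · rw [min_eq_right h] at hmin
    exact le_antisymm γ.injRad_le_half_MDC (hmin.trans γ.RO_le_injRad)
  · rw [min_eq_left h.le] at hmin
    have hpos : 0 < RO γ.f γ.fd univ := (one_div_pos.2 γ.supCurv_pos).trans_le hmin
    have hsup : γ.supCurv ≤ (RO γ.f γ.fd univ)⁻¹ := ciSup_le fun s => γ.curvAt_le_inv_RO hpos s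
    have hRO : RO γ.f γ.fd univ = γ.Fk := by
      refine le_antisymm ?_ (by rwa [one_div] at hmin)
      exact le_inv_of_le_inv₀ γ.supCurv_pos hsup
    refine absurd (fun s => ?_) hne
    rw [hRO]
    refine hcurv ⟨?_, hRO⟩ s
    rw [hRO, Knot.Fk, ← one_div]; exact h
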